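/- Let $K$ be an algebraically closed field, of any characteristic, complete with respect to a non-trivial (archimedean or non-archimedean) absolute value $|\cdot|$. Let $\mathsf P^1=\mathsf P^1(K)\supset\mathbb P^1=\mathbb P^1(K)$ be the Berkovich projective line (so $\mathsf P^1=\mathbb P^1$ if $K$ is archimedean). Let $\|\cdot\|$ be the maximum norm on $K^2$ if $K$ is non-archimedean and the Euclidean norm $\sqrt{|p_0|^2+|p_1|^2}$ if $K$ is archimedean, and let $[z,w]=|p\wedge q|/(\|p\|\,\|q\|)$ be the normalized chordal metric on $\mathbb P^1$, where $p,q\in K^2\setminus\{0\}$ are homogeneous coordinates of $z,w$. Let $[\cdot,\cdot]_{\mathrm{can}}$ be its extension to $\mathsf P^1$, the generalized Hsia kernel with respect to the canonical (Gauss) point ($[\cdot,\cdot]_{\mathrm{can}}=[\cdot,\cdot]$ if $K$ is archimedean). Let $\Omega_{\mathrm{can}}$ be the Dirac measure at the canonical point if $K$ is non-archimedean, and the normalized Fubini--Study area element if $K$ is archimedean, that is, if $K=\mathbb C$ (if the absolute value is the $s$-th power of the usual one, $0<s\le 1$, this means the curvature measure $\frac{s}{\pi}|z|_\infty^{2s-2}(1+|z|_\infty^{2s})^{-2}\,dA(z)$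 of $\log\|(z,1)\|$, where $|\cdot|_\infty$ denotes the usual absolute value). Let $\Delta$ be the Laplacian on $\mathsf P^1$, normalized so that $\Delta\log[\cdot,\mathcal S]_{\mathrm{can}}=\delta_{\mathcal S}-\Omega_{\mathrm{can}}$ for every $\mathcal S\in\mathsf P^1$. For a continuous function $g:\mathsf P^1\to\mathbb R$ put $\Phi_g(\mathcal S,\mathcal S')=\log[\mathcal S,\mathcal S']_{\mathrm{can}}-g(\mathcal S)-g(\mathcal S')$ and $U_{g,\nu}=\int_{\mathsf P^1}\Phi_g(\cdot,\mathcal S)\,d\nu(\mathcal S)$ for a Radon measure $\nu$ on $\mathsf P^1$, and let $V_g=\sup_\nu\int\Phi_g\,d(\nu\times\nu)$, the supremum being over all probability Radon measures $\nu$ on $\mathsf P^1$. Let $f\in K(z)$ be a rational function of degree $d>1$, extended continuously to $\mathsf P^1$. Let $F$ be a non-degenerate homogeneous lift of $f$ to $K^2$, let $T_{F^n}$ be the continuous extension to $\mathsf P^1$ of the function on $\mathbb P^1$ induced by $\log\|F^n\|-d^n\log\|\cdot\|$, and put $g_F=\lim_{n\to\infty}T_{F^n}/d^n$. Let $\mu_f=\Delta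 g_F+\Omega_{\mathrm{can}}$ be the equilibrium (canonical) measure of $f$, a probability Radon measure on $\mathsf P^1$ that does not depend on $F$, and let $g_f$ be the dynamical Green function of $f$, i.e. the unique continuous function on $\mathsf P^1$ with $\Delta g_f+\Omega_{\mathrm{can}}=\mu_f$ and $V_{g_f}=0$. For every integer $n\ge 1$, let $[f^n,\mathrm{Id}]_{\mathrm{can}}$ be the continuous extension to $\mathsf P^1$ of $z\mapsto[f^n(z),z]$ on $\mathbb P^1$, put $\Phi(f^n,\mathrm{Id})_{g_f}=\log[f^n,\mathrm{Id}]_{\mathrm{can}}-g_f\circ f^n-g_f$, and let $[f^n=\mathrm{Id}]=\sum_{w\in\mathbb P^1:\,f^n(w)=w}\delta_w$, where each root $w$ of $f^n=\mathrm{Id}$ is counted with its multiplicity. Then for every integer $n\ge1$, $$\Phi(f^n,\mathrm{Id})_{g_f}(\cdot)=U_{g_f,[f^n=\mathrm{Id}]}(\cdot)+\int_{\mathsf P^1}\Phi(f^n,\mathrm{Id})_{g_f}\,d\mu_f\quad\text{on }\mathsf P^1,$$ as an equality of functions with values in $[-\infty,\infty)$. -/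

import Mathlib

open Polynomial MeasureTheory Filter Topology
open scoped ENNReal ContDiff Laplacian

noncomputable section

namespace BerkovichDynamics

/-! ### The Berkovich projective line -/

/-- The Berkovich affine line over `K`: the multiplicative seminorms on `K[T]` that extend the
absolute value of `K`. -/
def BerkovichA1 (K : Type*) [NontriviallyNormedField K] : Type _ :=
  {s : MulRingSeminorm K[X] // ∀ a : K, s (C a) = ‖a‖}

/-- The topology of pointwise convergence on `K[T]`. -/
instance (K : Type*) [NontriviallyNormedField K] : TopologicalSpace (BerkovichA1 K) :=
  TopologicalSpace.induced (fun (s : BerkovichA1 K) (P : K[X]) => s.1 P) inferInstance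

/-- The Berkovich projective line `𝖯¹(K)`: the one-point compactification of the (locally compact
Hausdorff) Berkovich affine line. -/
abbrev BerkovichP1 (K : Type*) [NontriviallyNormedField K] : Type _ := OnePoint (BerkovichA1 K)

instance (K : Type*) [NontriviallyNormedField K] : MeasurableSpace (BerkovichP1 K) := borel _

instance (K : Type*) [NontriviallyNormedField K] : BorelSpace (BerkovichP1 K) := ⟨rfl⟩

section Line

variable {K : Type*} [NontriviallyNormedField K]

/-- The seminorm `P ↦ |P(a)|` of a classical point `a ∈ K`. -/
def evalPoint (a : K) : BerkovichA1 K :=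
  ⟨{ toFun := fun P => ‖P.eval a‖
     map_zero' := by simp
     add_le' := fun P Q => by simpa using norm_add_le (P.eval a) (Q.eval a)
     neg' := fun P => by simp
     map_one' := by simp
     map_mul' := fun P Q => by simp }, fun b => by
      change ‖(C b).eval a‖ = ‖b‖
      simp⟩

/-- The embedding `ℙ¹(K) = K ∪ {∞} → 𝖯¹(K)`. Here `OnePoint K` is used only as a set: its
topology plays no role. -/
def classical : OnePoint K → BerkovichP1 K := OnePoint.map evalPoint

/-- The absolute value of `K`, as an `AbsoluteValue`. -/
def absValue (K : Type*) [NontriviallyNormedField K] : AbsoluteValue K ℝ where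
  toFun := norm
  map_mul' := norm_mul
  nonneg' := norm_nonneg
  eq_zero' _ := norm_eq_zero
  add_le' := norm_add_le

/-- The canonical (Gauss) point of `𝖯¹(K)`, for non-archimedean `K`: the seminorm
`∑ aᵢ Tⁱ ↦ max |aᵢ|`. -/
def gaussPoint (K : Type*) [NontriviallyNormedField K] (h : IsUltrametricDist K) :
    BerkovichP1 K :=
  have hna : IsNonarchimedean (absValue K) := fun x y =>
    IsUltrametricDist.norm_add_le_max x y
  have abv : IsAbsoluteValue (Polynomial.gaussNorm (absValue K) 1) :=
    Polynomial.gaussNorm_isAbsoluteValue hna one_pos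
  OnePoint.some
    ⟨{ toFun := Polynomial.gaussNorm (absValue K) 1
       map_zero' := by simp
       add_le' := abv.abv_add'
       neg' := fun P => IsAbsoluteValue.abv_neg (Polynomial.gaussNorm (absValue K) 1) P
       map_one' := IsAbsoluteValue.abv_one (Polynomial.gaussNorm (absValue K) 1)
       map_mul' := abv.abv_mul' }, fun a => Polynomial.gaussNorm_C (absValue K) 1 a⟩

/-- The extension to `𝖯¹` of a function `u` on `ℙ¹` by continuity:
`x ↦ lim u(z)` as `ℙ¹ ∋ z → x` in `𝖯¹`. -/
def contExt {Y : Type*} [TopologicalSpace Y] [Nonempty Y] (u : OnePoint K → Y)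
    (x : BerkovichP1 K) : Y :=
  limUnder (comap classical (𝓝 x)) u

/-! ### The chordal metric and the generalized Hsia kernel -/

open Classical in
/-- The norm on `K²` in terms of the absolute values of the coordinates: the maximum norm for
non-archimedean `K`, the Euclidean norm for archimedean `K`. -/
def norm2 (K : Type*) [NontriviallyNormedField K] (a b : ℝ) : ℝ :=
  if IsUltrametricDist K then max a b else Real.sqrt (a ^ 2 + b ^ 2)

/-- The norm `‖(p₀,p₁)‖` on `K²`. -/
def pairNorm (p : K × K) : ℝ := norm2 K ‖p.1‖ ‖p.2‖

/-- Homogeneous coordinates: `z ↦ (z, 1)` and `∞ ↦ (1, 0)`. -/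
def homCoord (z : OnePoint K) : K × K := z.elim (1, 0) (fun a => (a, 1))

open Classical in
/-- The canonical projection `π : K² ∖ {0} → ℙ¹`, `(p₀, p₁) ↦ p₀ / p₁`. -/
def proj (p : K × K) : OnePoint K := if p.2 = 0 then OnePoint.infty else OnePoint.some (p.1 / p.2)

/-- The normalized chordal metric `[z,w] = |p ∧ q| / (‖p‖ ‖q‖)` on `ℙ¹`. -/
def chordal (z w : OnePoint K) : ℝ :=
  ‖(homCoord z).1 * (homCoord w).2 - (homCoord z).2 * (homCoord w).1‖ /
    (pairNorm (homCoord z) * pairNorm (homCoord w))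

/-- The chordal distance `[x, q]` of `x ∈ 𝖯¹` to a classical point `q = π(q₀,q₁)`, namely
`[q₁ T - q₀]_x / (max([T]_x, 1) ‖(q₀,q₁)‖)` for `x` in the affine line (where, in the archimedean
case, `max` is replaced by the Euclidean norm); it extends `z ↦ [z, q]`. -/
def chordalTo (x : BerkovichP1 K) (q : OnePoint K) : ℝ :=
  x.elim (‖(homCoord q).2‖ / pairNorm (homCoord q))
    (fun s => s.1 (C (homCoord q).2 * X - C (homCoord q).1) /
      (norm2 K (s.1 X) 1 * pairNorm (homCoord q)))

open Classical in
/-- The generalized Hsia kernel `[x,y]_can` with respect to the canonical point. For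
non-archimedean `K` this is the chordal diameter of the smallest chordal ball that contains both
`x` and `y`, that is, the infimum over the centers `q ∈ ℙ¹` of `max [x,q] [y,q]`. For archimedean
`K`, every point of `𝖯¹` is classical and `[·,·]_can` is the chordal metric. -/
def hsia (x y : BerkovichP1 K) : ℝ :=
  if IsUltrametricDist K then ⨅ q : OnePoint K, max (chordalTo x q) (chordalTo y q)
  else chordal (Function.invFun classical x) (Function.invFun classical y)

/-! ### The measure `Ω_can` and the Laplacian -/

/-- For archimedean `K`, the exponent `s ∈ (0,1]` such that `|·|` is the `s`-th power of the usual
absolute value of `ℂ` (so `s = 1` if `K` is `ℂ` with its usual absolute value). -/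
def absExponent (K : Type*) [NontriviallyNormedField K] : ℝ := Real.logb 2 ‖(2 : K)‖

/-- The affine chart `z ↦ z` of the Riemann sphere, for archimedean `K` identified with `ℂ`
through `e`. -/
def chartZero (e : K ≃+* ℂ) (z : ℂ) : BerkovichP1 K := classical (proj (e.symm z, 1))

/-- The affine chart `z ↦ 1/z` of the Riemann sphere at `∞`, for archimedean `K` identified with
`ℂ` through `e`. -/
def chartInfty (e : K ≃+* ℂ) (z : ℂ) : BerkovichP1 K := classical (proj (1, e.symm z))

open Classical in
/-- The measure `Ω_can`: the Dirac measure at the canonical point for non-archimedean `K`; for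
archimedean `K`, identified with `ℂ`, the normalized Fubini--Study area element
`π⁻¹ (1 + |z|²)⁻² dA(z)`. The latter is the curvature form of `log ‖(z,1)‖`, which for the absolute
value `|·|^s` reads `(s/π) |z|^(2s-2) (1 + |z|^(2s))⁻² dA(z)`. (The last case of the definition
does not occur: a complete algebraically closed archimedean field is `ℂ`.) -/
def omegaCan (K : Type*) [NontriviallyNormedField K] : Measure (BerkovichP1 K) :=
  if h : IsUltrametricDist K then Measure.dirac (gaussPoint K h)
  else if h : ∃ e : K ≃+* ℂ, Continuous e then
    ((volume : Measure ℂ).withDensity fun z => ENNReal.ofReal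
      (absExponent K / Real.pi * ‖z‖ ^ (2 * absExponent K - 2) /
        (1 + ‖z‖ ^ (2 * absExponent K)) ^ 2)).map (chartZero h.choose)
  else 0

open Classical in
/-- `Δ g = μ - ν` on `𝖯¹`, for a continuous function `g` and probability Radon measures `μ`, `ν`,
in the sense of duality with test functions, with `Δ` normalized so that
`Δ log [·,S]_can = δ_S - Ω_can`.

For non-archimedean `K` the test functions are the bounded continuous functions
`log [·,S]_can - log [·,S']_can`, with `S, S'` in the hyperbolic space `𝖯¹ ∖ ℙ¹`, whose
Laplacian is `δ_S - δ_{S'}`.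

For archimedean `K`, identified with `ℂ`, it is the distributional Laplacian on the Riemann sphere,
tested against smooth functions with compact support in one of the two affine charts; the factor
`1/(2πs)` normalizes `Δ log |z - w| = δ_w` (it is `1/(2π)` for the usual absolute value). -/
def HasLaplacian (g : BerkovichP1 K → ℝ) (μ ν : Measure (BerkovichP1 K)) : Prop :=
  if IsUltrametricDist K then
    ∀ S S' : BerkovichP1 K, S ∉ Set.range (classical (K := K)) →
      S' ∉ Set.range (classical (K := K)) →
      (∫ y, (Real.log (hsia y S) - Real.log (hsia y S')) ∂μ)
        - ∫ y, (Real.log (hsia y S) - Real.log (hsia y S')) ∂ν = g S - g S'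
  else
    ∀ e : K ≃+* ℂ, Continuous e → ∀ χ : ℂ → BerkovichP1 K, χ = chartZero e ∨ χ = chartInfty e →
      ∀ φ : ℂ → ℝ, ContDiff ℝ ∞ φ → HasCompactSupport φ →
        (∫ x, Function.extend χ φ 0 x ∂μ) - ∫ x, Function.extend χ φ 0 x ∂ν =
          (2 * Real.pi * absExponent K)⁻¹ * ∫ z, g (χ z) * (Δ φ : ℂ → ℝ) z

/-! ### Weighted potential theory -/

/-- The logarithm `[0,∞) → [-∞,∞)`, with `log 0 = -∞`. -/
def elog (t : ℝ) : EReal := ENNReal.log (ENNReal.ofReal t)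

/-- The Lebesgue integral `∫ φ⁺ dμ - ∫ φ⁻ dμ` of an extended-real function. -/
def eintegral {X : Type*} [MeasurableSpace X] (μ : Measure X) (φ : X → EReal) : EReal :=
  ((∫⁻ x, (φ x).toENNReal ∂μ : ℝ≥0∞) : EReal) - ((∫⁻ x, (-φ x).toENNReal ∂μ : ℝ≥0∞) : EReal)

/-- The `g`-potential kernel `Φ_g(x,y) = log [x,y]_can - g(x) - g(y)`. -/
def potentialKernel (g : BerkovichP1 K → ℝ) (x y : BerkovichP1 K) : EReal :=
  elog (hsia x y) - (g x : EReal) - (g y : EReal)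

/-- The `g`-potential `U_{g,ν}(x) = ∫ Φ_g(x,·) dν`. -/
def potential (g : BerkovichP1 K → ℝ) (ν : Measure (BerkovichP1 K)) (x : BerkovichP1 K) : EReal :=
  eintegral ν (potentialKernel g x)

/-- The `g`-energy `∫ Φ_g d(ν × ν)`, as the iterated integral `∫ (∫ Φ_g(x,y) dν(y)) dν(x)`. -/
def energy (g : BerkovichP1 K → ℝ) (ν : Measure (BerkovichP1 K)) : EReal :=
  eintegral ν (potential g ν)

/-- The `g`-equilibrium energy `V_g`: the supremum of the `g`-energy over all probability Radon
measures on `𝖯¹`. -/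
def equilibriumEnergy (g : BerkovichP1 K → ℝ) : EReal :=
  ⨆ (ν : Measure (BerkovichP1 K)) (_ : IsProbabilityMeasure ν) (_ : ν.Regular), energy g ν

/-- `g` is a continuous weight with `μ^g = Δ g + Ω_can = μ`, a probability Radon measure. -/
structure IsContinuousWeight (g : BerkovichP1 K → ℝ) (μ : Measure (BerkovichP1 K)) : Prop where
  continuous : Continuous g
  isProbabilityMeasure : IsProbabilityMeasure μ
  regular : μ.Regular
  laplacian : HasLaplacian g μ (omegaCan K)

/-! ### Dynamics of a rational function -/

/-- The degree of a rational function. -/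
def ratDegree (f : RatFunc K) : ℕ := max f.num.natDegree f.denom.natDegree

/-- The non-degenerate homogeneous lift `F = (F₀, F₁)` of `f` of degree `d = deg f` given by
homogenizing the coprime numerator and denominator of `f`, as a self-map of `R²` for every
`K`-algebra `R`. -/
def homLift (f : RatFunc K) {R : Type*} [CommRing R] [Algebra K R] (p : R × R) : R × R :=
  (∑ i ∈ Finset.range (ratDegree f + 1), f.num.coeff i • (p.1 ^ i * p.2 ^ (ratDegree f - i)),
   ∑ i ∈ Finset.range (ratDegree f + 1), f.denom.coeff i • (p.1 ^ i * p.2 ^ (ratDegree f - i)))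

/-- The action of `f` on `ℙ¹`, characterized by `π ∘ F = f ∘ π`. -/
def ratMap (f : RatFunc K) (z : OnePoint K) : OnePoint K := proj (homLift f (homCoord z))

/-- The action of `f` on `𝖯¹`, extending by continuity that on `ℙ¹`. -/
def berkMap (f : RatFunc K) : BerkovichP1 K → BerkovichP1 K :=
  contExt fun z => classical (ratMap f z)

/-- `T_{Fⁿ} = log ‖Fⁿ‖ - dⁿ log ‖·‖` on `ℙ¹`. -/
def logHomLift (f : RatFunc K) (n : ℕ) (z : OnePoint K) : ℝ :=
  Real.log (pairNorm ((homLift f)^[n] (homCoord z)))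
    - (ratDegree f : ℝ) ^ n * Real.log (pairNorm (homCoord z))

/-- `g_F = lim T_{Fⁿ} / dⁿ` on `𝖯¹`, where `T_{Fⁿ}` is extended continuously to `𝖯¹`. -/
def liftGreen (f : RatFunc K) (x : BerkovichP1 K) : ℝ :=
  limUnder atTop fun n : ℕ => contExt (logHomLift f n) x / (ratDegree f : ℝ) ^ n

/-- `μ` is the equilibrium (canonical) measure of `f`: the probability Radon measure
`μ_f = Δ g_F + Ω_can`. -/
structure IsEquilibriumMeasure (f : RatFunc K) (μ : Measure (BerkovichP1 K)) : Prop where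
  isProbabilityMeasure : IsProbabilityMeasure μ
  regular : μ.Regular
  laplacian : HasLaplacian (liftGreen f) μ (omegaCan K)

/-- `g` is the normalized weight with `Δ g + Ω_can = μ`, that is `μ^g = μ` and `V_g = 0`; for
`μ = μ_f` this is the dynamical Green function `g_f` of `f`. -/
structure IsNormalizedWeight (g : BerkovichP1 K → ℝ) (μ : Measure (BerkovichP1 K)) : Prop extends
    IsContinuousWeight g μ where
  equilibriumEnergy_eq_zero : equilibriumEnergy g = 0

/-- `[fⁿ, Id]_can`, the continuous extension to `𝖯¹` of `z ↦ [fⁿ(z), z]`. -/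
def proximity (f : RatFunc K) (n : ℕ) : BerkovichP1 K → ℝ :=
  contExt fun z => chordal ((ratMap f)^[n] z) z

/-- The logarithmic proximity function
`Φ(fⁿ, Id)_g = log [fⁿ, Id]_can - g ∘ fⁿ - g` weighted by `g`. -/
def logProximity (f : RatFunc K) (n : ℕ) (g : BerkovichP1 K → ℝ) (x : BerkovichP1 K) : EReal :=
  elog (proximity f n x) - (g ((berkMap f)^[n] x) : EReal) - (g x : EReal)

/-- The polynomial `Pₙ - T Qₙ`, where `fⁿ = Pₙ / Qₙ` with `(Pₙ, Qₙ) = Fⁿ(T, 1)`. -/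
def fixPoly (f : RatFunc K) (n : ℕ) : K[X] :=
  ((homLift f)^[n] ((X : K[X]), (1 : K[X]))).1 - X * ((homLift f)^[n] ((X : K[X]), (1 : K[X]))).2

/-- The multiplicity of `w ∈ ℙ¹` as a root of `fⁿ = Id`, i.e. as a zero of the form
`Fⁿ(p) ∧ p` of degree `dⁿ + 1`: the multiplicity of `w` as a root of `Pₙ - T Qₙ` if `w ∈ K`, and
`dⁿ + 1 - deg (Pₙ - T Qₙ)` if `w = ∞`. -/
def fixMult (f : RatFunc K) (n : ℕ) (w : OnePoint K) : ℕ :=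
  w.elim (ratDegree f ^ n + 1 - (fixPoly f n).natDegree) (fun a => (fixPoly f n).rootMultiplicity a)

/-- The measure `[fⁿ = Id] = ∑ δ_w` on `𝖯¹`, the sum being over the roots `w ∈ ℙ¹` of `fⁿ = Id`
with multiplicity. -/
def fixMeasure (f : RatFunc K) (n : ℕ) : Measure (BerkovichP1 K) :=
  Measure.sum fun w : OnePoint K => (fixMult f n w : ℝ≥0∞) • Measure.dirac (classical w)

end Line

end BerkovichDynamics

end

open BerkovichDynamics

noncomputable section

namespace BerkovichDynamics

/-! ### Topology of the Berkovich line -/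

section Topology

variable {K : Type*} [NontriviallyNormedField K]

theorem BerkovichA1.isEmbedding_coe :
    IsEmbedding fun (s : BerkovichA1 K) (P : K[X]) => s.1 P :=
  ⟨⟨rfl⟩, fun _ _ h => Subtype.ext (DFunLike.coe_injective h)⟩

theorem BerkovichA1.continuous_apply (P : K[X]) : Continuous fun s : BerkovichA1 K => s.1 P :=
  (_root_.continuous_apply P).comp BerkovichA1.isEmbedding_coe.continuous

theorem BerkovichA1.ext {s t : BerkovichA1 K} (h : ∀ P, s.1 P = t.1 P) : s = t :=
  BerkovichA1.isEmbedding_coe.injective (funext h)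

instance : T2Space (BerkovichA1 K) := BerkovichA1.isEmbedding_coe.t2Space

theorem BerkovichA1.apply_sum_le (s : BerkovichA1 K) (c : ℕ → K) (n : ℕ) :
    s.1 (∑ i ∈ Finset.range n, C (c i) * X ^ i) ≤ ∑ i ∈ Finset.range n, ‖c i‖ * s.1 X ^ i := by
  refine (Finset.le_sum_of_subadditive (fun P => s.1 P) (map_zero s.1).le
    (fun P Q => map_add_le_add s.1 P Q) _ _).trans (le_of_eq ?_)
  simp [map_mul, map_pow, s.2]

theorem BerkovichA1.apply_le (s : BerkovichA1 K) (P : K[X]) :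
    s.1 P ≤ ∑ i ∈ Finset.range (P.natDegree + 1), ‖P.coeff i‖ * s.1 X ^ i := by
  conv_lhs => rw [P.as_sum_range_C_mul_X_pow]
  exact s.apply_sum_le _ _

theorem BerkovichA1.isCompact_setOf_le (R : ℝ) : IsCompact {s : BerkovichA1 K | s.1 X ≤ R} := by
  rw [BerkovichA1.isEmbedding_coe.isInducing.isCompact_iff]
  set B : K[X] → ℝ := fun P => ∑ i ∈ Finset.range (P.natDegree + 1), ‖P.coeff i‖ * R ^ i
  have hcpt : IsCompact (Set.univ.pi fun P : K[X] => Set.Icc 0 (B P)) :=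
    isCompact_univ_pi fun _ => isCompact_Icc
  set Z : Set (K[X] → ℝ) := {φ | (∀ P, φ P ∈ Set.Icc 0 (B P)) ∧ φ 0 = 0 ∧ φ 1 = 1 ∧
    (∀ P, φ (-P) = φ P) ∧ (∀ P Q, φ (P + Q) ≤ φ P + φ Q) ∧ (∀ P Q, φ (P * Q) = φ P * φ Q) ∧
    (∀ a, φ (C a) = ‖a‖) ∧ φ X ≤ R} with hZ
  have hZc : IsClosed Z := by
    simp only [hZ, Set.ofPred_and, Set.ofPred_forall, Set.mem_Icc]
    have c (P : K[X]) : Continuous fun φ : K[X] → ℝ => φ P := _root_.continuous_apply P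
    refine IsClosed.inter (isClosed_iInter fun P => (isClosed_le continuous_const (c _)).inter
      (isClosed_le (c _) continuous_const)) ?_
    refine (isClosed_eq (c _) continuous_const).inter ?_
    refine (isClosed_eq (c _) continuous_const).inter ?_
    refine (isClosed_iInter fun P => isClosed_eq (c _) (c _)).inter ?_
    refine (isClosed_iInter fun P => isClosed_iInter fun Q =>
      isClosed_le (c _) ((c _).add (c _))).inter ?_
    refine (isClosed_iInter fun P => isClosed_iInter fun Q =>
      isClosed_eq (c _) ((c _).mul (c _))).inter ?_
    exact (isClosed_iInter fun a => isClosed_eq (c _) continuous_const).inter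
      (isClosed_le (c _) continuous_const)
  have hsub : Z ⊆ Set.univ.pi fun P : K[X] => Set.Icc 0 (B P) := fun φ hφ P _ => hφ.1 P
  convert hcpt.of_isClosed_subset hZc hsub using 1
  ext φ
  constructor
  · rintro ⟨s, hs, rfl⟩
    refine ⟨fun P => ⟨apply_nonneg s.1 P, (s.apply_le P).trans ?_⟩, map_zero s.1, map_one s.1,
      fun P => map_neg_eq_map s.1 P, fun P Q => map_add_le_add s.1 P Q, fun P Q => map_mul s.1 P Q,
      s.2, hs⟩
    exact Finset.sum_le_sum fun i _ => mul_le_mul_of_nonneg_left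
      (pow_le_pow_left₀ (apply_nonneg s.1 X) hs i) (norm_nonneg _)
  · rintro ⟨-, h0, h1, hn, ha, hm, hC, hX⟩
    let s : MulRingSeminorm K[X] :=
      { toFun := φ
        map_zero' := h0
        map_one' := h1
        neg' := hn
        add_le' := ha
        map_mul' := hm }
    exact ⟨⟨s, hC⟩, hX, rfl⟩

instance : WeaklyLocallyCompactSpace (BerkovichA1 K) where
  exists_compact_mem_nhds s := ⟨_, BerkovichA1.isCompact_setOf_le (s.1 X + 1),
    ((BerkovichA1.continuous_apply X).tendsto s).eventually_le_const (lt_add_one _)⟩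

theorem BerkovichA1.tendsto_apply_X_coclosedCompact :
    Tendsto (fun s : BerkovichA1 K => s.1 X) (coclosedCompact _) atTop := by
  refine tendsto_atTop.2 fun R => ?_
  rw [coclosedCompact_eq_cocompact]
  filter_upwards [(BerkovichA1.isCompact_setOf_le (K := K) R).compl_mem_cocompact] with s hs
  exact (not_le.1 (show ¬ s.1 X ≤ R from hs)).le

@[simp] theorem evalPoint_apply (a : K) (P : K[X]) : (evalPoint a).1 P = ‖P.eval a‖ := rfl

@[simp] theorem classical_some (a : K) :
    classical (OnePoint.some a) = OnePoint.some (evalPoint a) := rfl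

@[simp] theorem classical_infty :
    classical (OnePoint.infty : OnePoint K) = OnePoint.infty := rfl

theorem evalPoint_injective : Function.Injective (evalPoint (K := K)) := by
  intro a b h
  have := congrArg (fun s : BerkovichA1 K => s.1 (X - C b)) h
  simpa [sub_eq_zero] using this

theorem classical_injective : Function.Injective (classical (K := K)) := by
  intro z w h
  induction z using OnePoint.rec <;> induction w using OnePoint.rec
  · rfl
  · simp at h
  · simp at h
  · simp only [classical_some, OnePoint.coe_eq_coe] at h
    rw [evalPoint_injective h]

/-! ### The norm on the plane -/

theorem le_norm2_left {a b : ℝ} : a ≤ norm2 K a b := by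
  unfold norm2; split_ifs
  · exact le_max_left _ _
  · exact Real.le_sqrt_of_sq_le (by nlinarith [sq_nonneg b])

theorem le_norm2_right {a b : ℝ} : b ≤ norm2 K a b := by
  unfold norm2; split_ifs
  · exact le_max_right _ _
  · exact Real.le_sqrt_of_sq_le (by nlinarith [sq_nonneg a])

theorem norm2_le_add {a b : ℝ} (ha : 0 ≤ a) (hb : 0 ≤ b) : norm2 K a b ≤ a + b := by
  unfold norm2; split_ifs
  · exact max_le (by linarith) (by linarith)
  · exact Real.sqrt_le_iff.2 ⟨by linarith, by nlinarith⟩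

theorem norm2_mul {a b c : ℝ} (hc : 0 ≤ c) : norm2 K (c * a) (c * b) = c * norm2 K a b := by
  unfold norm2; split_ifs
  · exact (mul_max_of_nonneg _ _ hc).symm
  · rw [show (c * a) ^ 2 + (c * b) ^ 2 = c ^ 2 * (a ^ 2 + b ^ 2) by ring,
      Real.sqrt_mul (sq_nonneg _), Real.sqrt_sq hc]

theorem continuous_norm2 : Continuous fun p : ℝ × ℝ => norm2 K p.1 p.2 := by
  unfold norm2; split_ifs <;> fun_prop

theorem norm2_one_pos (t : ℝ) : 0 < norm2 K t 1 := one_pos.trans_le le_norm2_right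

theorem tendsto_div_norm2_one : Tendsto (fun t : ℝ => t / norm2 K t 1) atTop (𝓝 1) := by
  have h : Tendsto (fun t : ℝ => t / (t + 1)) atTop (𝓝 1) := by
    have := (tendsto_inv_atTop_zero.comp (tendsto_atTop_add_const_right atTop (1 : ℝ)
      tendsto_id)).const_sub 1
    rw [sub_zero] at this
    refine this.congr' ?_
    filter_upwards [eventually_gt_atTop 0] with t ht
    have : t + 1 ≠ 0 := by positivity
    simp only [Function.comp, id]
    field_simp
    ring
  refine tendsto_of_tendsto_of_tendsto_of_le_of_le' h tendsto_const_nhds ?_ ?_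
  · filter_upwards [eventually_gt_atTop 0] with t ht
    exact div_le_div_of_nonneg_left ht.le (norm2_one_pos t) (norm2_le_add ht.le zero_le_one)
  · exact Eventually.of_forall fun t => (div_le_one (norm2_one_pos t)).2 le_norm2_left

theorem pairNorm_pos {p : K × K} (hp : p ≠ 0) : 0 < pairNorm p := by
  by_cases h : p.1 = 0
  · have h2 : p.2 ≠ 0 := fun h2 => hp (Prod.ext h h2)
    exact (norm_pos_iff.2 h2).trans_le le_norm2_right
  · exact (norm_pos_iff.2 h).trans_le le_norm2_left

theorem pairNorm_smul (c : K) (p : K × K) : pairNorm (c • p) = ‖c‖ * pairNorm p := by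
  simp [pairNorm, norm2_mul]

@[simp] theorem homCoord_some (a : K) : homCoord (OnePoint.some a) = (a, 1) := rfl

@[simp] theorem homCoord_infty : homCoord (OnePoint.infty : OnePoint K) = (1, 0) := rfl

theorem homCoord_ne_zero (z : OnePoint K) : homCoord z ≠ 0 := by
  induction z using OnePoint.rec <;> simp

theorem pairNorm_homCoord_pos (z : OnePoint K) : 0 < pairNorm (homCoord z) :=
  pairNorm_pos (homCoord_ne_zero z)

theorem pairNorm_infty : pairNorm (homCoord (OnePoint.infty : OnePoint K)) = 1 := by
  simp [pairNorm, norm2]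

theorem pairNorm_some (a : K) : pairNorm (homCoord (OnePoint.some a)) = norm2 K ‖a‖ 1 := by
  simp [pairNorm]

theorem exists_smul_homCoord_proj {p : K × K} (hp : p ≠ 0) :
    ∃ c : K, c ≠ 0 ∧ p = c • homCoord (proj p) := by
  by_cases h : p.2 = 0
  · have h1 : p.1 ≠ 0 := fun h1 => hp (Prod.ext h1 h)
    exact ⟨p.1, h1, Prod.ext (by simp [proj, h]) (by simp [proj, h])⟩
  · exact ⟨p.2, h, Prod.ext (by simp [proj, h, mul_div_cancel₀]) (by simp [proj, h])⟩

@[simp] theorem proj_homCoord (z : OnePoint K) : proj (homCoord z) = z := by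
  induction z using OnePoint.rec <;> simp [proj]

/-! ### Absolute values of binary forms -/

/-- The continuous function `|H(p)| / ‖p‖ ^ m` on `𝖯¹` attached to the binary form `H` of degree
`m` whose dehomogenization is the polynomial `P`. -/
def formAbs (m : ℕ) (P : K[X]) (x : BerkovichP1 K) : ℝ :=
  x.elim ‖P.coeff m‖ fun s => s.1 P / norm2 K (s.1 X) 1 ^ m

@[simp] theorem formAbs_infty (m : ℕ) (P : K[X]) :
    formAbs m P OnePoint.infty = ‖P.coeff m‖ := rfl

@[simp] theorem formAbs_some (m : ℕ) (P : K[X]) (s : BerkovichA1 K) :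
    formAbs m P (OnePoint.some s) = s.1 P / norm2 K (s.1 X) 1 ^ m := rfl

theorem formAbs_nonneg (m : ℕ) (P : K[X]) (x : BerkovichP1 K) : 0 ≤ formAbs m P x := by
  induction x using OnePoint.rec with
  | infty => exact norm_nonneg _
  | coe s => exact div_nonneg (apply_nonneg s.1 P) (pow_nonneg (norm2_one_pos _).le m)

theorem continuous_formAbs {m : ℕ} {P : K[X]} (hP : P.natDegree ≤ m) :
    Continuous (formAbs m P) := by
  rw [OnePoint.continuous_iff]
  constructor
  · have key : Tendsto (fun s : BerkovichA1 K => s.1 P / s.1 X ^ m) (coclosedCompact _)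
        (𝓝 ‖P.coeff m‖) := by
      have hsum : Tendsto (fun t : ℝ => ∑ i ∈ Finset.range m, ‖P.coeff i‖ * (t⁻¹) ^ (m - i))
          atTop (𝓝 0) := by
        rw [← Finset.sum_const_zero (s := Finset.range m)]
        refine tendsto_finsetSum _ fun i hi => ?_
        have hi' : m - i ≠ 0 := by have := Finset.mem_range.1 hi; omega
        have := (tendsto_inv_atTop_zero.pow (m - i)).const_mul ‖P.coeff i‖
        simpa [zero_pow hi'] using this
      have hsum' := hsum.comp (BerkovichA1.tendsto_apply_X_coclosedCompact (K := K))
      rw [tendsto_iff_norm_sub_tendsto_zero]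
      refine squeeze_zero' (Eventually.of_forall fun _ => norm_nonneg _) ?_ hsum'
      filter_upwards [(BerkovichA1.tendsto_apply_X_coclosedCompact (K := K)).eventually_gt_atTop 0]
        with s hs
      have e1 : P = (∑ i ∈ Finset.range m, C (P.coeff i) * X ^ i) + C (P.coeff m) * X ^ m := by
        rw [← Finset.sum_range_succ]
        exact P.as_sum_range_C_mul_X_pow' (Nat.lt_succ_of_le hP)
      set Q := ∑ i ∈ Finset.range m, C (P.coeff i) * X ^ i with hQ
      have e2 : s.1 (C (P.coeff m) * X ^ m) = ‖P.coeff m‖ * s.1 X ^ m := by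
        simp [map_mul, map_pow, s.2]
      have e3 : |s.1 P - ‖P.coeff m‖ * s.1 X ^ m| ≤ s.1 Q := by
        rw [← e2, abs_le]
        constructor
        · have h := map_add_le_add s.1 P (-Q)
          rw [map_neg_eq_map, show P + -Q = C (P.coeff m) * X ^ m by
            nth_rw 1 [e1]; ring] at h
          linarith
        · have h := map_add_le_add s.1 Q (C (P.coeff m) * X ^ m)
          rw [← e1] at h
          linarith
      have e4 : s.1 P / s.1 X ^ m - ‖P.coeff m‖ =
          (s.1 P - ‖P.coeff m‖ * s.1 X ^ m) / s.1 X ^ m := by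
        field_simp
      rw [e4, norm_div, Real.norm_eq_abs, Real.norm_of_nonneg (pow_nonneg hs.le m),
        div_le_iff₀ (pow_pos hs m)]
      refine (e3.trans (s.apply_sum_le _ _)).trans (le_of_eq ?_)
      simp only [Function.comp, Finset.sum_mul]
      refine Finset.sum_congr rfl fun i hi => ?_
      have hi' : i ≤ m := (Finset.mem_range.1 hi).le
      rw [mul_assoc, inv_pow, ← pow_sub_mul_pow (s.1 X) hi', ← mul_assoc (_⁻¹),
        inv_mul_cancel₀ (pow_pos hs _).ne', one_mul]
    have h2 := (tendsto_div_norm2_one (K := K)).comp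
      (BerkovichA1.tendsto_apply_X_coclosedCompact (K := K))
    have h3 := key.mul (h2.pow m)
    rw [one_pow, mul_one] at h3
    refine h3.congr' ?_
    filter_upwards [(BerkovichA1.tendsto_apply_X_coclosedCompact (K := K)).eventually_gt_atTop 0]
      with s hs
    have := (norm2_one_pos (K := K) (s.1 X)).ne'
    simp only [Function.comp, formAbs_some, div_pow]
    field_simp
  · refine (BerkovichA1.continuous_apply P).div (((continuous_norm2 (K := K)).comp
      ((BerkovichA1.continuous_apply X).prodMk continuous_const)).pow m) fun s => ?_
    exact (pow_pos (norm2_one_pos _) m).ne'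

/-- The value at `p` of the form of degree `m` with dehomogenization `P`. -/
def formEval (m : ℕ) (P : K[X]) (p : K × K) : K :=
  ∑ i ∈ Finset.range (m + 1), P.coeff i * (p.1 ^ i * p.2 ^ (m - i))

theorem formEval_some {m : ℕ} {P : K[X]} (hP : P.natDegree ≤ m) (a : K) :
    formEval m P (a, 1) = P.eval a := by
  simp [formEval, P.eval_eq_sum_range' (Nat.lt_succ_of_le hP)]

theorem formEval_infty (m : ℕ) (P : K[X]) : formEval m P (1, 0) = P.coeff m := by
  unfold formEval
  rw [Finset.sum_range_succ, Finset.sum_eq_zero]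
  · simp
  · intro i hi
    have : m - i ≠ 0 := by have := Finset.mem_range.1 hi; omega
    simp [zero_pow this]

theorem formAbs_classical {m : ℕ} {P : K[X]} (hP : P.natDegree ≤ m) (z : OnePoint K) :
    formAbs m P (classical z) = ‖formEval m P (homCoord z)‖ / pairNorm (homCoord z) ^ m := by
  induction z using OnePoint.rec with
  | infty => rw [classical_infty, formAbs_infty, homCoord_infty, formEval_infty,
      ← homCoord_infty, pairNorm_infty]; simp
  | coe a => rw [classical_some, formAbs_some, pairNorm_some, homCoord_some, formEval_some hP]; simp

/-! ### The chordal distance to a classical point -/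

theorem chordalTo_eq_formAbs (x : BerkovichP1 K) (q : OnePoint K) :
    chordalTo x q =
      formAbs 1 (C (homCoord q).2 * X - C (homCoord q).1) x / pairNorm (homCoord q) := by
  induction x using OnePoint.rec with
  | infty => simp [chordalTo, formAbs, coeff_C]
  | coe s => simp [chordalTo, formAbs, div_div]

theorem natDegree_linear_le (a b : K) : (C a * X - C b).natDegree ≤ 1 := by
  rw [sub_eq_add_neg, ← C_neg]; exact Polynomial.natDegree_linear_le

theorem continuous_chordalTo (q : OnePoint K) : Continuous fun x => chordalTo x q := by
  simp only [chordalTo_eq_formAbs]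
  exact (continuous_formAbs (natDegree_linear_le _ _)).div_const _

theorem chordalTo_nonneg (x : BerkovichP1 K) (q : OnePoint K) : 0 ≤ chordalTo x q := by
  rw [chordalTo_eq_formAbs]
  exact div_nonneg (formAbs_nonneg _ _ _) (pairNorm_homCoord_pos q).le

theorem chordalTo_classical (z q : OnePoint K) : chordalTo (classical z) q = chordal z q := by
  rw [chordalTo_eq_formAbs, formAbs_classical (natDegree_linear_le _ _), chordal, pow_one, div_div]
  congr 2
  simp [formEval, Finset.sum_range_succ, coeff_X, coeff_C]
  ring

theorem chordal_comm (z w : OnePoint K) : chordal z w = chordal w z := by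
  rw [chordal, chordal, mul_comm (pairNorm _), ← norm_neg]
  congr 2; ring

theorem chordalTo_infty_infty : chordalTo (OnePoint.infty : BerkovichP1 K) OnePoint.infty = 0 := by
  simp [chordalTo]

theorem chordalTo_some_infty (s : BerkovichA1 K) :
    chordalTo (OnePoint.some s) OnePoint.infty = (norm2 K (s.1 X) 1)⁻¹ := by
  simp [chordalTo, pairNorm, norm2]

theorem chordalTo_some_some (s : BerkovichA1 K) (a : K) :
    chordalTo (OnePoint.some s) (OnePoint.some a) =
      s.1 (X - C a) / (norm2 K (s.1 X) 1 * norm2 K ‖a‖ 1) := by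
  simp [chordalTo, pairNorm]

theorem chordalTo_infty_some (a : K) :
    chordalTo (OnePoint.infty : BerkovichP1 K) (OnePoint.some a) = (norm2 K ‖a‖ 1)⁻¹ := by
  simp [chordalTo, pairNorm]

theorem BerkovichA1.ext_of_linear [IsAlgClosed K] {s t : BerkovichA1 K}
    (h : ∀ a : K, s.1 (X - C a) = t.1 (X - C a)) : s = t := by
  refine BerkovichA1.ext fun P => ?_
  rw [(IsAlgClosed.splits P).eq_prod_roots, map_mul, map_mul, s.2, t.2, map_multiset_prod,
    map_multiset_prod, Multiset.map_map, Multiset.map_map]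
  congr 2
  exact Multiset.map_congr rfl fun a _ => h a

theorem ext_of_chordalTo [IsAlgClosed K] {x y : BerkovichP1 K}
    (h : ∀ q, chordalTo x q = chordalTo y q) : x = y := by
  induction x using OnePoint.rec with
  | infty =>
    induction y using OnePoint.rec with
    | infty => rfl
    | coe t =>
      have := h OnePoint.infty
      rw [chordalTo_infty_infty, chordalTo_some_infty] at this
      exact absurd this.symm (inv_pos.2 (norm2_one_pos _)).ne'
  | coe s =>
    induction y using OnePoint.rec with
    | infty =>
      have := h OnePoint.infty
      rw [chordalTo_infty_infty, chordalTo_some_infty] at this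
      exact absurd this (inv_pos.2 (norm2_one_pos _)).ne'
    | coe t =>
      have h1 := h OnePoint.infty
      rw [chordalTo_some_infty, chordalTo_some_infty, inv_inj] at h1
      congr 1
      refine BerkovichA1.ext_of_linear fun a => ?_
      have h2 := h (OnePoint.some a)
      rw [chordalTo_some_some, chordalTo_some_some, h1] at h2
      exact (div_left_inj' (mul_pos (norm2_one_pos _) (norm2_one_pos _)).ne').1 h2

theorem isClosedEmbedding_chordalTo [IsAlgClosed K] :
    IsClosedEmbedding fun (x : BerkovichP1 K) (q : OnePoint K) => chordalTo x q :=
  (continuous_pi continuous_chordalTo).isClosedEmbedding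
    fun _ _ h => ext_of_chordalTo (congrFun h)

end Topology

/-! ### Dynamics on the Berkovich line -/

section Dynamics

variable {K : Type*} [NontriviallyNormedField K]

theorem contExt_eq {Y : Type*} [TopologicalSpace Y] [T2Space Y] [Nonempty Y]
    (hd : DenseRange (classical (K := K))) {u : OnePoint K → Y} {E : BerkovichP1 K → Y}
    (hE : Continuous E) (h : ∀ z, E (classical z) = u z) : contExt u = E := by
  funext x
  have : (comap classical (𝓝 x)).NeBot := comap_neBot fun t ht =>
    let ⟨_, hz, z, hzx⟩ := mem_closure_iff_nhds.1 (hd x) t ht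
    ⟨z, hzx ▸ hz⟩
  refine Tendsto.limUnder_eq ?_
  have h1 : Tendsto (fun z => E (classical z)) (comap classical (𝓝 x)) (𝓝 (E x)) :=
    (hE.tendsto x).comp tendsto_comap
  exact h1.congr h

theorem eq_of_classical {Y : Type*} [TopologicalSpace Y] [T2Space Y]
    (hd : DenseRange (classical (K := K))) {E E' : BerkovichP1 K → Y}
    (hE : Continuous E) (hE' : Continuous E') (h : ∀ z, E (classical z) = E' (classical z)) :
    E = E' :=
  hd.equalizer hE hE' (funext h)

theorem proj_smul {c : K} (hc : c ≠ 0) (p : K × K) : proj (c • p) = proj p := by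
  by_cases h : p.2 = 0
  · simp [proj, h]
  · simp [proj, h, hc, mul_div_mul_left]

theorem chordal_proj {p q : K × K} (hp : p ≠ 0) (hq : q ≠ 0) :
    chordal (proj p) (proj q) = ‖p.1 * q.2 - p.2 * q.1‖ / (pairNorm p * pairNorm q) := by
  obtain ⟨c, hc, hpc⟩ := exists_smul_homCoord_proj hp
  obtain ⟨b, hb, hqb⟩ := exists_smul_homCoord_proj hq
  set P := homCoord (proj p) with hP
  set Q := homCoord (proj q) with hQ
  have hc' := norm_pos_iff.2 hc
  have hb' := norm_pos_iff.2 hb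
  have e : p.1 * q.2 - p.2 * q.1 = c * b * (P.1 * Q.2 - P.2 * Q.1) := by
    rw [hpc, hqb]; simp only [Prod.smul_fst, Prod.smul_snd, smul_eq_mul]; ring
  rw [chordal, ← hP, ← hQ, e, norm_mul, norm_mul, hpc, hqb, pairNorm_smul, pairNorm_smul]
  rw [show ‖c‖ * pairNorm P * (‖b‖ * pairNorm Q) = ‖c‖ * ‖b‖ * (pairNorm P * pairNorm Q) by ring,
    mul_div_mul_left _ _ (mul_pos hc' hb').ne']

variable (f : RatFunc K)

theorem homLift_eq (p : K × K) :
    homLift f p = (formEval (ratDegree f) f.num p, formEval (ratDegree f) f.denom p) := by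
  simp [homLift, formEval]

theorem formEval_smul (m : ℕ) (P : K[X]) (c : K) (p : K × K) :
    formEval m P (c • p) = c ^ m * formEval m P p := by
  simp only [formEval, Finset.mul_sum]
  refine Finset.sum_congr rfl fun i hi => ?_
  have hi' : i ≤ m := Nat.lt_succ_iff.1 (Finset.mem_range.1 hi)
  simp only [Prod.smul_fst, Prod.smul_snd, smul_eq_mul, mul_pow]
  rw [← pow_mul_pow_sub c hi']
  ring

theorem homLift_smul (c : K) (p : K × K) :
    homLift f (c • p) = c ^ ratDegree f • homLift f p := by
  simp [homLift_eq, formEval_smul]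

theorem natDegree_num_le : f.num.natDegree ≤ ratDegree f := le_max_left _ _

theorem natDegree_denom_le : f.denom.natDegree ≤ ratDegree f := le_max_right _ _

theorem coeff_ratDegree_ne_zero (h1 : f.num.coeff (ratDegree f) = 0) :
    f.denom.coeff (ratDegree f) ≠ 0 := by
  intro h2
  rcases le_total f.num.natDegree f.denom.natDegree with h | h
  · rw [ratDegree, max_eq_right h] at h2
    exact f.denom_ne_zero (leadingCoeff_eq_zero.1 h2)
  · have hd : ratDegree f = f.num.natDegree := max_eq_left h
    rw [hd] at h1 h2
    have h0 : f.num = 0 := leadingCoeff_eq_zero.1 h1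
    have h3 : f.denom.natDegree = f.num.natDegree := le_antisymm h (by rw [h0]; simp)
    rw [← h3] at h2
    exact f.denom_ne_zero (leadingCoeff_eq_zero.1 h2)

theorem homLift_ne_zero {p : K × K} (hp : p ≠ 0) : homLift f p ≠ 0 := by
  obtain ⟨c, hc, hpc⟩ := exists_smul_homCoord_proj hp
  rw [hpc, homLift_smul]
  refine smul_ne_zero (pow_ne_zero _ hc) ?_
  rw [homLift_eq, Ne, Prod.mk_eq_zero]
  rintro ⟨h1, h2⟩
  generalize proj p = z at h1 h2
  induction z using OnePoint.rec with
  | infty =>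
    rw [homCoord_infty, formEval_infty] at h1 h2
    exact coeff_ratDegree_ne_zero f h1 h2
  | coe a =>
    rw [homCoord_some, formEval_some (natDegree_num_le f)] at h1
    rw [homCoord_some, formEval_some (natDegree_denom_le f)] at h2
    obtain ⟨u, v, huv⟩ := f.isCoprime_num_denom
    have := congrArg (Polynomial.eval a) huv
    simp [h1, h2] at this

theorem iterate_homLift_ne_zero (n : ℕ) {p : K × K} (hp : p ≠ 0) : (homLift f)^[n] p ≠ 0 := by
  induction n with
  | zero => exact hp
  | succ n ih => rw [Function.iterate_succ_apply']; exact homLift_ne_zero f ih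

theorem ratMap_proj {p : K × K} (hp : p ≠ 0) : ratMap f (proj p) = proj (homLift f p) := by
  obtain ⟨c, hc, hpc⟩ := exists_smul_homCoord_proj hp
  conv_rhs => rw [hpc, homLift_smul, proj_smul (pow_ne_zero _ hc)]
  rfl

theorem iterate_ratMap (n : ℕ) (z : OnePoint K) :
    (ratMap f)^[n] z = proj ((homLift f)^[n] (homCoord z)) := by
  induction n with
  | zero => simp
  | succ n ih =>
    rw [Function.iterate_succ_apply', Function.iterate_succ_apply', ih,
      ratMap_proj f (iterate_homLift_ne_zero f n (homCoord_ne_zero z))]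

/-- The continuous extension to `𝖯¹` of `‖F(p)‖ / ‖p‖ ^ d`. -/
def liftAbs (x : BerkovichP1 K) : ℝ :=
  norm2 K (formAbs (ratDegree f) f.num x) (formAbs (ratDegree f) f.denom x)

theorem continuous_liftAbs : Continuous (liftAbs f) :=
  (continuous_norm2 (K := K)).comp ((continuous_formAbs (natDegree_num_le f)).prodMk
    (continuous_formAbs (natDegree_denom_le f)))

theorem liftAbs_pos (x : BerkovichP1 K) : 0 < liftAbs f x := by
  by_contra hx
  have h1 : formAbs (ratDegree f) f.num x = 0 :=
    le_antisymm (le_norm2_left.trans (not_lt.1 hx)) (formAbs_nonneg _ _ _)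
  have h2 : formAbs (ratDegree f) f.denom x = 0 :=
    le_antisymm (le_norm2_right.trans (not_lt.1 hx)) (formAbs_nonneg _ _ _)
  induction x using OnePoint.rec with
  | infty =>
    rw [formAbs_infty, norm_eq_zero] at h1 h2
    exact coeff_ratDegree_ne_zero f h1 h2
  | coe s =>
    have hN := (pow_pos (norm2_one_pos (K := K) (s.1 X)) (ratDegree f)).ne'
    rw [formAbs_some, div_eq_zero_iff, or_iff_left hN] at h1 h2
    obtain ⟨u, v, huv⟩ := f.isCoprime_num_denom
    have h3 := map_add_le_add s.1 (u * f.num) (v * f.denom)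
    rw [huv, map_one, map_mul, map_mul, h1, h2] at h3
    norm_num at h3

theorem liftAbs_classical (z : OnePoint K) : liftAbs f (classical z) =
    pairNorm (homLift f (homCoord z)) / pairNorm (homCoord z) ^ ratDegree f := by
  rw [liftAbs, formAbs_classical (natDegree_num_le f), formAbs_classical (natDegree_denom_le f),
    homLift_eq, div_eq_inv_mul, div_eq_inv_mul, norm2_mul, div_eq_inv_mul]
  · rfl
  exact inv_nonneg.2 (pow_nonneg (pairNorm_homCoord_pos z).le _)

theorem exists_continuous_extension [IsAlgClosed K] (hd : DenseRange (classical (K := K))) :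
    ∃ φ : BerkovichP1 K → BerkovichP1 K, Continuous φ ∧
      ∀ z, φ (classical z) = classical (ratMap f z) := by
  set E : BerkovichP1 K → OnePoint K → ℝ := fun x q =>
    formAbs (ratDegree f) (C (homCoord q).2 * f.num - C (homCoord q).1 * f.denom) x /
      (liftAbs f x * pairNorm (homCoord q)) with hE
  have hdeg (q : OnePoint K) : (C (homCoord q).2 * f.num - C (homCoord q).1 * f.denom).natDegree ≤
      ratDegree f :=
    (natDegree_sub_le _ _).trans (max_le
      ((natDegree_C_mul_le _ _).trans (natDegree_num_le f))
      ((natDegree_C_mul_le _ _).trans (natDegree_denom_le f)))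
  have hEc : Continuous E := continuous_pi fun q =>
    (continuous_formAbs (hdeg q)).div ((continuous_liftAbs f).mul continuous_const)
      fun x => (mul_pos (liftAbs_pos f x) (pairNorm_homCoord_pos q)).ne'
  have hEz (z : OnePoint K) : E (classical z) = fun q => chordalTo (classical (ratMap f z)) q := by
    funext q
    have hF := homLift_ne_zero f (homCoord_ne_zero z)
    simp only [hE]
    rw [chordalTo_classical, ratMap]
    conv_rhs => rw [← proj_homCoord q, chordal_proj hF (homCoord_ne_zero q)]
    rw [formAbs_classical (hdeg q), liftAbs_classical]
    have hlin : formEval (ratDegree f) (C (homCoord q).2 * f.num - C (homCoord q).1 * f.denom)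
        (homCoord z) = (homLift f (homCoord z)).1 * (homCoord q).2 -
          (homLift f (homCoord z)).2 * (homCoord q).1 := by
      simp only [homLift_eq, formEval, Finset.sum_mul, ← Finset.sum_sub_distrib]
      refine Finset.sum_congr rfl fun i _ => ?_
      simp only [coeff_sub, coeff_C_mul]
      ring
    rw [hlin]
    have h1 := (pow_pos (pairNorm_homCoord_pos z) (ratDegree f)).ne'
    have h2 := (pairNorm_pos hF).ne'
    have h3 := (pairNorm_homCoord_pos q).ne'
    field_simp
  have hcl := isClosedEmbedding_chordalTo (K := K)
  have hmem (x : BerkovichP1 K) :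
      E x ∈ Set.range fun (x : BerkovichP1 K) (q : OnePoint K) => chordalTo x q := by
    have hc := hcl.isClosed_range.preimage hEc
    have : closure (Set.range (classical (K := K))) ⊆ E ⁻¹' (Set.range _) :=
      hc.closure_subset_iff.2 (by rintro _ ⟨z, rfl⟩; exact ⟨_, (hEz z).symm⟩)
    exact this (hd x)
  choose φ hφ using hmem
  refine ⟨φ, hcl.isEmbedding.continuous_iff.2 ?_, fun z => hcl.injective ((hφ _).trans (hEz z))⟩
  convert hEc using 1
  exact funext hφ

theorem berkMap_eq [IsAlgClosed K] (hd : DenseRange (classical (K := K))) :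
    Continuous (berkMap f) ∧ ∀ z, berkMap f (classical z) = classical (ratMap f z) := by
  obtain ⟨φ, hφ, h⟩ := exists_continuous_extension f hd
  have : berkMap f = φ := contExt_eq hd hφ h
  exact this ▸ ⟨hφ, h⟩

/-- The continuous extension `T_{Fⁿ}` to `𝖯¹` of `log ‖Fⁿ‖ - dⁿ log ‖·‖`, defined through the
cocycle relation `T_{Fⁿ⁺¹} = d T_{Fⁿ} + T_F ∘ fⁿ`. -/
def iterLog : ℕ → BerkovichP1 K → ℝ
  | 0, _ => 0
  | n + 1, x => ratDegree f * iterLog n x + Real.log (liftAbs f ((berkMap f)^[n] x))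

theorem continuous_log_liftAbs : Continuous fun x => Real.log (liftAbs f x) :=
  (continuous_liftAbs f).log fun x => (liftAbs_pos f x).ne'

variable [IsAlgClosed K] (hd : DenseRange (classical (K := K)))

include hd in
theorem iterate_berkMap_classical (n : ℕ) (z : OnePoint K) :
    (berkMap f)^[n] (classical z) = classical ((ratMap f)^[n] z) := by
  induction n with
  | zero => rfl
  | succ n ih => rw [Function.iterate_succ_apply', ih, (berkMap_eq f hd).2,
      Function.iterate_succ_apply']

include hd in
theorem continuous_iterLog (n : ℕ) : Continuous (iterLog f n) := by
  induction n with
  | zero => exact continuous_const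
  | succ n ih =>
    exact (continuous_const.mul ih).add
      ((continuous_log_liftAbs f).comp ((berkMap_eq f hd).1.iterate n))

include hd in
theorem iterLog_classical (n : ℕ) (z : OnePoint K) :
    iterLog f n (classical z) = logHomLift f n z := by
  induction n with
  | zero => simp [iterLog, logHomLift]
  | succ n ih =>
    rw [iterLog, ih, iterate_berkMap_classical f hd, iterate_ratMap]
    have hp := iterate_homLift_ne_zero f n (homCoord_ne_zero z)
    set p := (homLift f)^[n] (homCoord z) with hpdef
    obtain ⟨c, hc, hpc⟩ := exists_smul_homCoord_proj hp
    have hc' := norm_pos_iff.2 hc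
    have hF := pairNorm_pos (homLift_ne_zero f hp)
    have hN := pairNorm_pos hp
    have e : liftAbs f (classical (proj p)) = pairNorm (homLift f p) / pairNorm p ^ ratDegree f := by
      rw [liftAbs_classical]
      conv_rhs => rw [hpc, homLift_smul, pairNorm_smul, pairNorm_smul, norm_pow, mul_pow,
        mul_div_mul_left _ _ (pow_pos hc' _).ne']
    rw [e, Real.log_div hF.ne' (pow_pos hN _).ne', Real.log_pow, logHomLift, logHomLift,
      Function.iterate_succ_apply', ← hpdef]
    ring

include hd in
theorem contExt_logHomLift (n : ℕ) : contExt (logHomLift f n) = iterLog f n :=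
  contExt_eq hd (continuous_iterLog f hd n) (iterLog_classical f hd n)

omit [IsAlgClosed K] in
theorem iterLog_div_pow (hf : 1 < ratDegree f) (n : ℕ) (x : BerkovichP1 K) :
    iterLog f n x / (ratDegree f : ℝ) ^ n = ∑ k ∈ Finset.range n,
      Real.log (liftAbs f ((berkMap f)^[k] x)) / (ratDegree f : ℝ) ^ (k + 1) := by
  have hd0 : (ratDegree f : ℝ) ≠ 0 := by positivity
  induction n with
  | zero => simp [iterLog]
  | succ n ih =>
    rw [Finset.sum_range_succ, ← ih, iterLog]
    field_simp
    ring

include hd in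
theorem liftGreen_eq (hf : 1 < ratDegree f) :
    Continuous (liftGreen f) ∧ ∀ n x, liftGreen f ((berkMap f)^[n] x) =
      (ratDegree f : ℝ) ^ n * liftGreen f x - iterLog f n x := by
  set d : ℝ := (ratDegree f : ℝ) with hdd
  have hd1 : 1 < d := by rw [hdd]; exact_mod_cast hf
  set T : BerkovichP1 K → ℝ := fun x => Real.log (liftAbs f x) with hT
  set φ := berkMap f
  have hTc : Continuous T := continuous_log_liftAbs f
  have hφc : Continuous φ := (berkMap_eq f hd).1
  obtain ⟨M, hM⟩ := isCompact_univ.exists_bound_of_continuousOn hTc.continuousOn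
  have hM' (x) : ‖T x‖ ≤ M := hM x (Set.mem_univ x)
  have hbound (k : ℕ) (x) : ‖T (φ^[k] x) / d ^ (k + 1)‖ ≤ M / d * (d⁻¹) ^ k := by
    rw [norm_div, norm_pow, Real.norm_of_nonneg (by positivity : (0 : ℝ) ≤ d), pow_succ', inv_pow,
      ← div_eq_mul_inv, div_div]
    gcongr
    exact hM' _
  have hsum : Summable fun k : ℕ => M / d * (d⁻¹) ^ k :=
    (summable_geometric_of_lt_one (by positivity) (inv_lt_one_of_one_lt₀ hd1)).mul_left _
  have hS (x) : Summable fun k : ℕ => T (φ^[k] x) / d ^ (k + 1) :=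
    Summable.of_norm_bounded hsum (fun k => hbound k x)
  have heq (x) : liftGreen f x = ∑' k : ℕ, T (φ^[k] x) / d ^ (k + 1) := by
    refine Tendsto.limUnder_eq ?_
    simp only [contExt_logHomLift f hd]
    refine (hS x).hasSum.tendsto_sum_nat.congr fun n => ?_
    exact (iterLog_div_pow f hf n x).symm
  have hfun (x) : liftGreen f (φ x) = d * liftGreen f x - T x := by
    rw [heq, heq, (hS x).tsum_eq_zero_add, mul_add, ← tsum_mul_left]
    simp only [Function.iterate_zero, id, zero_add, pow_one]
    rw [mul_div_cancel₀ _ (by positivity : d ≠ 0), add_sub_cancel_left]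
    refine tsum_congr fun k => ?_
    rw [← Function.iterate_succ_apply]
    have : d ≠ 0 := by positivity
    rw [pow_succ _ (k + 1), Function.iterate_succ]
    field_simp
  refine ⟨?_, fun n x => ?_⟩
  · rw [show liftGreen f = fun x => ∑' k : ℕ, T (φ^[k] x) / d ^ (k + 1) from funext heq]
    exact continuous_tsum (fun k => (hTc.comp (hφc.iterate k)).div_const _) hsum
      fun k x => hbound k x
  · induction n with
    | zero => simp [iterLog]
    | succ n ih => rw [Function.iterate_succ_apply', hfun, ih, iterLog]; ring

/-! ### Fixed points -/

omit [IsAlgClosed K] in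
theorem iterate_homLift_X (n : ℕ) :
    (((homLift f)^[n] ((X : K[X]), (1 : K[X]))).1.natDegree ≤ ratDegree f ^ n ∧
      ((homLift f)^[n] ((X : K[X]), (1 : K[X]))).2.natDegree ≤ ratDegree f ^ n) ∧
    (∀ a : K, (((homLift f)^[n] ((X : K[X]), (1 : K[X]))).1.eval a,
      ((homLift f)^[n] ((X : K[X]), (1 : K[X]))).2.eval a) = (homLift f)^[n] (a, 1)) ∧
    (((homLift f)^[n] ((X : K[X]), (1 : K[X]))).1.coeff (ratDegree f ^ n),
      ((homLift f)^[n] ((X : K[X]), (1 : K[X]))).2.coeff (ratDegree f ^ n)) =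
        (homLift f)^[n] (1, 0) := by
  induction n with
  | zero => simp [coeff_one]
  | succ n ih =>
    simp only [Function.iterate_succ_apply', pow_succ]
    generalize ((homLift f)^[n] ((X : K[X]), (1 : K[X]))) = p at ih ⊢
    generalize ratDegree f ^ n = m at ih ⊢
    obtain ⟨⟨h1, h2⟩, h3, h4⟩ := ih
    have hterm (i : ℕ) (hi : i ∈ Finset.range (ratDegree f + 1)) :
        (p.1 ^ i * p.2 ^ (ratDegree f - i)).natDegree ≤ m * ratDegree f ∧
        (p.1 ^ i * p.2 ^ (ratDegree f - i)).coeff (m * ratDegree f) =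
          p.1.coeff m ^ i * p.2.coeff m ^ (ratDegree f - i) := by
      have hi' : i ≤ ratDegree f := Nat.lt_succ_iff.1 (Finset.mem_range.1 hi)
      have e : m * ratDegree f = i * m + (ratDegree f - i) * m := by
        rw [← add_mul, Nat.add_sub_cancel' hi', mul_comm]
      have d1 : (p.1 ^ i).natDegree ≤ i * m := natDegree_pow_le_of_le i h1
      have d2 : (p.2 ^ (ratDegree f - i)).natDegree ≤ (ratDegree f - i) * m :=
        natDegree_pow_le_of_le _ h2
      rw [e]
      refine ⟨natDegree_mul_le_of_le d1 d2, ?_⟩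
      rw [coeff_mul_add_eq_of_natDegree_le d1 d2, coeff_pow_of_natDegree_le h1,
        coeff_pow_of_natDegree_le h2]
    have hdeg (P : K[X]) : (∑ i ∈ Finset.range (ratDegree f + 1),
        P.coeff i • (p.1 ^ i * p.2 ^ (ratDegree f - i))).natDegree ≤ m * ratDegree f :=
      natDegree_sum_le_of_forall_le (f := fun i => P.coeff i • (p.1 ^ i * p.2 ^ (ratDegree f - i)))
        _ fun i hi => (natDegree_smul_le _ _).trans (hterm i hi).1
    refine ⟨⟨hdeg f.num, hdeg f.denom⟩, fun a => ?_, ?_⟩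
    · rw [← h3 a]; simp [homLift, eval_finsetSum]
    · rw [← h4]
      simp only [homLift, finsetSum_coeff, coeff_smul]
      congr 1 <;> exact Finset.sum_congr rfl fun i hi => congrArg _ (hterm i hi).2

omit [IsAlgClosed K] in
theorem natDegree_fixPoly_le (n : ℕ) : (fixPoly f n).natDegree ≤ ratDegree f ^ n + 1 := by
  obtain ⟨⟨h1, h2⟩, -, -⟩ := iterate_homLift_X f n
  refine (natDegree_sub_le _ _).trans (max_le (by omega) ?_)
  exact natDegree_mul_le.trans (by rw [natDegree_X]; omega)

omit [IsAlgClosed K] in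
theorem formEval_fixPoly (n : ℕ) (z : OnePoint K) :
    formEval (ratDegree f ^ n + 1) (fixPoly f n) (homCoord z) =
      ((homLift f)^[n] (homCoord z)).1 * (homCoord z).2 -
        ((homLift f)^[n] (homCoord z)).2 * (homCoord z).1 := by
  obtain ⟨⟨h1, h2⟩, h3, h4⟩ := iterate_homLift_X f n
  induction z using OnePoint.rec with
  | infty =>
    rw [homCoord_infty, formEval_infty, ← h4, fixPoly, coeff_sub, coeff_X_mul,
      coeff_eq_zero_of_natDegree_lt (Nat.lt_succ_of_le h1)]
    simp
  | coe a =>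
    rw [homCoord_some, formEval_some (natDegree_fixPoly_le f n), ← h3, fixPoly]
    simp [mul_comm]

theorem fixPoly_ne_zero (hf : 1 < ratDegree f) {n : ℕ} (hn : 1 ≤ n) : fixPoly f n ≠ 0 := by
  intro h0
  obtain ⟨-, h3, h4⟩ := iterate_homLift_X f n
  rw [fixPoly, sub_eq_zero] at h0
  generalize ((homLift f)^[n] ((X : K[X]), (1 : K[X]))).1 = P at *
  generalize ((homLift f)^[n] ((X : K[X]), (1 : K[X]))).2 = Q at *
  have hQ : Q.degree ≤ 0 := by
    by_contra hQ
    obtain ⟨a, ha⟩ := IsAlgClosed.exists_root Q (by intro h; rw [h] at hQ; exact hQ le_rfl)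
    have : (homLift f)^[n] (a, 1) = 0 := by
      rw [← h3 a, h0]; simp [ha.eq_zero]
    exact iterate_homLift_ne_zero f n (by simp) this
  have hdn : 1 < ratDegree f ^ n := Nat.one_lt_pow (by omega) hf
  have hQ' : Q.natDegree = 0 := natDegree_eq_zero_iff_degree_le_zero.2 hQ
  have : (homLift f)^[n] ((1 : K), (0 : K)) = 0 := by
    rw [← h4, h0]
    refine Prod.ext ?_ ?_
    · obtain ⟨k, hk⟩ : ∃ k, ratDegree f ^ n = k + 2 := ⟨ratDegree f ^ n - 2, by omega⟩
      rw [hk]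
      exact (coeff_X_mul _ _).trans (coeff_eq_zero_of_natDegree_lt (by omega))
    · exact coeff_eq_zero_of_natDegree_lt (by omega)
  exact iterate_homLift_ne_zero f n (by simp) this

include hd in
theorem proximity_eq (n : ℕ) (x : BerkovichP1 K) : proximity f n x =
    formAbs (ratDegree f ^ n + 1) (fixPoly f n) x * Real.exp (-iterLog f n x) := by
  refine congrFun (contExt_eq hd ((continuous_formAbs (natDegree_fixPoly_le f n)).mul
    (Real.continuous_exp.comp (continuous_iterLog f hd n).neg)) fun z => ?_) x
  have hp := iterate_homLift_ne_zero f n (homCoord_ne_zero z)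
  simp only [Pi.mul_apply, Function.comp, Pi.neg_apply]
  rw [iterLog_classical f hd, formAbs_classical (natDegree_fixPoly_le f n), formEval_fixPoly,
    iterate_ratMap]
  conv_rhs => rw [← proj_homCoord z, chordal_proj (by simpa using hp)
    (by simpa using homCoord_ne_zero z)]
  simp only [proj_homCoord]
  have h1 := pairNorm_homCoord_pos z
  have h2 := pairNorm_pos hp
  have e : Real.exp (-logHomLift f n z) =
      pairNorm (homCoord z) ^ (ratDegree f ^ n) / pairNorm ((homLift f)^[n] (homCoord z)) := by
    rw [logHomLift, neg_sub, Real.exp_sub, Real.exp_log h2]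
    congr 1
    rw [← Nat.cast_pow, ← Real.log_pow, Real.exp_log (pow_pos h1 _)]
  rw [e, pow_succ]
  field_simp

/-- The fixed points of `fⁿ` in `ℙ¹`, with multiplicity. -/
def fixPoints (n : ℕ) : Multiset (OnePoint K) :=
  (fixPoly f n).roots.map OnePoint.some +
    Multiset.replicate (ratDegree f ^ n + 1 - (fixPoly f n).natDegree) OnePoint.infty

theorem card_fixPoints (n : ℕ) : (fixPoints f n).card = ratDegree f ^ n + 1 := by
  have h := natDegree_fixPoly_le f n
  rw [fixPoints, Multiset.card_add, Multiset.card_map, Multiset.card_replicate,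
    ← (IsAlgClosed.splits (fixPoly f n)).natDegree_eq_card_roots]
  omega

open Classical in
omit [IsAlgClosed K] in
theorem count_fixPoints (n : ℕ) (w : OnePoint K) : (fixPoints f n).count w = fixMult f n w := by
  induction w using OnePoint.rec with
  | infty =>
    rw [fixPoints, Multiset.count_add, Multiset.count_replicate_self, Multiset.count_eq_zero_of_notMem]
    · simp [fixMult]
    · simp
  | coe a =>
    rw [fixPoints, Multiset.count_add, Multiset.count_replicate, if_neg (by simp),
      Multiset.count_map_eq_count' _ _ OnePoint.coe_injective, count_roots]
    rfl

omit [IsAlgClosed K] in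
theorem lintegral_fixMeasure (n : ℕ) (h : BerkovichP1 K → ℝ≥0∞) :
    ∫⁻ y, h y ∂(fixMeasure f n) = ((fixPoints f n).map fun w => h (classical w)).sum := by
  classical
  rw [fixMeasure, lintegral_sum_measure, Finset.sum_multiset_map_count, tsum_eq_sum
    (s := (fixPoints f n).toFinset)]
  · refine Finset.sum_congr rfl fun w _ => ?_
    rw [lintegral_smul_measure, lintegral_dirac, count_fixPoints, smul_eq_mul, nsmul_eq_mul]
  · intro w hw
    rw [← count_fixPoints, Multiset.count_eq_zero_of_notMem (by simpa using hw)]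
    simp

theorem exists_formAbs_fixPoly_eq (hf : 1 < ratDegree f) {n : ℕ} (hn : 1 ≤ n) :
    ∃ c : ℝ, 0 < c ∧ ∀ x, formAbs (ratDegree f ^ n + 1) (fixPoly f n) x =
      c * ((fixPoints f n).map fun w => chordalTo x w).prod := by
  set P := fixPoly f n
  set m := ratDegree f ^ n + 1
  have hP0 : P ≠ 0 := fixPoly_ne_zero f hf hn
  have hdeg : P.natDegree ≤ m := natDegree_fixPoly_le f n
  have hcard := (IsAlgClosed.splits P).natDegree_eq_card_roots
  have hmap (x : BerkovichP1 K) : ((fixPoints f n).map fun w => chordalTo x w).prod =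
      (P.roots.map fun a => chordalTo x (OnePoint.some a)).prod *
        chordalTo x OnePoint.infty ^ (m - P.natDegree) := by
    rw [fixPoints, Multiset.map_add, Multiset.prod_add, Multiset.map_map, Multiset.map_replicate,
      Multiset.prod_replicate]
    rfl
  have hpos : 0 < (P.roots.map fun a => norm2 K ‖a‖ 1).prod := by
    refine Multiset.prod_induction (fun t : ℝ => 0 < t) _ (fun _ _ => mul_pos) one_pos ?_
    intro t ht
    obtain ⟨a, -, rfl⟩ := Multiset.mem_map.1 ht
    exact norm2_one_pos _
  refine ⟨‖P.leadingCoeff‖ * (P.roots.map fun a => norm2 K ‖a‖ 1).prod,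
    mul_pos (norm_pos_iff.2 (leadingCoeff_ne_zero.2 hP0)) hpos, fun x => ?_⟩
  rw [hmap]
  induction x using OnePoint.rec with
  | infty =>
    rw [formAbs_infty, chordalTo_infty_infty]
    simp only [chordalTo_infty_some]
    rw [Multiset.prod_map_inv]
    rcases hdeg.lt_or_eq with h | h
    · rw [coeff_eq_zero_of_natDegree_lt h, zero_pow (by omega)]
      simp
    · rw [h, Nat.sub_self, pow_zero, mul_one, mul_assoc, mul_inv_cancel₀ hpos.ne', mul_one,
        ← h, leadingCoeff]
  | coe s =>
    rw [formAbs_some, chordalTo_some_infty]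
    simp only [chordalTo_some_some]
    have e1 : s.1 P = ‖P.leadingCoeff‖ * (P.roots.map fun a => s.1 (X - C a)).prod := by
      conv_lhs => rw [(IsAlgClosed.splits P).eq_prod_roots, map_mul, s.2, map_multiset_prod,
        Multiset.map_map]
      rfl
    have hN := norm2_one_pos (K := K) (s.1 X)
    rw [e1, Multiset.prod_map_div, Multiset.prod_map_mul, Multiset.map_const', Multiset.prod_replicate,
      ← hcard]
    obtain ⟨j, hj⟩ : ∃ j, m = P.natDegree + j := ⟨m - P.natDegree, by omega⟩
    rw [hj, Nat.add_sub_cancel_left, pow_add, inv_pow]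
    have := hpos.ne'
    field_simp

end Dynamics

/-! ### Integrals of extended-real functions -/

section ExtendedIntegral

variable {X : Type*} [MeasurableSpace X]

theorem toENNReal_add_eq (k : ℝ≥0∞) (b : ℝ) :
    (-(k : EReal) + (b : EReal)).toENNReal + (k + ENNReal.ofReal (-b)) =
      (-(-(k : EReal) + (b : EReal))).toENNReal + ENNReal.ofReal b := by
  induction k using ENNReal.recTopCoe with
  | top => simp
  | coe r =>
    have e : -(((r : ℝ≥0∞) : EReal)) + (b : EReal) = ((-(r : ℝ) + b : ℝ) : EReal) := by
      push_cast; rfl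
    rw [e, ← EReal.coe_neg]
    simp only [EReal.toENNReal_of_ne_top (EReal.coe_ne_top _), EReal.toReal_coe]
    have hr : (r : ℝ≥0∞) = ENNReal.ofReal (r : ℝ) := (ENNReal.ofReal_coe_nnreal).symm
    rw [hr]
    rcases le_total (-(r : ℝ) + b) 0 with h1 | h1 <;> rcases le_total b 0 with h2 | h2
    · rw [ENNReal.ofReal_of_nonpos h1, ENNReal.ofReal_of_nonpos h2, zero_add, add_zero,
        ← ENNReal.ofReal_add r.coe_nonneg (by linarith)]
      congr 1; ring
    · rw [ENNReal.ofReal_of_nonpos h1, ENNReal.ofReal_of_nonpos (neg_nonpos.2 h2), zero_add,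
        add_zero, ← ENNReal.ofReal_add (by linarith) h2]
      congr 1; ring
    · have := r.coe_nonneg
      have hb : b = 0 := by linarith
      have hr0 : (r : ℝ) = 0 := by linarith
      simp [hb, hr0]
    · rw [ENNReal.ofReal_of_nonpos (neg_nonpos.2 h1), ENNReal.ofReal_of_nonpos (neg_nonpos.2 h2),
        zero_add, add_zero, ← ENNReal.ofReal_add h1 r.coe_nonneg]
      congr 1; ring

theorem coe_sub_coe_le_of_add_le {P N I B C : ℝ≥0∞} (hP : P ≠ ⊤) (hB : B ≠ ⊤) (hC : C ≠ ⊤)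
    (h : P + (I + C) ≤ N + B) :
    (P : EReal) - N ≤ -(I : EReal) + ((B.toReal - C.toReal : ℝ) : EReal) := by
  lift P to NNReal using hP
  lift B to NNReal using hB
  lift C to NNReal using hC
  induction N using ENNReal.recTopCoe with
  | top => simp
  | coe N =>
    have hI : I ≠ ⊤ := by
      rintro rfl
      simp at h
    lift I to NNReal using hI
    have h' : (P : ℝ) + (I + C) ≤ N + B := by exact_mod_cast h
    have e1 : ((P : ℝ≥0∞) : EReal) - ((N : ℝ≥0∞) : EReal) = ((P - N : ℝ) : EReal) := by
      push_cast; rfl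
    have e2 : -((I : ℝ≥0∞) : EReal) = ((-(I : ℝ) : ℝ) : EReal) := by push_cast; rfl
    rw [e1, e2, ← EReal.coe_add, EReal.coe_le_coe_iff]
    simp only [ENNReal.coe_toReal]
    linarith

theorem le_coe_sub_coe_of_le_add {P N I B C : ℝ≥0∞} (hP : P ≠ ⊤) (hB : B ≠ ⊤) (hC : C ≠ ⊤)
    (h : N + B ≤ P + (I + C)) :
    -(I : EReal) + ((B.toReal - C.toReal : ℝ) : EReal) ≤ (P : EReal) - N := by
  lift P to NNReal using hP
  lift B to NNReal using hB
  lift C to NNReal using hC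
  induction I using ENNReal.recTopCoe with
  | top => simp
  | coe I =>
    have hN : N ≠ ⊤ := by
      rintro rfl
      rw [top_add, top_le_iff] at h
      exact absurd h (by finiteness)
    lift N to NNReal using hN
    have h' : (N : ℝ) + B ≤ P + (I + C) := by exact_mod_cast h
    have e1 : ((P : ℝ≥0∞) : EReal) - ((N : ℝ≥0∞) : EReal) = ((P - N : ℝ) : EReal) := by
      push_cast; rfl
    have e2 : -((I : ℝ≥0∞) : EReal) = ((-(I : ℝ) : ℝ) : EReal) := by push_cast; rfl
    rw [e1, e2, ← EReal.coe_add, EReal.coe_le_coe_iff]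
    simp only [ENNReal.coe_toReal]
    linarith

variable {ν : Measure X} {b : X → ℝ}

theorem lintegral_toENNReal_ne_top (k : X → ℝ≥0∞) (hb : Integrable b ν) :
    ∫⁻ x, (-(k x : EReal) + (b x : EReal)).toENNReal ∂ν ≠ ⊤ := by
  refine ne_top_of_le_ne_top hb.lintegral_lt_top.ne (lintegral_mono fun x => ?_)
  have h : -(k x : EReal) + (b x : EReal) ≤ b x := by
    have : -(k x : EReal) ≤ 0 := by simpa using EReal.coe_ennreal_nonneg (k x)
    simpa using add_le_add_left this (b x : EReal)
  exact (EReal.toENNReal_le_toENNReal h).trans (by simp)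

theorem eintegral_le (k : X → ℝ≥0∞) (hb : Integrable b ν) :
    eintegral ν (fun x => -(k x : EReal) + (b x : EReal)) ≤
      -((∫⁻ x, k x ∂ν : ℝ≥0∞) : EReal) + ((∫ x, b x ∂ν : ℝ) : EReal) := by
  rw [integral_eq_lintegral_pos_part_sub_lintegral_neg_part hb]
  refine coe_sub_coe_le_of_add_le (lintegral_toENNReal_ne_top k hb) hb.lintegral_lt_top.ne
    hb.neg.lintegral_lt_top.ne ?_
  have hbm : AEMeasurable (fun x => ENNReal.ofReal (b x)) ν := hb.aemeasurable.ennreal_ofReal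
  rw [← lintegral_add_right' _ hbm]
  refine (add_le_add_right (le_lintegral_add _ _) _).trans ((le_lintegral_add _ _).trans ?_)
  exact (lintegral_congr fun x => toENNReal_add_eq (k x) (b x)).le

theorem eintegral_eq {k : X → ℝ≥0∞} (hk : AEMeasurable k ν) (hb : Integrable b ν) :
    eintegral ν (fun x => -(k x : EReal) + (b x : EReal)) =
      -((∫⁻ x, k x ∂ν : ℝ≥0∞) : EReal) + ((∫ x, b x ∂ν : ℝ) : EReal) := by
  refine (eintegral_le k hb).antisymm ?_
  rw [integral_eq_lintegral_pos_part_sub_lintegral_neg_part hb]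
  refine le_coe_sub_coe_of_le_add (lintegral_toENNReal_ne_top k hb) hb.lintegral_lt_top.ne
    hb.neg.lintegral_lt_top.ne ?_
  have hbm : AEMeasurable (fun x => ENNReal.ofReal (-b x)) ν := hb.aemeasurable.neg.ennreal_ofReal
  have hbm' : AEMeasurable (fun x => ENNReal.ofReal (b x)) ν := hb.aemeasurable.ennreal_ofReal
  have hkb : AEMeasurable (fun x => k x + ENNReal.ofReal (-b x)) ν := hk.add hbm
  rw [← lintegral_add_right' _ hbm, ← lintegral_add_right' _ hkb, ← lintegral_add_right' _ hbm']
  exact (lintegral_congr fun x => toENNReal_add_eq (k x) (b x)).ge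

theorem eintegral_const [IsProbabilityMeasure ν] (a : ℝ) :
    eintegral ν (fun _ => (a : EReal)) = a := by
  have := eintegral_eq (ν := ν) (k := fun _ => 0) aemeasurable_const (integrable_const a)
  simpa using this

end ExtendedIntegral

/-! ### The logarithmic kernel -/

section Kernel

/-- `-log t ∈ [0,∞]` for `t ∈ [0,1]`. -/
def negLog (t : ℝ) : ℝ≥0∞ := (-elog t).toENNReal

theorem elog_eq {t : ℝ} (ht : t ≤ 1) : elog t = -(negLog t : EReal) := by
  have : elog t ≤ 0 := by
    rw [elog, ← ENNReal.log_one]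
    exact ENNReal.log_monotone (ENNReal.ofReal_le_one.2 ht)
  rw [negLog, EReal.coe_toENNReal (EReal.neg_nonneg.2 this), neg_neg]

theorem elog_of_pos {t : ℝ} (ht : 0 < t) : elog t = (Real.log t : EReal) :=
  ENNReal.log_ofReal_of_pos ht

theorem elog_mul {a b : ℝ} (ha : 0 ≤ a) : elog (a * b) = elog a + elog b := by
  rw [elog, ENNReal.ofReal_mul ha, ENNReal.log_mul_add]; rfl

theorem negLog_of_pos {t : ℝ} (ht : 0 < t) : negLog t = ENNReal.ofReal (-Real.log t) := by
  rw [negLog, elog_of_pos ht, ← EReal.coe_neg, EReal.toENNReal_of_ne_top (EReal.coe_ne_top _),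
    EReal.toReal_coe]

@[simp] theorem negLog_zero : negLog 0 = ⊤ := by simp [negLog, elog]

theorem measurable_negLog : Measurable negLog := by
  have : Measurable fun t : ℝ => -elog t :=
    (continuous_neg.measurable).comp (ENNReal.measurable_log.comp ENNReal.measurable_ofReal)
  exact measurable_ereal_toENNReal.comp this

theorem elog_multiset_prod {ι : Type*} (M : Multiset ι) (h : ι → ℝ) (h0 : ∀ i, 0 ≤ h i)
    (h1 : ∀ i, h i ≤ 1) :
    elog (M.map h).prod = -(((M.map fun i => negLog (h i)).sum : ℝ≥0∞) : EReal) := by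
  induction M using Multiset.induction with
  | empty => simp [elog]
  | cons i M ih =>
    rw [Multiset.map_cons, Multiset.prod_cons, Multiset.map_cons, Multiset.sum_cons,
      elog_mul (h0 i), ih, elog_eq (h1 i), EReal.coe_ennreal_add, EReal.neg_add
        (Or.inl (EReal.coe_ennreal_ne_bot _)) (Or.inr (EReal.coe_ennreal_ne_bot _)), sub_eq_add_neg]

end Kernel

/-! ### The weighted equilibrium and the Riesz decomposition -/

section Riesz

/-- The facts of potential theory on `𝖯¹(K)` that enter the Riesz decomposition. -/
structure PotentialTheory (K : Type*) [NontriviallyNormedField K] : Prop where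
  dense : DenseRange (classical (K := K))
  hsia_classical : ∀ (x : BerkovichP1 K) (w : OnePoint K), hsia x (classical w) = chordalTo x w
  hsia_le_one : ∀ x y : BerkovichP1 K, hsia x y ≤ 1
  hsia_comm : ∀ x y : BerkovichP1 K, hsia x y = hsia y x
  measurable_hsia : ∀ x : BerkovichP1 K, Measurable (hsia x)
  eq_add_const : ∀ (g₁ g₂ : BerkovichP1 K → ℝ) (μ : Measure (BerkovichP1 K)),
    IsContinuousWeight g₁ μ → IsContinuousWeight g₂ μ → ∃ c, ∀ x, g₁ x = g₂ x + c
  potential_eq : ∀ (g : BerkovichP1 K → ℝ) (μ : Measure (BerkovichP1 K)),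
    IsContinuousWeight g μ → ∃ κ : ℝ, ∀ x, g x + κ ≤ 0 ∧
      ∫⁻ y, negLog (hsia x y) ∂μ = ENNReal.ofReal (-(g x + κ))
  energy_le : ∀ μ ν : Measure (BerkovichP1 K), IsProbabilityMeasure μ → IsProbabilityMeasure ν →
    2 * ∫⁻ x, ∫⁻ y, negLog (hsia x y) ∂μ ∂ν ≤
      (∫⁻ x, ∫⁻ y, negLog (hsia x y) ∂ν ∂ν) + ∫⁻ x, ∫⁻ y, negLog (hsia x y) ∂μ ∂μ

variable {K : Type*} [NontriviallyNormedField K]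

theorem integrable_of_continuous {g : BerkovichP1 K → ℝ} (hg : Continuous g)
    (ν : Measure (BerkovichP1 K)) [IsFiniteMeasure ν] : Integrable g ν := by
  obtain ⟨M, hM⟩ := isCompact_univ.exists_bound_of_continuousOn hg.continuousOn
  exact Integrable.of_bound hg.measurable.aestronglyMeasurable M
    (Eventually.of_forall fun x => hM x (Set.mem_univ x))

namespace PotentialTheory

variable (H : PotentialTheory K)
include H

theorem potentialKernel_eq (g : BerkovichP1 K → ℝ) (x y : BerkovichP1 K) :
    potentialKernel g x y = -(negLog (hsia x y) : EReal) + ((-g x - g y : ℝ) : EReal) := by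
  rw [potentialKernel, elog_eq (H.hsia_le_one x y)]
  push_cast
  rw [sub_eq_add_neg, sub_eq_add_neg, sub_eq_add_neg, add_assoc]

theorem potential_eq_add {g : BerkovichP1 K → ℝ} (hg : Continuous g) (ν : Measure (BerkovichP1 K))
    [IsFiniteMeasure ν] (x : BerkovichP1 K) : potential g ν x =
      -((∫⁻ y, negLog (hsia x y) ∂ν : ℝ≥0∞) : EReal) +
        ((-(ν.real Set.univ * g x) - ∫ y, g y ∂ν : ℝ) : EReal) := by
  have hi := integrable_of_continuous hg ν
  have hk : AEMeasurable (fun y => negLog (hsia x y)) ν :=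
    (measurable_negLog.comp (H.measurable_hsia x)).aemeasurable
  have hb : Integrable (fun y => -g x - g y) ν := (integrable_const _).sub hi
  rw [potential, funext (H.potentialKernel_eq g x), eintegral_eq hk hb,
    integral_sub (integrable_const _) hi]
  simp

theorem energy_le_of_weight {g : BerkovichP1 K → ℝ} {μ : Measure (BerkovichP1 K)}
    (hg : IsContinuousWeight g μ) {κ : ℝ} (hκ : ∀ x, g x + κ ≤ 0 ∧
      ∫⁻ y, negLog (hsia x y) ∂μ = ENNReal.ofReal (-(g x + κ)))
    (ν : Measure (BerkovichP1 K)) [hν : IsProbabilityMeasure ν] :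
    energy g ν ≤ ((κ - ∫ y, g y ∂μ : ℝ) : EReal) := by
  have hμ := hg.isProbabilityMeasure
  have hcross (σ : Measure (BerkovichP1 K)) [IsProbabilityMeasure σ] :
      ∫⁻ x, ∫⁻ y, negLog (hsia x y) ∂μ ∂σ = ENNReal.ofReal (-(∫ y, g y ∂σ) - κ) := by
    have hi := integrable_of_continuous hg.continuous σ
    have hb : Integrable (fun y => -(g y + κ)) σ := (hi.add (integrable_const κ)).neg
    simp only [fun x => (hκ x).2]
    rw [← ofReal_integral_eq_lintegral_ofReal hb
      (Eventually.of_forall fun x => neg_nonneg.2 (hκ x).1), integral_neg,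
      integral_add hi (integrable_const κ)]
    simp [add_comm, sub_eq_add_neg]
  have hpsd := H.energy_le μ ν hμ hν
  rw [hcross ν, hcross μ] at hpsd
  have hi := integrable_of_continuous hg.continuous ν
  have h1 : energy g ν ≤ -((∫⁻ x, ∫⁻ y, negLog (hsia x y) ∂ν ∂ν : ℝ≥0∞) : EReal) +
      ((-(2 * ∫ y, g y ∂ν) : ℝ) : EReal) := by
    rw [energy, funext (H.potential_eq_add hg.continuous ν)]
    simp only [probReal_univ, one_mul]
    have hb : Integrable (fun x => -g x - ∫ y, g y ∂ν) ν := hi.neg.sub (integrable_const _)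
    refine (eintegral_le _ hb).trans (le_of_eq ?_)
    congr 2
    rw [integral_sub hi.fun_neg (integrable_const _)]
    simp only [integral_neg, integral_const, probReal_univ, one_smul]
    ring
  refine h1.trans ?_
  generalize (∫⁻ x, ∫⁻ y, negLog (hsia x y) ∂ν ∂ν) = I at hpsd ⊢
  have hn : 0 ≤ -(∫ y, g y ∂μ) - κ := by
    have hle : ∫ y, g y ∂μ ≤ ∫ _, -κ ∂μ :=
      integral_mono (integrable_of_continuous hg.continuous μ) (integrable_const _)
        fun x => by have := (hκ x).1; simp only; linarith
    simp only [integral_const, probReal_univ, one_smul] at hle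
    linarith
  induction I using ENNReal.recTopCoe with
  | top => simp
  | coe I =>
    rw [← ENNReal.ofReal_ofNat, ← ENNReal.ofReal_mul (by norm_num), ← ENNReal.ofReal_coe_nnreal,
      ← ENNReal.ofReal_add I.coe_nonneg hn, ENNReal.ofReal_le_ofReal_iff (add_nonneg I.coe_nonneg hn)] at hpsd
    have e2 : -((I : ℝ≥0∞) : EReal) = ((-(I : ℝ) : ℝ) : EReal) := by push_cast; rfl
    rw [e2, ← EReal.coe_add, EReal.coe_le_coe_iff]
    linarith

theorem integral_eq_of_isNormalizedWeight {g : BerkovichP1 K → ℝ} {μ : Measure (BerkovichP1 K)}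
    (hg : IsNormalizedWeight g μ) {κ : ℝ} (hκ : ∀ x, g x + κ ≤ 0 ∧
      ∫⁻ y, negLog (hsia x y) ∂μ = ENNReal.ofReal (-(g x + κ))) :
    ∫ y, g y ∂μ = κ := by
  have hw := hg.toIsContinuousWeight
  have hμ := hw.isProbabilityMeasure
  have hE : energy g μ = ((κ - ∫ y, g y ∂μ : ℝ) : EReal) := by
    have : potential g μ = fun _ => ((κ - ∫ y, g y ∂μ : ℝ) : EReal) := by
      funext x
      rw [H.potential_eq_add hw.continuous μ x, (hκ x).2, EReal.coe_ennreal_ofReal,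
        max_eq_left (neg_nonneg.2 (hκ x).1), ← EReal.coe_neg, ← EReal.coe_add]
      congr 1
      simp only [probReal_univ]
      ring
    rw [energy, this, eintegral_const]
  have hV : equilibriumEnergy g = ((κ - ∫ y, g y ∂μ : ℝ) : EReal) := by
    refine le_antisymm (iSup_le fun ν => iSup_le fun hν => iSup_le fun _ =>
      H.energy_le_of_weight hw hκ ν) ?_
    rw [← hE]
    exact le_iSup_of_le μ (le_iSup_of_le hμ (le_iSup_of_le hw.regular le_rfl))
  rw [hg.equilibriumEnergy_eq_zero, eq_comm, EReal.coe_eq_zero] at hV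
  linarith

theorem riesz_decomposition [IsAlgClosed K] (f : RatFunc K) (hf : 1 < ratDegree f)
    (μf : Measure (BerkovichP1 K)) (hμf : IsEquilibriumMeasure f μf)
    (gf : BerkovichP1 K → ℝ) (hgf : IsNormalizedWeight gf μf)
    (n : ℕ) (hn : 1 ≤ n) (x : BerkovichP1 K) :
    logProximity f n gf x =
      potential gf (fixMeasure f n) x + eintegral μf (logProximity f n gf) := by
  have hμ := hμf.isProbabilityMeasure
  have hw := hgf.toIsContinuousWeight
  obtain ⟨hFc, hFeq⟩ := liftGreen_eq f H.dense hf
  obtain ⟨c₀, hc₀⟩ := H.eq_add_const gf (liftGreen f) μf hw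
    ⟨hFc, hμf.isProbabilityMeasure, hμf.regular, hμf.laplacian⟩
  obtain ⟨κ, hκ⟩ := H.potential_eq gf μf hw
  have hA := H.integral_eq_of_isNormalizedWeight hgf hκ
  obtain ⟨c, hc, hform⟩ := exists_formAbs_fixPoly_eq f hf hn
  set M := fixPoints f n
  set m : ℝ := (ratDegree f : ℝ) ^ n + 1 with hm
  set S : BerkovichP1 K → ℝ≥0∞ := fun x => (M.map fun w => negLog (hsia x (classical w))).sum with hS
  have huniv : fixMeasure f n Set.univ = ENNReal.ofReal m := by
    have := lintegral_fixMeasure f n (fun _ => 1)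
    rw [lintegral_one, Multiset.map_const', Multiset.sum_replicate, card_fixPoints] at this
    rw [this, nsmul_eq_mul, mul_one, hm, ← Nat.cast_pow, ← Nat.cast_add_one, ENNReal.ofReal_natCast]
  have hfin : IsFiniteMeasure (fixMeasure f n) := ⟨by rw [huniv]; exact ENNReal.ofReal_lt_top⟩
  have hreal : (fixMeasure f n).real Set.univ = m := by
    rw [measureReal_def, huniv, ENNReal.toReal_ofReal (by positivity)]
  set G := ∫ y, gf y ∂(fixMeasure f n) with hG
  set B : ℝ := Real.log c + ((ratDegree f : ℝ) ^ n - 1) * c₀ with hB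
  have hlog (x : BerkovichP1 K) :
      logProximity f n gf x = -(S x : EReal) + ((B - m * gf x : ℝ) : EReal) := by
    have h1 : elog (proximity f n x) =
        -(S x : EReal) + ((Real.log c - iterLog f n x : ℝ) : EReal) := by
      rw [proximity_eq f H.dense, hform, mul_comm, ← mul_assoc,
        elog_mul (mul_nonneg (Real.exp_pos _).le hc.le), elog_of_pos (mul_pos (Real.exp_pos _) hc),
        elog_multiset_prod _ _ (fun w => chordalTo_nonneg x w)
          (fun w => H.hsia_classical x w ▸ H.hsia_le_one x _),
        Real.log_mul (Real.exp_pos _).ne' hc.ne', Real.log_exp, add_comm]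
      simp only [hS, H.hsia_classical]
      congr 2
      ring
    rw [logProximity, h1, sub_eq_add_neg, sub_eq_add_neg, add_assoc, add_assoc, ← EReal.coe_neg,
      ← EReal.coe_neg, ← EReal.coe_add, ← EReal.coe_add]
    congr 2
    rw [hc₀ ((berkMap f)^[n] x), hFeq, hB, hm, hc₀ x]
    ring
  have hpot : potential gf (fixMeasure f n) x = -(S x : EReal) + ((-(m * gf x) - G : ℝ) : EReal) := by
    rw [H.potential_eq_add hw.continuous, lintegral_fixMeasure, hreal]
  have hSm : Measurable S := by
    have : S = fun x => (M.map fun w => negLog (hsia (classical w) x)).sum := by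
      simp only [hS, H.hsia_comm]
    rw [this]
    generalize M = M'
    induction M' using Multiset.induction with
    | empty => simp
    | cons w M' ih =>
      simp only [Multiset.map_cons, Multiset.sum_cons]
      exact (measurable_negLog.comp (H.measurable_hsia _)).add ih
  have hSint : ∫⁻ x, S x ∂μf = ENNReal.ofReal (-(G + m * κ)) := by
    have h1 : ∫⁻ x, S x ∂μf =
        (M.map fun w => ENNReal.ofReal (-(gf (classical w) + κ))).sum := by
      simp only [hS]
      generalize M = M'
      induction M' using Multiset.induction with
      | empty => simp
      | cons w M' ih =>
        simp only [Multiset.map_cons, Multiset.sum_cons]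
        rw [lintegral_add_left, ih]
        · congr 1
          rw [← (hκ (classical w)).2]
          exact lintegral_congr fun x => by rw [H.hsia_comm]
        · simp only [H.hsia_comm _ (classical w)]
          exact measurable_negLog.comp (H.measurable_hsia _)
    have hi := integrable_of_continuous hw.continuous (fixMeasure f n)
    have hb : Integrable (fun y => -(gf y + κ)) (fixMeasure f n) :=
      (hi.add (integrable_const κ)).neg
    rw [h1, ← lintegral_fixMeasure f n (fun y => ENNReal.ofReal (-(gf y + κ))),
      ← ofReal_integral_eq_lintegral_ofReal hb
      (Eventually.of_forall fun x => neg_nonneg.2 (hκ x).1), integral_neg,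
      integral_add hi (integrable_const κ), integral_const, hreal, smul_eq_mul]
  have hneg : 0 ≤ -(G + m * κ) := by
    have hi := integrable_of_continuous hw.continuous (fixMeasure f n)
    have hle : G ≤ ∫ _, -κ ∂(fixMeasure f n) :=
      integral_mono hi (integrable_const _)
        fun x => by have := (hκ x).1; simp only; linarith
    rw [integral_const, hreal, smul_eq_mul] at hle
    linarith
  have hint : eintegral μf (logProximity f n gf) = ((B + G : ℝ) : EReal) := by
    have hi := integrable_of_continuous hw.continuous μf
    have hb : Integrable (fun x => B - m * gf x) μf := (integrable_const _).sub (hi.const_mul m)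
    rw [funext hlog, eintegral_eq hSm.aemeasurable hb,
      hSint, integral_sub (integrable_const _) (hi.const_mul m), integral_const_mul, hA,
      EReal.coe_ennreal_ofReal, max_eq_left hneg, ← EReal.coe_neg, ← EReal.coe_add]
    congr 1
    simp only [integral_const, probReal_univ, one_smul]
    ring
  rw [hlog, hpot, hint, add_assoc, ← EReal.coe_add]
  congr 2
  ring

end PotentialTheory

end Riesz

theorem le_of_forall_pow_le_succ_mul_pow {c C : ℝ} (hC : 0 ≤ C)
    (h : ∀ N : ℕ, c ^ N ≤ (N + 1) * C ^ N) : c ≤ C := by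
  rcases hC.eq_or_lt with rfl | hC
  · simpa using h 1
  refine le_of_forall_gt_imp_ge_of_dense fun a ha => ?_
  obtain ⟨m, hm⟩ : ∃ m : ℕ, ((m + 1) : ℕ) < (a / C) ^ m := by
    apply_mod_cast Real.exists_natCast_add_one_lt_pow_of_one_lt
    rwa [one_lt_div hC]
  rw [div_pow, lt_div_iff₀ (by positivity)] at hm
  push_cast at hm
  refine le_of_pow_le_pow_left₀ (n := m) (fun h0 => ?_) (hC.trans ha).le ((h m).trans hm.le)
  simp [h0] at hm

theorem BerkovichA1.isInducing_linear {K : Type*} [NontriviallyNormedField K] [IsAlgClosed K] :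
    IsInducing fun (s : BerkovichA1 K) (a : K) => s.1 (X - C a) := by
  set Ψ : (K → ℝ) → K[X] → ℝ := fun h P => ‖P.leadingCoeff‖ * (P.roots.map h).prod
  have hΨ : Continuous Ψ := by
    refine continuous_pi fun P => continuous_const.mul ?_
    exact continuous_multiset_prod P.roots fun a _ => _root_.continuous_apply a
  refine IsInducing.of_comp (continuous_pi fun a => BerkovichA1.continuous_apply _) hΨ ?_
  convert (BerkovichA1.isEmbedding_coe (K := K)).isInducing using 1
  funext s P
  conv_rhs => rw [(IsAlgClosed.splits P).eq_prod_roots, map_mul, s.2, map_multiset_prod,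
    Multiset.map_map]
  rfl

theorem exists_norm_mem_Ioo {K : Type*} [NontriviallyNormedField K] [IsAlgClosed K] {lo hi : ℝ}
    (hi0 : 0 < hi) (h : lo < hi) : ∃ x : K, lo < ‖x‖ ∧ ‖x‖ < hi := by
  obtain ⟨lo', h1, h2⟩ := exists_between (max_lt h hi0)
  have hlo' : 0 < lo' := (le_max_right _ _).trans_lt h1
  obtain ⟨c, hc⟩ := NormedField.exists_one_lt_norm K
  obtain ⟨n, hn⟩ := pow_unbounded_of_one_lt ‖c‖ ((one_lt_div hlo').2 h2)
  have hn0 : n ≠ 0 := by rintro rfl; simp at hn; linarith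
  obtain ⟨y, hy⟩ := IsAlgClosed.exists_pow_nat_eq c (Nat.pos_of_ne_zero hn0)
  have hyn : ‖y‖ ^ n = ‖c‖ := by rw [← norm_pow, hy]
  have hy1 : 1 < ‖y‖ := by
    by_contra hle
    have := pow_le_one₀ (n := n) (norm_nonneg y) (not_lt.1 hle)
    linarith
  have hy2 : ‖y‖ < hi / lo' := lt_of_pow_lt_pow_left₀ n (by positivity) (hyn.trans_lt hn)
  obtain ⟨k, hk1, hk2⟩ := exists_mem_Ico_zpow hlo' hy1
  refine ⟨y ^ (k + 1), ?_, ?_⟩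
  · rw [norm_zpow]; exact ((le_max_left _ _).trans_lt h1).trans hk2
  · rw [norm_zpow, zpow_add_one₀ (by positivity)]
    calc ‖y‖ ^ k * ‖y‖ ≤ lo' * ‖y‖ := by gcongr
      _ < lo' * (hi / lo') := by gcongr
      _ = hi := by field_simp

/-! ### The non-archimedean Berkovich line -/

section Nonarchimedean

variable {K : Type*} [NontriviallyNormedField K] [hK : IsUltrametricDist K]

theorem norm2_eq_max (a b : ℝ) : norm2 K a b = max a b := if_pos hK

theorem BerkovichA1.add_le_max (s : BerkovichA1 K) (P Q : K[X]) :
    s.1 (P + Q) ≤ max (s.1 P) (s.1 Q) := by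
  have hM : 0 ≤ max (s.1 P) (s.1 Q) := (apply_nonneg s.1 P).trans (le_max_left _ _)
  refine le_of_forall_pow_le_succ_mul_pow hM fun N => ?_
  rw [← map_pow, add_pow]
  refine (Finset.le_sum_of_subadditive (fun P => s.1 P) (map_zero s.1).le
    (fun P Q => map_add_le_add s.1 P Q) _ _).trans ?_
  have : ((N : ℝ) + 1) * max (s.1 P) (s.1 Q) ^ N =
      ∑ _k ∈ Finset.range (N + 1), max (s.1 P) (s.1 Q) ^ N := by simp
  rw [this]
  refine Finset.sum_le_sum fun k hk => ?_
  have hk' : k ≤ N := Nat.lt_succ_iff.1 (Finset.mem_range.1 hk)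
  rw [map_mul, map_mul, map_pow, map_pow]
  have h1 : s.1 ((N.choose k : ℕ) : K[X]) ≤ 1 := by
    rw [← map_natCast (C : K →+* K[X]), s.2]
    exact IsUltrametricDist.norm_natCast_le_one K _
  calc s.1 P ^ k * s.1 Q ^ (N - k) * s.1 ((N.choose k : ℕ) : K[X])
      ≤ max (s.1 P) (s.1 Q) ^ k * max (s.1 P) (s.1 Q) ^ (N - k) * 1 := by
        have := apply_nonneg s.1 P
        have := apply_nonneg s.1 Q
        gcongr
        · exact le_max_left _ _
        · exact le_max_right _ _
    _ = max (s.1 P) (s.1 Q) ^ N := by rw [mul_one, pow_mul_pow_sub _ hk']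

theorem BerkovichA1.apply_sub_le (s : BerkovichA1 K) (a b : K) :
    s.1 (X - C a) ≤ max (s.1 (X - C b)) ‖b - a‖ := by
  have := s.add_le_max (X - C b) (C (b - a))
  rwa [s.2, C_sub, sub_add_sub_cancel] at this

theorem BerkovichA1.norm_sub_le (s : BerkovichA1 K) (a b : K) :
    ‖a - b‖ ≤ max (s.1 (X - C a)) (s.1 (X - C b)) := by
  have := s.add_le_max (X - C b) (-(X - C a))
  rwa [map_neg_eq_map, show X - C b + -(X - C a) = C (a - b) by rw [C_sub]; ring, s.2,
    max_comm] at this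

theorem exists_norm_sub_mem [IsAlgClosed K] (s : BerkovichA1 K) (I : Finset K) (u : K → Set ℝ)
    (hu : ∀ a ∈ I, IsOpen (u a) ∧ s.1 (X - C a) ∈ u a) : ∃ b : K, ∀ a ∈ I, ‖b - a‖ ∈ u a := by
  rcases I.eq_empty_or_nonempty with rfl | hI
  · exact ⟨0, by simp⟩
  obtain ⟨a₀, ha₀, hmin⟩ := I.exists_min_image (fun a => s.1 (X - C a)) hI
  set r := s.1 (X - C a₀) with hr
  have hval (a) (ha : a ∈ I) : s.1 (X - C a) = max r ‖a₀ - a‖ := by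
    refine le_antisymm (s.apply_sub_le a a₀) (max_le (hmin a ha) ?_)
    exact (s.norm_sub_le a₀ a).trans (max_le (hmin a ha) le_rfl)
  rcases (apply_nonneg s.1 (X - C a₀)).eq_or_lt with h0 | h0
  · refine ⟨a₀, fun a ha => ?_⟩
    have := (hu a ha).2
    rwa [hval a ha, hr, ← h0, max_eq_right (norm_nonneg _)] at this
  have hev : ∀ᶠ t in 𝓝[<] r, ∀ a ∈ I, (‖a₀ - a‖ < r → ‖a₀ - a‖ < t ∧ t ∈ u a) := by
    rw [Finset.eventually_all]
    intro a ha
    by_cases h : ‖a₀ - a‖ < r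
    · have h1 : ∀ᶠ t in 𝓝 r, ‖a₀ - a‖ < t := eventually_gt_nhds h
      have h2 : ∀ᶠ t in 𝓝 r, t ∈ u a := by
        refine (hu a ha).1.mem_nhds ?_
        have := (hu a ha).2
        rwa [hval a ha, max_eq_left h.le] at this
      filter_upwards [nhdsWithin_le_nhds h1, nhdsWithin_le_nhds h2] with t ht1 ht2 _
      exact ⟨ht1, ht2⟩
    · exact Eventually.of_forall fun t ht => absurd ht h
  obtain ⟨l, hl, hsub⟩ := (mem_nhdsLT_iff_exists_Ioo_subset).1 hev
  obtain ⟨y, hy1, hy2⟩ := exists_norm_mem_Ioo (K := K) h0 hl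
  have hy := hsub ⟨hy1, hy2⟩
  refine ⟨a₀ + y, fun a ha => ?_⟩
  have e : a₀ + y - a = (a₀ - a) + y := by ring
  rcases lt_or_ge ‖a₀ - a‖ r with h | h
  · obtain ⟨h1, h2⟩ := hy a ha h
    rw [e, IsUltrametricDist.norm_add_eq_max_of_norm_ne_norm h1.ne, max_eq_right h1.le]
    exact h2
  · have h1 : ‖y‖ < ‖a₀ - a‖ := hy2.trans_le h
    rw [e, IsUltrametricDist.norm_add_eq_max_of_norm_ne_norm h1.ne', max_eq_left h1.le]
    have := (hu a ha).2
    rwa [hval a ha, max_eq_right h] at this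

theorem denseRange_classical_of_ultrametric [IsAlgClosed K] :
    DenseRange (classical (K := K)) := by
  intro x
  induction x using OnePoint.rec with
  | infty => exact subset_closure ⟨OnePoint.infty, rfl⟩
  | coe s =>
    have h1 : s ∈ closure (Set.range (evalPoint (K := K))) := by
      rw [(BerkovichA1.isInducing_linear (K := K)).closure_eq_preimage_closure_image,
        Set.mem_preimage, mem_closure_iff]
      intro U hU hsU
      obtain ⟨I, u, hu, hI⟩ := isOpen_pi_iff.1 hU _ hsU
      obtain ⟨b, hb⟩ := exists_norm_sub_mem s I u hu
      exact ⟨_, hI fun a ha => by simpa using hb a ha, Set.mem_image_of_mem _ ⟨b, rfl⟩⟩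
    have h2 := image_closure_subset_closure_image (OnePoint.continuous_coe (X := BerkovichA1 K))
      (Set.mem_image_of_mem _ h1)
    refine closure_mono ?_ h2
    rintro _ ⟨_, ⟨a, rfl⟩, rfl⟩
    exact ⟨OnePoint.some a, rfl⟩

/-! ### Disks -/

theorem isNonarchimedean_absValue : IsNonarchimedean (absValue K) := fun x y =>
  IsUltrametricDist.norm_add_le_max x y

/-- The point of the Berkovich line attached to the closed disk of center `a` and radius `r`. -/
def diskPoint (a : K) {r : ℝ} (hr : 0 < r) : BerkovichA1 K :=
  have abv : IsAbsoluteValue (Polynomial.gaussNorm (absValue K) r) :=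
    Polynomial.gaussNorm_isAbsoluteValue isNonarchimedean_absValue hr
  ⟨{ toFun := fun P => (P.comp (X + C a)).gaussNorm (absValue K) r
     map_zero' := by simp
     add_le' := fun P Q => by rw [add_comp]; exact abv.abv_add' _ _
     neg' := fun P => by
       rw [neg_comp]; exact IsAbsoluteValue.abv_neg (Polynomial.gaussNorm (absValue K) r) _
     map_one' := by
       rw [one_comp]; exact IsAbsoluteValue.abv_one (Polynomial.gaussNorm (absValue K) r)
     map_mul' := fun P Q => by rw [mul_comp]; exact abv.abv_mul' _ _ }, fun b => by
      change ((C b).comp (X + C a)).gaussNorm (absValue K) r = ‖b‖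
      rw [C_comp, gaussNorm_C]; rfl⟩

theorem diskPoint_apply (a : K) {r : ℝ} (hr : 0 < r) (P : K[X]) :
    (diskPoint a hr).1 P = (P.comp (X + C a)).gaussNorm (absValue K) r := rfl

theorem diskPoint_linear (a b : K) {r : ℝ} (hr : 0 < r) :
    (diskPoint a hr).1 (X - C b) = max r ‖a - b‖ := by
  rw [diskPoint_apply, sub_comp, X_comp, C_comp, add_sub_assoc, ← C_sub]
  have hX : (X : K[X]).gaussNorm (absValue K) r = r := by
    rw [← monomial_one_one_eq_X, gaussNorm_monomial]; simp
  have hC : (C (a - b) : K[X]).gaussNorm (absValue K) r = ‖a - b‖ := by rw [gaussNorm_C]; rfl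
  refine le_antisymm ?_ (max_le ?_ ?_)
  · have := isNonarchimedean_gaussNorm (absValue K) isNonarchimedean_absValue hr.le
      (X : K[X]) (C (a - b))
    rwa [hX, hC] at this
  · have := le_gaussNorm (absValue K) (X + C (a - b)) hr.le 1
    simpa [coeff_C] using this
  · have := le_gaussNorm (absValue K) (X + C (a - b)) hr.le 0
    simp only [coeff_add, coeff_X_zero, coeff_C_zero, zero_add, pow_zero, mul_one] at this
    exact this

theorem diskPoint_X (a : K) {r : ℝ} (hr : 0 < r) : (diskPoint a hr).1 X = max r ‖a‖ := by
  simpa using diskPoint_linear a 0 hr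

theorem diskPoint_notMem_range (a : K) {r : ℝ} (hr : 0 < r) :
    (OnePoint.some (diskPoint a hr) : BerkovichP1 K) ∉ Set.range (classical (K := K)) := by
  rintro ⟨z, hz⟩
  induction z using OnePoint.rec with
  | infty => simp at hz
  | coe b =>
    rw [classical_some, OnePoint.coe_eq_coe] at hz
    have := congrArg (fun s : BerkovichA1 K => s.1 (X - C b)) hz
    simp only [diskPoint_linear, evalPoint_apply] at this
    simp only [eval_sub, eval_X, eval_C, sub_self, norm_zero] at this
    exact absurd (this ▸ le_max_left r ‖a - b‖) (not_le.2 hr)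

theorem gaussPoint_eq :
    gaussPoint K hK = OnePoint.some (diskPoint 0 one_pos) := by
  refine congrArg OnePoint.some (BerkovichA1.ext fun P => ?_)
  rw [diskPoint_apply, C_0, add_zero, comp_X]
  rfl

/-! ### The ultrametric inequality -/

theorem chordal_le_max (z q a : OnePoint K) : chordal z a ≤ max (chordal z q) (chordal q a) := by
  set p := homCoord z
  set r := homCoord q
  set b := homCoord a
  have hp := pairNorm_homCoord_pos z
  have hr := pairNorm_homCoord_pos q
  have hb := pairNorm_homCoord_pos a
  set W := ‖p.1 * b.2 - p.2 * b.1‖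
  set U := ‖p.1 * r.2 - p.2 * r.1‖
  set V := ‖r.1 * b.2 - r.2 * b.1‖
  have key (t u v : K) (e : (p.1 * b.2 - p.2 * b.1) * t =
      (p.1 * r.2 - p.2 * r.1) * u + (r.1 * b.2 - r.2 * b.1) * v)
      (hu : ‖u‖ ≤ pairNorm b) (hv : ‖v‖ ≤ pairNorm p) :
      W * ‖t‖ ≤ max (U * pairNorm b) (V * pairNorm p) := by
    rw [← norm_mul, e]
    refine (IsUltrametricDist.norm_add_le_max _ _).trans (max_le_max ?_ ?_)
    · rw [norm_mul]; gcongr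
    · rw [norm_mul]; gcongr
  have h : W * pairNorm r ≤ max (U * pairNorm b) (V * pairNorm p) := by
    have e : pairNorm r = max ‖r.1‖ ‖r.2‖ := norm2_eq_max _ _
    rw [e, mul_max_of_nonneg _ _ (norm_nonneg _)]
    exact max_le (key r.1 b.1 p.1 (by ring) le_norm2_left le_norm2_left)
      (key r.2 b.2 p.2 (by ring) le_norm2_right le_norm2_right)
  have e1 : chordal z q = U / (pairNorm p * pairNorm r) := rfl
  have e2 : chordal q a = V / (pairNorm r * pairNorm b) := rfl
  have e3 : chordal z a = W / (pairNorm p * pairNorm b) := rfl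
  rw [e1, e2, e3]
  rcases le_max_iff.1 h with h | h
  · refine le_max_of_le_left ?_
    rw [div_le_div_iff₀ (by positivity) (by positivity)]
    nlinarith
  · refine le_max_of_le_right ?_
    rw [div_le_div_iff₀ (by positivity) (by positivity)]
    nlinarith

variable [IsAlgClosed K]

theorem chordalTo_le_max (x : BerkovichP1 K) (q a : OnePoint K) :
    chordalTo x a ≤ max (chordalTo x q) (chordal q a) := by
  refine (denseRange_classical_of_ultrametric (K := K)).induction_on
    (p := fun x => chordalTo x a ≤ max (chordalTo x q) (chordal q a)) x ?_ fun z => ?_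
  · exact isClosed_le (continuous_chordalTo a) ((continuous_chordalTo q).max continuous_const)
  · simpa only [chordalTo_classical] using chordal_le_max z q a

theorem chordal_le_max_chordalTo (x : BerkovichP1 K) (q a : OnePoint K) :
    chordal q a ≤ max (chordalTo x q) (chordalTo x a) := by
  refine (denseRange_classical_of_ultrametric (K := K)).induction_on
    (p := fun x => chordal q a ≤ max (chordalTo x q) (chordalTo x a)) x ?_ fun z => ?_
  · exact isClosed_le continuous_const ((continuous_chordalTo q).max (continuous_chordalTo a))
  · simpa only [chordalTo_classical, chordal_comm q z] using chordal_le_max q z a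

omit [IsAlgClosed K] in
theorem chordal_le_one (z q : OnePoint K) : chordal z q ≤ 1 := by
  have hp := pairNorm_homCoord_pos z
  have hr := pairNorm_homCoord_pos q
  rw [chordal, div_le_one (by positivity)]
  rw [sub_eq_add_neg]
  refine (IsUltrametricDist.norm_add_le_max _ _).trans (max_le ?_ ?_)
  · rw [norm_mul]; exact mul_le_mul le_norm2_left le_norm2_right (norm_nonneg _) hp.le
  · rw [norm_neg, norm_mul]; exact mul_le_mul le_norm2_right le_norm2_left (norm_nonneg _) hp.le

theorem chordalTo_le_one (x : BerkovichP1 K) (q : OnePoint K) : chordalTo x q ≤ 1 := by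
  refine (denseRange_classical_of_ultrametric (K := K)).induction_on
    (p := fun x => chordalTo x q ≤ 1) x
    (isClosed_le (continuous_chordalTo q) continuous_const) fun z => ?_
  simpa only [chordalTo_classical] using chordal_le_one z q

omit [IsAlgClosed K] in
theorem hsia_eq_iInf (x y : BerkovichP1 K) :
    hsia x y = ⨅ q : OnePoint K, max (chordalTo x q) (chordalTo y q) := if_pos hK

omit hK [IsAlgClosed K] in
theorem bddBelow_range_max (x y : BerkovichP1 K) :
    BddBelow (Set.range fun q : OnePoint K => max (chordalTo x q) (chordalTo y q)) :=
  ⟨0, by rintro _ ⟨q, rfl⟩; exact (chordalTo_nonneg x q).trans (le_max_left _ _)⟩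

omit [IsAlgClosed K] in
theorem hsia_lt_iff {x y : BerkovichP1 K} {ρ : ℝ} :
    hsia x y < ρ ↔ ∃ q, chordalTo x q < ρ ∧ chordalTo y q < ρ := by
  rw [hsia_eq_iInf]
  simp only [← max_lt_iff]
  exact ⟨fun h => exists_lt_of_ciInf_lt h, fun ⟨q, hq⟩ =>
    (ciInf_le (bddBelow_range_max x y) q).trans_lt hq⟩

omit [IsAlgClosed K] in
theorem hsia_comm_of_ultrametric (x y : BerkovichP1 K) : hsia x y = hsia y x := by
  simp only [hsia_eq_iInf, max_comm]

theorem hsia_eq_max {S : BerkovichP1 K} {a : OnePoint K}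
    (h : ∀ q, chordalTo S a ≤ chordalTo S q) (y : BerkovichP1 K) :
    hsia y S = max (chordalTo y a) (chordalTo S a) := by
  rw [hsia_eq_iInf]
  refine le_antisymm (ciInf_le (bddBelow_range_max y S) a) (le_ciInf fun q => max_le ?_ ?_)
  · refine (chordalTo_le_max y q a).trans (max_le (le_max_left _ _) ?_)
    exact (chordal_le_max_chordalTo S q a).trans
      (max_le (le_max_right _ _) ((h q).trans (le_max_right _ _)))
  · exact (h q).trans (le_max_right _ _)

theorem hsia_classical_of_ultrametric (x : BerkovichP1 K) (w : OnePoint K) :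
    hsia x (classical w) = chordalTo x w := by
  have h0 : chordalTo (classical w) w = 0 := by
    rw [chordalTo_classical, chordal, mul_comm, sub_self, norm_zero, zero_div]
  rw [hsia_eq_max (a := w) (fun q => h0 ▸ chordalTo_nonneg _ _), h0,
    max_eq_left (chordalTo_nonneg _ _)]

omit [IsAlgClosed K] in
theorem chordalTo_gaussPoint (q : OnePoint K) :
    chordalTo (gaussPoint K hK) q = 1 := by
  rw [gaussPoint_eq]
  induction q using OnePoint.rec with
  | infty => rw [chordalTo_some_infty, diskPoint_X, norm2_eq_max]; simp
  | coe a =>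
    rw [chordalTo_some_some, diskPoint_X, diskPoint_linear, norm2_eq_max, norm2_eq_max]
    simp only [norm_zero, zero_sub, norm_neg, max_comm ‖a‖, max_eq_left zero_le_one, max_self,
      one_mul]
    exact div_self (one_pos.trans_le (le_max_left _ _)).ne'

theorem hsia_gaussPoint (y : BerkovichP1 K) :
    hsia y (gaussPoint K hK) = 1 := by
  rw [hsia_eq_max (a := OnePoint.infty)
    (fun q => by rw [chordalTo_gaussPoint, chordalTo_gaussPoint]), chordalTo_gaussPoint,
    max_eq_right (chordalTo_le_one _ _)]

theorem hsia_le_one_of_ultrametric (x y : BerkovichP1 K) : hsia x y ≤ 1 := by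
  rw [hsia_eq_iInf]
  exact (ciInf_le (bddBelow_range_max x y) OnePoint.infty).trans
    (max_le (chordalTo_le_one _ _) (chordalTo_le_one _ _))

omit [IsAlgClosed K] in
theorem hsia_nonneg_of_ultrametric (x y : BerkovichP1 K) : 0 ≤ hsia x y := by
  rw [hsia_eq_iInf]
  exact le_ciInf fun q => (chordalTo_nonneg x q).trans (le_max_left _ _)

omit [IsAlgClosed K] in
theorem isOpen_hsia_lt (x : BerkovichP1 K) (ρ : ℝ) : IsOpen {y | hsia x y < ρ} := by
  have : {y | hsia x y < ρ} = ⋃ q : OnePoint K, {y | chordalTo x q < ρ ∧ chordalTo y q < ρ} := by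
    ext y; simp [hsia_lt_iff]
  rw [this]
  refine isOpen_iUnion fun q => ?_
  by_cases h : chordalTo x q < ρ
  · simpa [h] using isOpen_lt (continuous_chordalTo q) continuous_const
  · simp [h]

omit [IsAlgClosed K] in
theorem measurable_hsia_of_ultrametric (x : BerkovichP1 K) : Measurable (hsia x) :=
  measurable_of_Iio fun ρ => (isOpen_hsia_lt x ρ).measurableSet

theorem hsia_lt_trans {x y z : BerkovichP1 K} {ρ : ℝ} (h1 : hsia x y < ρ) (h2 : hsia y z < ρ) :
    hsia x z < ρ := by
  obtain ⟨q, hq1, hq2⟩ := hsia_lt_iff.1 h1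
  obtain ⟨r, hr1, hr2⟩ := hsia_lt_iff.1 h2
  refine hsia_lt_iff.2 ⟨r, ?_, hr2⟩
  refine (chordalTo_le_max x q r).trans_lt (max_lt hq1 ?_)
  exact (chordal_le_max_chordalTo y q r).trans_lt (max_lt hq2 hr1)

end Nonarchimedean

/-! ### Non-archimedean potential theory -/

section NonarchimedeanPotential

theorem negLog_antitone : Antitone negLog := fun a b h => by
  refine EReal.toENNReal_le_toENNReal (EReal.neg_le_neg_iff.2 ?_)
  exact ENNReal.log_monotone (ENNReal.ofReal_le_ofReal h)

theorem continuous_negLog : Continuous negLog := by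
  unfold negLog elog
  exact EReal.continuous_toENNReal.comp
    (continuous_neg.comp (ENNReal.continuous_log.comp ENNReal.continuous_ofReal))

variable {K : Type*} [NontriviallyNormedField K] [hK : IsUltrametricDist K] [IsAlgClosed K]

omit [IsAlgClosed K] in
/-- A sequence of disks that shrinks to a classical point. -/
theorem exists_seq_disks (w : OnePoint K) : ∃ (S : ℕ → BerkovichP1 K) (ε : ℕ → ℝ),
    (∀ n, S n ∉ Set.range (classical (K := K))) ∧ (∀ n q, ε n ≤ chordalTo (S n) q) ∧
    (∀ n, chordalTo (S n) w = ε n) ∧ Antitone ε ∧ (∀ n, 0 < ε n) ∧ Tendsto ε atTop (𝓝 0) := by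
  have hanti : Antitone fun n : ℕ => ((n : ℝ) + 1)⁻¹ := fun m n h => by
    have : (m : ℝ) ≤ n := by exact_mod_cast h
    exact inv_anti₀ (by positivity) (by linarith)
  have hlim : Tendsto (fun n : ℕ => ((n : ℝ) + 1)⁻¹) atTop (𝓝 0) := by
    simpa only [one_div] using tendsto_one_div_add_atTop_nhds_zero_nat (𝕜 := ℝ)
  have hp (n : ℕ) : (0 : ℝ) < n + 1 := by positivity
  have hp1 (n : ℕ) : (1 : ℝ) ≤ n + 1 := by linarith [(Nat.cast_nonneg n : (0 : ℝ) ≤ n)]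
  induction w using OnePoint.rec with
  | infty =>
    refine ⟨fun n => OnePoint.some (diskPoint 0 (hp n)), fun n => ((n : ℝ) + 1)⁻¹,
      fun n => diskPoint_notMem_range _ _, fun n q => ?_, fun n => ?_, hanti,
      fun n => inv_pos.2 (hp n), hlim⟩
    · induction q using OnePoint.rec with
      | infty =>
        rw [chordalTo_some_infty, diskPoint_X, norm2_eq_max, norm_zero, max_eq_left (hp n).le,
          max_eq_left (hp1 n)]
      | coe b =>
        rw [chordalTo_some_some, diskPoint_X, diskPoint_linear, norm2_eq_max, norm2_eq_max,
          norm_zero, max_eq_left (hp n).le, max_eq_left (hp1 n), zero_sub, norm_neg]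
        have hb : 0 < max ‖b‖ 1 := one_pos.trans_le (le_max_right _ _)
        rw [le_div_iff₀ (mul_pos (hp n) hb), inv_mul_cancel_left₀ (hp n).ne']
        exact max_le (le_max_right _ _) ((hp1 n).trans (le_max_left _ _))
    · rw [chordalTo_some_infty, diskPoint_X, norm2_eq_max, norm_zero, max_eq_left (hp n).le,
        max_eq_left (hp1 n)]
  | coe a =>
    set N := max ‖a‖ 1 with hN
    have hN1 : 1 ≤ N := le_max_right _ _
    have hN0 : 0 < N := one_pos.trans_le hN1
    have hr (n : ℕ) : ((n : ℝ) + 1)⁻¹ ≤ 1 := inv_le_one_of_one_le₀ (hp1 n)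
    have hX (n : ℕ) : norm2 K ((diskPoint a (inv_pos.2 (hp n))).1 X) 1 = N := by
      rw [diskPoint_X, norm2_eq_max, max_assoc]
      exact max_eq_right ((hr n).trans hN1)
    have hval (n : ℕ) : chordalTo (OnePoint.some (diskPoint a (inv_pos.2 (hp n))))
        (OnePoint.some a) = ((n : ℝ) + 1)⁻¹ / (N * N) := by
      rw [chordalTo_some_some, hX, diskPoint_linear, norm2_eq_max, sub_self, norm_zero,
        max_eq_left (inv_pos.2 (hp n)).le]
    refine ⟨fun n => OnePoint.some (diskPoint a (inv_pos.2 (hp n))),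
      fun n => ((n : ℝ) + 1)⁻¹ / (N * N),
      fun n => diskPoint_notMem_range _ _, fun n q => ?_, hval, ?_, ?_, ?_⟩
    · induction q using OnePoint.rec with
      | infty =>
        rw [chordalTo_some_infty, hX, div_le_iff₀ (by positivity), inv_mul_cancel_left₀ hN0.ne']
        exact (hr n).trans hN1
      | coe b =>
        rw [chordalTo_some_some, hX, diskPoint_linear, norm2_eq_max]
        have hb : 0 < max ‖b‖ 1 := one_pos.trans_le (le_max_right _ _)
        rw [div_le_div_iff₀ (by positivity) (by positivity)]
        rcases le_or_gt (max ‖b‖ 1) N with h | h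
        · exact mul_le_mul (le_max_left _ _) (by gcongr) (by positivity)
            ((inv_pos.2 (hp n)).le.trans (le_max_left _ _))
        · have hb1 : 1 < ‖b‖ := (lt_max_iff.1 (hN1.trans_lt h)).resolve_right (lt_irrefl _)
          rw [max_eq_left hb1.le] at h ⊢
          have hab : ‖a - b‖ = ‖b‖ := by
            have h1 : ‖a‖ < ‖b‖ := (le_max_left _ _).trans_lt h
            rw [sub_eq_add_neg, IsUltrametricDist.norm_add_eq_max_of_norm_ne_norm
              (by rw [norm_neg]; exact h1.ne), norm_neg, max_eq_right h1.le]
          rw [hab]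
          have h2 : (((n : ℝ) + 1)⁻¹) * (N * ‖b‖) ≤ 1 * (N * ‖b‖) := by gcongr; exact hr n
          have h3 : ‖b‖ ≤ max (((n : ℝ) + 1)⁻¹) ‖b‖ := le_max_right _ _
          nlinarith [mul_le_mul_of_nonneg_right h3 (mul_pos hN0 hN0).le,
            mul_nonneg (mul_pos hN0 (one_pos.trans hb1)).le (sub_nonneg.2 hN1)]
    · exact fun m n h => div_le_div_of_nonneg_right (hanti h) (by positivity)
    · exact fun n => div_pos (inv_pos.2 (hp n)) (by positivity)
    · simpa using hlim.div_const (N * N)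

theorem tendsto_seq_disks {S : ℕ → BerkovichP1 K} {ε : ℕ → ℝ} {w : OnePoint K}
    (h : ∀ n, chordalTo (S n) w = ε n) (hε : Tendsto ε atTop (𝓝 0)) :
    Tendsto S atTop (𝓝 (classical w)) := by
  rw [(isClosedEmbedding_chordalTo (K := K)).isEmbedding.tendsto_nhds_iff, tendsto_pi_nhds]
  intro q
  rw [tendsto_iff_norm_sub_tendsto_zero]
  refine squeeze_zero (fun _ => norm_nonneg _) (fun n => ?_) hε
  have h1 := chordalTo_le_max (S n) w q
  have h2 := chordal_le_max_chordalTo (S n) w q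
  have h3 := chordalTo_nonneg (S n) q
  have h4 : 0 ≤ ε n := h n ▸ chordalTo_nonneg _ _
  have h5 : 0 ≤ chordal w q := by rw [← chordalTo_classical]; exact chordalTo_nonneg _ _
  rw [h n] at h1 h2
  simp only [Function.comp, chordalTo_classical]
  rw [Real.norm_eq_abs, abs_le]
  constructor
  · rcases le_max_iff.1 h2 with h | h <;> linarith
  · rcases le_max_iff.1 h1 with h | h <;> linarith

theorem exists_le_chordalTo [CompleteSpace K] {S : BerkovichP1 K}
    (hS : S ∉ Set.range (classical (K := K))) : ∃ ε > 0, ∀ q, ε ≤ chordalTo S q := by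
  induction S using OnePoint.rec with
  | infty => exact absurd ⟨OnePoint.infty, rfl⟩ hS
  | coe s =>
    set N := max (s.1 X) 1 with hN
    have hN1 : 1 ≤ N := le_max_right _ _
    have hN0 : 0 < N := one_pos.trans_le hN1
    have hpos : ∃ δ > 0, ∀ a, δ ≤ s.1 (X - C a) := by
      by_contra! hcon
      have hseq (n : ℕ) : ∃ a, s.1 (X - C a) < ((n : ℝ) + 1)⁻¹ := hcon _ (by positivity)
      choose a ha using hseq
      have hlim : Tendsto (fun n : ℕ => ((n : ℝ) + 1)⁻¹) atTop (𝓝 0) := by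
        simpa only [one_div] using tendsto_one_div_add_atTop_nhds_zero_nat (𝕜 := ℝ)
      have hanti : ∀ N m : ℕ, N ≤ m → ((m : ℝ) + 1)⁻¹ ≤ ((N : ℝ) + 1)⁻¹ := fun N m h => by
        have : (N : ℝ) ≤ m := by exact_mod_cast h
        exact inv_anti₀ (by positivity) (by linarith)
      have hcauchy : CauchySeq a := cauchySeq_of_le_tendsto_0 (fun n : ℕ => ((n : ℝ) + 1)⁻¹)
        (fun n m N hn hm => by
          rw [dist_eq_norm]
          exact (s.norm_sub_le _ _).trans
            (max_le ((ha n).le.trans (hanti N n hn)) ((ha m).le.trans (hanti N m hm)))) hlim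
      obtain ⟨b, hb⟩ := cauchySeq_tendsto_of_complete hcauchy
      have h0 : s.1 (X - C b) = 0 := by
        refine le_antisymm ?_ (apply_nonneg s.1 _)
        have h1 : Tendsto (fun n : ℕ => max (((n : ℝ) + 1)⁻¹) ‖a n - b‖) atTop (𝓝 (max 0 0)) :=
          hlim.max (tendsto_iff_norm_sub_tendsto_zero.1 hb)
        rw [max_self] at h1
        exact ge_of_tendsto' h1 fun n => (s.apply_sub_le b (a n)).trans
          (max_le_max (ha n).le le_rfl)
      refine hS ⟨OnePoint.some b, ?_⟩
      rw [classical_some]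
      congr 1
      refine BerkovichA1.ext_of_linear fun c => ?_
      have h1 := s.norm_sub_le b c
      have h2 := s.apply_sub_le c b
      rw [h0, max_eq_right (apply_nonneg s.1 _)] at h1
      rw [h0, max_eq_right (norm_nonneg _)] at h2
      simpa using le_antisymm h1 h2
    obtain ⟨δ, hδ, hle⟩ := hpos
    refine ⟨min (δ / (N * N)) N⁻¹, lt_min (by positivity) (by positivity), fun q => ?_⟩
    induction q using OnePoint.rec with
    | infty => rw [chordalTo_some_infty, norm2_eq_max]; exact min_le_right _ _
    | coe a =>
      rw [chordalTo_some_some, norm2_eq_max, norm2_eq_max, ← hN]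
      have ha1 : (0 : ℝ) < max ‖a‖ 1 := one_pos.trans_le (le_max_right _ _)
      have ha : ‖a‖ ≤ max (s.1 (X - C a)) (s.1 X) := by simpa using s.norm_sub_le a 0
      rcases le_or_gt (s.1 (X - C a)) N with h | h
      · refine (min_le_left _ _).trans ?_
        have : max ‖a‖ 1 ≤ N := max_le (ha.trans (max_le h (le_max_left _ _))) hN1
        exact div_le_div₀ (apply_nonneg s.1 _) (hle a) (by positivity) (by gcongr)
      · refine (min_le_right _ _).trans ?_
        have : max ‖a‖ 1 ≤ s.1 (X - C a) :=
          max_le (ha.trans (max_le le_rfl ((le_max_left _ _).trans h.le))) (hN1.trans h.le)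
        rw [le_div_iff₀ (by positivity), inv_mul_cancel_left₀ hN0.ne']
        exact this

omit [IsAlgClosed K] in
theorem omegaCan_of_ultrametric : omegaCan K = Measure.dirac (gaussPoint K hK) := dif_pos hK

omit [IsAlgClosed K] in
theorem gaussPoint_notMem_range :
    gaussPoint K hK ∉ Set.range (classical (K := K)) := by
  rw [gaussPoint_eq]; exact diskPoint_notMem_range _ _

theorem integral_log_hsia_of_hasLaplacian {g : BerkovichP1 K → ℝ} {μ : Measure (BerkovichP1 K)}
    (hg : HasLaplacian g μ (omegaCan K)) {S : BerkovichP1 K}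
    (hS : S ∉ Set.range (classical (K := K))) :
    ∫ y, Real.log (hsia y S) ∂μ = g S - g (gaussPoint K hK) := by
  rw [HasLaplacian, if_pos hK] at hg
  have := hg S (gaussPoint K hK) hS gaussPoint_notMem_range
  rw [omegaCan_of_ultrametric, integral_dirac] at this
  simpa only [hsia_gaussPoint, hsia_comm_of_ultrametric (gaussPoint K hK), Real.log_one, sub_zero]
    using this

theorem eq_add_const_of_ultrametric {g₁ g₂ : BerkovichP1 K → ℝ} {μ : Measure (BerkovichP1 K)}
    (h₁ : IsContinuousWeight g₁ μ) (h₂ : IsContinuousWeight g₂ μ) :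
    ∃ c, ∀ x, g₁ x = g₂ x + c := by
  refine ⟨g₁ (gaussPoint K hK) - g₂ (gaussPoint K hK), fun x => ?_⟩
  refine congrFun (eq_of_classical denseRange_classical_of_ultrametric h₁.continuous
    (h₂.continuous.add continuous_const) fun w => ?_) x
  obtain ⟨S, ε, hS, -, hSw, -, -, hε⟩ := exists_seq_disks w
  have hlim := tendsto_seq_disks hSw hε
  refine tendsto_nhds_unique ((h₁.continuous.tendsto _).comp hlim)
    ((((h₂.continuous.tendsto _).comp hlim).add_const _).congr fun n => ?_)
  have e1 := integral_log_hsia_of_hasLaplacian h₁.laplacian (hS n)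
  have e2 := integral_log_hsia_of_hasLaplacian h₂.laplacian (hS n)
  simp only [Function.comp]
  linarith

theorem lintegral_negLog_of_notMem_range [CompleteSpace K] {g : BerkovichP1 K → ℝ}
    {μ : Measure (BerkovichP1 K)} (h : IsContinuousWeight g μ) {S : BerkovichP1 K}
    (hS : S ∉ Set.range (classical (K := K))) :
    g S + -g (gaussPoint K hK) ≤ 0 ∧
      ∫⁻ y, negLog (hsia S y) ∂μ = ENNReal.ofReal (-(g S + -g (gaussPoint K hK))) := by
  have hμ := h.isProbabilityMeasure
  obtain ⟨ε, hε, hle⟩ := exists_le_chordalTo hS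
  have hge (y : BerkovichP1 K) : ε ≤ hsia S y := by
    rw [hsia_eq_iInf]
    exact le_ciInf fun q => (hle q).trans (le_max_left _ _)
  have e := integral_log_hsia_of_hasLaplacian h.laplacian hS
  simp only [hsia_comm_of_ultrametric _ S] at e
  have hnn (y : BerkovichP1 K) : 0 ≤ -Real.log (hsia S y) :=
    neg_nonneg.2 (Real.log_nonpos (hsia_nonneg_of_ultrametric _ _) (hsia_le_one_of_ultrametric _ _))
  have hint : Integrable (fun y => -Real.log (hsia S y)) μ := by
    refine Integrable.of_bound
      ((Real.measurable_log.comp (measurable_hsia_of_ultrametric S)).neg.aestronglyMeasurable)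
      (-Real.log ε) (Eventually.of_forall fun y => ?_)
    rw [Real.norm_of_nonneg (hnn y)]
    exact neg_le_neg (Real.log_le_log hε (hge y))
  have e2 : ∫ y, -Real.log (hsia S y) ∂μ = -(g S + -g (gaussPoint K hK)) := by
    rw [integral_neg, e]; ring
  constructor
  · have := integral_nonneg (μ := μ) (f := fun y => -Real.log (hsia S y)) hnn
    rw [e2] at this
    linarith
  · rw [← e2, ofReal_integral_eq_lintegral_ofReal hint (Eventually.of_forall hnn)]
    exact lintegral_congr fun y => negLog_of_pos (hε.trans_le (hge y))

theorem potential_eq_of_ultrametric [CompleteSpace K] {g : BerkovichP1 K → ℝ}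
    {μ : Measure (BerkovichP1 K)} (h : IsContinuousWeight g μ) : ∃ κ : ℝ, ∀ x, g x + κ ≤ 0 ∧
      ∫⁻ y, negLog (hsia x y) ∂μ = ENNReal.ofReal (-(g x + κ)) := by
  refine ⟨-g (gaussPoint K hK), fun x => ?_⟩
  by_cases hx : x ∈ Set.range (classical (K := K))
  · obtain ⟨w, rfl⟩ := hx
    obtain ⟨S, ε, hS, hSq, hSw, hanti, hpos, hε⟩ := exists_seq_disks w
    have hlim := tendsto_seq_disks hSw hε
    have hg : Tendsto (fun n => g (S n) + -g (gaussPoint K hK)) atTop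
        (𝓝 (g (classical w) + -g (gaussPoint K hK))) :=
      ((h.continuous.tendsto _).comp hlim).add_const _
    have hsia_eq (n : ℕ) (y : BerkovichP1 K) : hsia (S n) y = max (chordalTo y w) (ε n) := by
      rw [hsia_comm_of_ultrametric, hsia_eq_max (a := w) (fun q => (hSw n).trans_le (hSq n q)),
        hSw n]
    refine ⟨le_of_tendsto' hg fun n => (lintegral_negLog_of_notMem_range h (hS n)).1, ?_⟩
    have h1 : Tendsto (fun n => ∫⁻ y, negLog (hsia (S n) y) ∂μ) atTop
        (𝓝 (∫⁻ y, negLog (hsia (classical w) y) ∂μ)) := by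
      refine lintegral_tendsto_of_tendsto_of_monotone
        (fun n => (measurable_negLog.comp (measurable_hsia_of_ultrametric _)).aemeasurable)
        (Eventually.of_forall fun y m n hmn => ?_) (Eventually.of_forall fun y => ?_)
      · simp only [hsia_eq]
        exact negLog_antitone (max_le_max le_rfl (hanti hmn))
      · simp only [hsia_eq]
        rw [hsia_comm_of_ultrametric, hsia_classical_of_ultrametric]
        have h2 : Tendsto (fun n => max (chordalTo y w) (ε n)) atTop (𝓝 (max (chordalTo y w) 0)) :=
          tendsto_const_nhds.max hε
        rw [max_eq_left (chordalTo_nonneg y w)] at h2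
        exact (continuous_negLog.tendsto _).comp h2
    simp only [fun n => (lintegral_negLog_of_notMem_range h (hS n)).2] at h1
    exact tendsto_nhds_unique h1
      ((ENNReal.continuous_ofReal.tendsto _).comp hg.neg)
  · exact lintegral_negLog_of_notMem_range h hx

/-! ### Positivity of the energy -/

theorem two_mul_mul_le_ennreal (a b : ℝ≥0∞) : 2 * (a * b) ≤ b * b + a * a := by
  rcases le_total a b with h | h
  · obtain ⟨c, rfl⟩ := exists_add_of_le h
    calc 2 * (a * (a + c)) ≤ 2 * (a * (a + c)) + c * c := le_self_add
      _ = _ := by ring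
  · obtain ⟨c, rfl⟩ := exists_add_of_le h
    calc 2 * ((b + c) * b) ≤ 2 * ((b + c) * b) + c * c := le_self_add
      _ = _ := by ring

theorem tsum_ite_le (L δ : ℝ≥0∞) :
    ∑' j : ℕ, (if ((j : ℝ≥0∞) + 1) * δ < L then δ else 0) ≤ L := by
  refine ENNReal.tsum_le_of_sum_range_le fun N => ?_
  have : ∑ j ∈ Finset.range N, (if ((j : ℝ≥0∞) + 1) * δ < L then δ else 0) ≤ L ∧
      ∑ j ∈ Finset.range N, (if ((j : ℝ≥0∞) + 1) * δ < L then δ else 0) ≤ N * δ := by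
    induction N with
    | zero => simp
    | succ N ih =>
      rw [Finset.sum_range_succ]
      split_ifs with h
      · have h2 := add_le_add_left ih.2 δ
        have e : (N : ℝ≥0∞) * δ + δ = (N + 1) * δ := by ring
        rw [e] at h2
        exact ⟨h2.trans h.le, by push_cast; exact h2⟩
      · rw [add_zero]
        refine ⟨ih.1, ih.2.trans ?_⟩
        gcongr
        simp
  exact this.1

theorem le_add_tsum_ite (L : ℝ≥0∞) {δ : ℝ≥0∞} (hδ : δ ≠ 0) :
    L ≤ δ + ∑' j : ℕ, (if ((j : ℝ≥0∞) + 1) * δ < L then δ else 0) := by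
  have key (N : ℕ) : min L (((N : ℝ≥0∞) + 1) * δ) ≤
      δ + ∑ j ∈ Finset.range N, (if ((j : ℝ≥0∞) + 1) * δ < L then δ else 0) := by
    induction N with
    | zero => simp
    | succ N ih =>
      rw [Finset.sum_range_succ, ← add_assoc]
      split_ifs with h
      · rw [min_eq_right h.le] at ih
        refine (min_le_right _ _).trans ?_
        calc (((N + 1 : ℕ) : ℝ≥0∞) + 1) * δ = ((N : ℝ≥0∞) + 1) * δ + δ := by push_cast; ring
          _ ≤ _ := by gcongr
      · rw [min_eq_left (not_lt.1 h)] at ih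
        rw [add_zero]
        exact (min_le_left _ _).trans ih
  by_cases hall : ∀ N : ℕ, ((N : ℝ≥0∞) + 1) * δ < L
  · have : ∑' j : ℕ, (if ((j : ℝ≥0∞) + 1) * δ < L then δ else 0) = ⊤ := by
      simp only [hall, if_true]
      exact ENNReal.tsum_const_eq_top_of_ne_zero hδ
    rw [this]; simp
  · push Not at hall
    obtain ⟨N, hN⟩ := hall
    have := key N
    rw [min_eq_left hN] at this
    refine this.trans ?_
    gcongr
    exact ENNReal.sum_le_tsum _

theorem lt_negLog_iff {t c : ℝ} (ht : 0 ≤ t) (hc : 0 ≤ c) :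
    ENNReal.ofReal c < negLog t ↔ t < Real.exp (-c) := by
  rcases ht.eq_or_lt with rfl | ht
  · simp [Real.exp_pos]
  · rw [negLog_of_pos ht, ENNReal.ofReal_lt_ofReal_iff_of_nonneg hc, lt_neg,
      Real.log_lt_iff_lt_exp ht]

theorem exists_countable_balls (ρ : ℝ) (μ : Measure (BerkovichP1 K)) [IsFiniteMeasure μ] :
    ∃ 𝓑 : Set (Set (BerkovichP1 K)), 𝓑.Countable ∧ (∀ b ∈ 𝓑, IsOpen b) ∧
      ∀ ν : Measure (BerkovichP1 K), ν ≤ μ → ∀ x,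
        ν {y | hsia x y < ρ} = ∑' b : 𝓑, (b : Set (BerkovichP1 K)).indicator (fun _ => ν b) x := by
  set B : BerkovichP1 K → Set (BerkovichP1 K) := fun x => {y | hsia x y < ρ} with hB
  have hopen (x) : IsOpen (B x) := isOpen_hsia_lt x ρ
  have heq {x y : BerkovichP1 K} (h : y ∈ B x) : B y = B x := by
    ext z
    exact ⟨fun hz => hsia_lt_trans h hz,
      fun hz => hsia_lt_trans (by rw [hsia_comm_of_ultrametric]; exact h) hz⟩
  have hself {x y : BerkovichP1 K} (h : y ∈ B x) : y ∈ B y := by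
    rw [heq h]; exact h
  set As : Set.range B → Set (BerkovichP1 K) := fun b => b
  have hdisj : Pairwise (Function.onFun Disjoint As) := by
    rintro ⟨_, x, rfl⟩ ⟨_, y, rfl⟩ hne
    refine Set.disjoint_left.2 fun z hz1 hz2 => hne (Subtype.ext ?_)
    exact (heq hz1).symm.trans (heq hz2)
  have hcount := Measure.countable_meas_pos_of_disjoint_iUnion (μ := μ)
    (As := As) (by rintro ⟨_, x, rfl⟩; exact (hopen x).measurableSet) hdisj
  set 𝓑 : Set (Set (BerkovichP1 K)) := Subtype.val '' {b : Set.range B | 0 < μ (As b)} with h𝓑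
  have hmem {b} (hb : b ∈ 𝓑) : ∃ x, B x = b := by
    obtain ⟨⟨_, x, rfl⟩, -, rfl⟩ := hb
    exact ⟨x, rfl⟩
  refine ⟨𝓑, hcount.image _, fun b hb => ?_, fun ν hν x => ?_⟩
  · obtain ⟨x, rfl⟩ := hmem hb
    exact hopen x
  by_cases hx : B x ∈ 𝓑 ∧ x ∈ B x
  · rw [tsum_eq_single ⟨B x, hx.1⟩, Set.indicator_of_mem hx.2]
    rintro ⟨b, hb⟩ hne
    obtain ⟨y, rfl⟩ := hmem hb
    refine Set.indicator_of_notMem (fun hxy => hne (Subtype.ext ?_)) _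
    exact (heq hxy).symm
  · have h0 : ν (B x) = 0 := by
      by_cases hxx : x ∈ B x
      · have : B x ∉ 𝓑 := fun h => hx ⟨h, hxx⟩
        have hμ0 : μ (B x) = 0 := by
          by_contra hne
          exact this ⟨⟨B x, x, rfl⟩, pos_iff_ne_zero.2 hne, rfl⟩
        exact le_antisymm ((hν _).trans hμ0.le) bot_le
      · have : B x = ∅ := by
          refine Set.eq_empty_iff_forall_notMem.2 fun y hy => hxx ?_
          exact hsia_lt_trans (y := y) hy (by rw [hsia_comm_of_ultrametric]; exact hy)
        rw [this, measure_empty]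
    rw [show ν {y | hsia x y < ρ} = 0 from h0, eq_comm, ENNReal.tsum_eq_zero]
    rintro ⟨b, hb⟩
    obtain ⟨y, rfl⟩ := hmem hb
    by_cases hxy : x ∈ B y
    · have e := heq hxy
      rw [Set.indicator_of_mem hxy]
      change ν (B y) = 0
      rw [← e, h0]
    · exact Set.indicator_of_notMem hxy _

theorem lintegral_ball_le (ρ : ℝ) (μ ν : Measure (BerkovichP1 K)) [IsFiniteMeasure μ]
    [IsFiniteMeasure ν] :
    Measurable (fun x => μ {y | hsia x y < ρ}) ∧
    2 * ∫⁻ x, μ {y | hsia x y < ρ} ∂ν ≤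
      (∫⁻ x, ν {y | hsia x y < ρ} ∂ν) + ∫⁻ x, μ {y | hsia x y < ρ} ∂μ := by
  obtain ⟨𝓑, hc, hopen, h⟩ := exists_countable_balls ρ (μ + ν)
  have := hc.to_subtype
  have hmeas (σ : Measure (BerkovichP1 K)) (b : 𝓑) : Measurable
      ((b : Set (BerkovichP1 K)).indicator fun _ => σ b) :=
    measurable_const.indicator (hopen b b.2).measurableSet
  have hint (σ τ : Measure (BerkovichP1 K)) (hσ : σ ≤ μ + ν) :
      ∫⁻ x, σ {y | hsia x y < ρ} ∂τ = ∑' b : 𝓑, σ b * τ b := by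
    simp only [h σ hσ]
    rw [lintegral_tsum fun b => (hmeas σ b).aemeasurable]
    exact tsum_congr fun b => by
      rw [lintegral_indicator (hopen b b.2).measurableSet, setLIntegral_const]
  have hμ : μ ≤ μ + ν := Measure.le_add_right le_rfl
  have hν : ν ≤ μ + ν := Measure.le_add_left le_rfl
  constructor
  · simp only [h μ hμ]
    exact Measurable.tsum (hmeas μ)
  · rw [hint μ ν hμ, hint ν ν hν, hint μ μ hμ, ← ENNReal.tsum_mul_left, ← ENNReal.tsum_add]
    exact ENNReal.tsum_le_tsum fun b => two_mul_mul_le_ennreal _ _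

theorem energy_le_of_ultrametric (μ ν : Measure (BerkovichP1 K)) [IsProbabilityMeasure μ]
    [IsProbabilityMeasure ν] : 2 * ∫⁻ x, ∫⁻ y, negLog (hsia x y) ∂μ ∂ν ≤
      (∫⁻ x, ∫⁻ y, negLog (hsia x y) ∂ν ∂ν) + ∫⁻ x, ∫⁻ y, negLog (hsia x y) ∂μ ∂μ := by
  refine ENNReal.le_of_forall_pos_le_add fun η hη _ => ?_
  set δ : ℝ := (η : ℝ) / 2 with hδ
  have hδ0 : 0 < δ := by positivity
  set d : ℝ≥0∞ := ENNReal.ofReal δ with hd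
  have hd0 : d ≠ 0 := (ENNReal.ofReal_pos.2 hδ0).ne'
  set ρ : ℕ → ℝ := fun j => Real.exp (-((j + 1) * δ)) with hρ
  set k : BerkovichP1 K → BerkovichP1 K → ℝ≥0∞ := fun x y =>
    ∑' j : ℕ, {y | hsia x y < ρ j}.indicator (fun _ => d) y with hk
  have hk' (x y) : k x y =
      ∑' j : ℕ, (if ((j : ℝ≥0∞) + 1) * d < negLog (hsia x y) then d else 0) := by
    refine tsum_congr fun j => ?_
    have e : ((j : ℝ≥0∞) + 1) * d = ENNReal.ofReal (((j : ℝ) + 1) * δ) := by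
      rw [ENNReal.ofReal_mul (by positivity), ENNReal.ofReal_add (by positivity) zero_le_one,
        ENNReal.ofReal_natCast, ENNReal.ofReal_one]
    rw [e]
    simp only [lt_negLog_iff (hsia_nonneg_of_ultrametric x y)
      (by positivity : 0 ≤ ((j : ℝ) + 1) * δ), Set.indicator, Set.mem_ofPred_eq, hρ]
  have hlow (x y) : k x y ≤ negLog (hsia x y) := hk' x y ▸ tsum_ite_le _ _
  have hup (x y) : negLog (hsia x y) ≤ d + k x y := hk' x y ▸ le_add_tsum_ite _ hd0
  have hint (σ τ : Measure (BerkovichP1 K)) [IsProbabilityMeasure σ] [IsProbabilityMeasure τ] :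
      ∫⁻ x, ∫⁻ y, k x y ∂σ ∂τ = ∑' j : ℕ, d * ∫⁻ x, σ {y | hsia x y < ρ j} ∂τ := by
    have h1 (x) : ∫⁻ y, k x y ∂σ = ∑' j : ℕ, d * σ {y | hsia x y < ρ j} := by
      rw [lintegral_tsum fun j => (measurable_const.indicator
        (isOpen_hsia_lt x (ρ j)).measurableSet).aemeasurable]
      exact tsum_congr fun j => by
        rw [lintegral_indicator (isOpen_hsia_lt x (ρ j)).measurableSet, setLIntegral_const]
    simp only [h1]
    rw [lintegral_tsum fun j => ((lintegral_ball_le (ρ j) σ τ).1.const_mul d).aemeasurable]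
    exact tsum_congr fun j => lintegral_const_mul _ (lintegral_ball_le (ρ j) σ τ).1
  have hd2 : 2 * d = η := by
    rw [hd, hδ, ← ENNReal.ofReal_ofNat, ← ENNReal.ofReal_mul (by norm_num),
      mul_div_cancel₀ _ (by norm_num : (2 : ℝ) ≠ 0), ENNReal.ofReal_coe_nnreal]
  calc 2 * ∫⁻ x, ∫⁻ y, negLog (hsia x y) ∂μ ∂ν
      ≤ 2 * ∫⁻ x, ∫⁻ y, (d + k x y) ∂μ ∂ν := by
        gcongr with x y; exact hup x y
    _ = 2 * (d + ∫⁻ x, ∫⁻ y, k x y ∂μ ∂ν) := by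
        simp only [lintegral_add_left measurable_const, lintegral_const, measure_univ, mul_one]
    _ = 2 * (∫⁻ x, ∫⁻ y, k x y ∂μ ∂ν) + η := by rw [mul_add, hd2, add_comm]
    _ ≤ (∫⁻ x, ∫⁻ y, k x y ∂ν ∂ν) + (∫⁻ x, ∫⁻ y, k x y ∂μ ∂μ) + η := by
        gcongr
        rw [hint μ ν, hint ν ν, hint μ μ, ← ENNReal.tsum_mul_left, ← ENNReal.tsum_add]
        refine ENNReal.tsum_le_tsum fun j => ?_
        rw [← mul_add, mul_left_comm]
        gcongr
        exact (lintegral_ball_le (ρ j) μ ν).2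
    _ ≤ _ := by
        gcongr with x y x y
        · exact hlow x y
        · exact hlow x y

theorem potentialTheory_of_ultrametric [CompleteSpace K] : PotentialTheory K where
  dense := denseRange_classical_of_ultrametric
  hsia_classical := hsia_classical_of_ultrametric
  hsia_le_one := hsia_le_one_of_ultrametric
  hsia_comm := hsia_comm_of_ultrametric
  measurable_hsia := measurable_hsia_of_ultrametric
  eq_add_const _ _ _ := eq_add_const_of_ultrametric
  potential_eq _ _ := potential_eq_of_ultrametric
  energy_le μ ν _ _ := energy_le_of_ultrametric μ ν

end NonarchimedeanPotential

/-! ### Complete algebraically closed archimedean fields -/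

section Ostrowski

variable {K : Type*} [NontriviallyNormedField K]

theorem charZero_of_not_ultrametric (hK : ¬ IsUltrametricDist K) : CharZero K := by
  obtain ⟨p, hp⟩ := CharP.exists K
  rcases hp.char_is_prime_or_zero K p with hprime | rfl
  · refine absurd (IsUltrametricDist.isUltrametricDist_of_forall_norm_natCast_le_one
      fun n => ?_) hK
    have : Fact p.Prime := ⟨hprime⟩
    have h1 : ((n : K)) ^ p = n := by
      have := map_natCast (frobenius K p) n
      rwa [frobenius_def] at this
    have h2 : ‖(n : K)‖ ^ p = ‖(n : K)‖ := by rw [← norm_pow, h1]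
    by_contra h3
    have := lt_self_pow₀ (not_le.1 h3) hprime.one_lt
    exact absurd h2 this.ne'
  · exact CharP.charP_to_charZero K

/-- The exponent in Ostrowski's theorem. -/
theorem exists_rpow_norm_ratCast_eq (hK : ¬ IsUltrametricDist K) :
    ∃ c : ℝ, 0 < c ∧ ∀ q : ℚ, ‖(q : K)‖ ^ c = |(q : ℝ)| := by
  have := charZero_of_not_ultrametric hK
  set f : AbsoluteValue ℚ ℝ := (absValue K).comp (f := Rat.castHom K) (Rat.castHom K).injective
  have hf (q : ℚ) : f q = ‖(q : K)‖ := rfl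
  have hnb : ¬ ∀ n : ℕ, f n ≤ 1 := fun h =>
    hK (IsUltrametricDist.isUltrametricDist_of_forall_norm_natCast_le_one fun n => by
      simpa [hf] using h n)
  obtain ⟨c, hc, h⟩ :=
    Rat.AbsoluteValue.exists_nat_rpow_iff_isEquiv.2 (Rat.AbsoluteValue.equiv_real_of_unbounded hnb)
  refine ⟨c, hc, fun q => ?_⟩
  have hn (n : ℕ) : ‖(n : K)‖ ^ c = n := by
    have := h n
    rw [hf] at this
    simpa using this
  have hz (n : ℤ) : ‖(n : K)‖ ^ c = |(n : ℝ)| := by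
    obtain ⟨m, rfl | rfl⟩ := n.eq_nat_or_neg
    · simpa using hn m
    · simpa using hn m
  rw [Rat.cast_def, norm_div, Real.div_rpow (norm_nonneg _) (norm_nonneg _), hz, hn]
  conv_rhs => rw [Rat.cast_def, abs_div, Nat.abs_cast]

theorem rpow_norm_add_le {c : ℝ} (hc : 0 < c) (hn : ∀ n : ℕ, ‖(n : K)‖ ^ c = n) (x y : K) :
    ‖x + y‖ ^ c ≤ ‖x‖ ^ c + ‖y‖ ^ c := by
  set a := ‖x‖ ^ c with ha
  set b := ‖y‖ ^ c with hb
  have ha0 : 0 ≤ a := by positivity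
  have hb0 : 0 ≤ b := by positivity
  have inv {t : ℝ} (ht : 0 ≤ t) : (t ^ c) ^ c⁻¹ = t := Real.rpow_rpow_inv ht hc.ne'
  have key : ‖x + y‖ ≤ (a + b) ^ c⁻¹ := by
    refine le_of_forall_pow_le_succ_mul_pow (by positivity) fun N => ?_
    rw [← norm_pow, add_pow]
    refine (norm_sum_le _ _).trans ?_
    have : ((N : ℝ) + 1) * ((a + b) ^ c⁻¹) ^ N =
        ∑ _k ∈ Finset.range (N + 1), ((a + b) ^ c⁻¹) ^ N := by simp
    rw [this]
    refine Finset.sum_le_sum fun k hk => ?_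
    have e1 : ‖x ^ k * y ^ (N - k) * (N.choose k : K)‖ =
        (a ^ k * b ^ (N - k) * (N.choose k : ℝ)) ^ c⁻¹ := by
      rw [Real.mul_rpow (by positivity) (by positivity), Real.mul_rpow (by positivity)
        (by positivity), ← hn (N.choose k), inv (norm_nonneg _), ← Real.rpow_natCast,
        ← Real.rpow_natCast, ← Real.rpow_mul ha0, ← Real.rpow_mul hb0, mul_comm _ c⁻¹,
        mul_comm _ c⁻¹, Real.rpow_mul ha0, Real.rpow_mul hb0, ha, hb, inv (norm_nonneg _),
        inv (norm_nonneg _), Real.rpow_natCast, Real.rpow_natCast]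
      simp [norm_mul, norm_pow]
    have e2 : ((a + b) ^ c⁻¹) ^ N = ((a + b) ^ N) ^ c⁻¹ := by
      rw [← Real.rpow_natCast, ← Real.rpow_natCast, ← Real.rpow_mul (by positivity),
        ← Real.rpow_mul (by positivity), mul_comm]
    rw [e1, e2]
    refine Real.rpow_le_rpow (by positivity) ?_ (by positivity)
    rw [add_pow]
    exact Finset.single_le_sum (f := fun k => a ^ k * b ^ (N - k) * (N.choose k : ℝ))
      (fun _ _ => by positivity) hk
  calc ‖x + y‖ ^ c ≤ ((a + b) ^ c⁻¹) ^ c := Real.rpow_le_rpow (norm_nonneg _) key hc.le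
    _ = a + b := Real.rpow_inv_rpow (by positivity) hc.ne'

/-- A normed field that is isomorphic to `ℂ` as an `ℝ`-algebra is isometric to `ℂ`. -/
theorem norm_eq_of_algEquiv_complex {F : Type*} [NormedField F] [NormedAlgebra ℝ F]
    (e : F ≃ₐ[ℝ] ℂ) (x : F) : ‖x‖ = ‖e x‖ := by
  have hI : ‖e.symm Complex.I‖ = 1 := by
    have h4 : ‖e.symm Complex.I‖ ^ 4 = 1 := by rw [← norm_pow, ← map_pow]; simp
    exact (pow_eq_one_iff_of_nonneg (norm_nonneg _) (by norm_num)).1 h4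
  have h2 (z : ℂ) : ‖e.symm z‖ ≤ 2 * ‖z‖ := by
    have hz : e.symm z = algebraMap ℝ F z.re + algebraMap ℝ F z.im * e.symm Complex.I := by
      rw [← e.symm.commutes, ← e.symm.commutes, ← map_mul, ← map_add]
      simp
    rw [hz]
    refine (norm_add_le _ _).trans ?_
    rw [norm_mul, norm_algebraMap', norm_algebraMap', hI, mul_one, two_mul]
    exact add_le_add (Complex.abs_re_le_norm z) (Complex.abs_im_le_norm z)
  have hle (z : ℂ) : ‖e.symm z‖ ≤ ‖z‖ := by
    refine le_of_forall_pow_le_succ_mul_pow (norm_nonneg z) fun N => ?_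
    rcases Nat.eq_zero_or_pos N with rfl | hN
    · simp
    · rw [← norm_pow, ← map_pow]
      refine (h2 _).trans ?_
      rw [norm_pow]
      have : (1 : ℝ) ≤ N := by exact_mod_cast hN
      gcongr
      linarith
  refine le_antisymm (by simpa using hle (e x)) ?_
  rcases eq_or_ne x 0 with rfl | hx
  · simp
  · have h := hle (e x)⁻¹
    rw [← map_inv₀, e.symm_apply_apply, map_inv₀, norm_inv, norm_inv] at h
    exact (inv_le_inv₀ (norm_pos_iff.2 hx) (norm_pos_iff.2 (by simpa using hx))).1 h

theorem exists_realHom [CompleteSpace K] [CharZero K] {c : ℝ} (hc : 0 < c)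
    (hq : ∀ q : ℚ, ‖(q : K)‖ ^ c = |(q : ℝ)|) :
    ∃ φ : ℝ →+* K, ∀ r, ‖φ r‖ ^ c = |r| := by
  have hn (q : ℚ) : ‖(q : K)‖ = |(q : ℝ)| ^ c⁻¹ := by
    rw [← hq, Real.rpow_rpow_inv (norm_nonneg _) hc.ne']
  have hu : UniformContinuous (Rat.castHom K) := by
    refine uniformContinuous_of_continuousAt_zero (Rat.castHom K) ?_
    rw [ContinuousAt, map_zero, tendsto_zero_iff_norm_tendsto_zero]
    have h1 : Tendsto (fun q : ℚ => |(q : ℝ)| ^ c⁻¹) (𝓝 0) (𝓝 0) := by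
      have : Continuous fun q : ℚ => |(q : ℝ)| ^ c⁻¹ :=
        (Rat.continuous_coe_real.abs).rpow_const fun _ => Or.inr (by positivity)
      have := this.tendsto 0
      simpa [Real.zero_rpow (inv_pos.2 hc).ne'] using this
    exact h1.congr fun q => (hn q).symm
  have ue : IsUniformInducing (Rat.castHom ℝ) := Rat.isUniformEmbedding_coe_real.isUniformInducing
  have dr : DenseRange (Rat.castHom ℝ) := Rat.denseRange_cast
  set φ := IsDenseInducing.extendRingHom ue dr hu
  have hφc : Continuous φ := (uniformContinuous_uniformly_extend ue dr hu).continuous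
  have hφq (q : ℚ) : φ (q : ℝ) = (q : K) := map_ratCast φ q
  refine ⟨φ, fun r => ?_⟩
  have h1 : Continuous fun r => ‖φ r‖ ^ c := hφc.norm.rpow_const fun _ => Or.inr hc.le
  refine congrFun ((Rat.denseRange_cast (𝕜 := ℝ)).equalizer h1 continuous_abs ?_) r
  funext q
  simp only [Function.comp, hφq, hq]

theorem absExponent_eq {c : ℝ} (hc : 0 < c) (hq : ∀ q : ℚ, ‖(q : K)‖ ^ c = |(q : ℝ)|) :
    absExponent K = c⁻¹ := by
  have h2 : ‖(2 : K)‖ = (2 : ℝ) ^ c⁻¹ := by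
    have := hq 2
    rw [show |((2 : ℚ) : ℝ)| = 2 by norm_num] at this
    rw [← this]
    simpa using (Real.rpow_rpow_inv (norm_nonneg (2 : K)) hc.ne').symm
  rw [absExponent, h2, Real.logb_rpow (by norm_num) (by norm_num)]

theorem exists_ringEquiv_complex [CompleteSpace K] [IsAlgClosed K] (hK : ¬ IsUltrametricDist K) :
    0 < absExponent K ∧ ∃ e : K ≃+* ℂ, ∀ x, ‖x‖ = ‖e x‖ ^ absExponent K := by
  have := charZero_of_not_ultrametric hK
  obtain ⟨c, hc, hq⟩ := exists_rpow_norm_ratCast_eq hK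
  obtain ⟨φ, hφ⟩ := exists_realHom hc hq
  have hn (n : ℕ) : ‖(n : K)‖ ^ c = n := by simpa using hq n
  rw [absExponent_eq hc hq]
  refine ⟨inv_pos.2 hc, ?_⟩
  let v : AbsoluteValue K ℝ :=
    { toFun := fun x => ‖x‖ ^ c
      map_mul' := fun x y => by
        simp only [norm_mul]
        exact Real.mul_rpow (norm_nonneg _) (norm_nonneg _)
      nonneg' := fun x => by positivity
      eq_zero' := fun x => by
        rw [Real.rpow_eq_zero (norm_nonneg _) hc.ne', norm_eq_zero]
      add_le' := rpow_norm_add_le hc hn }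
  let _ : Algebra ℝ (WithAbs v) := ((WithAbs.equiv v).symm.toRingHom.comp φ).toAlgebra
  have hnorm (x : WithAbs v) : ‖x‖ = ‖(WithAbs.equiv v) x‖ ^ c := rfl
  let _ : NormedAlgebra ℝ (WithAbs v) :=
    { norm_smul_le := fun r x => by
        rw [Algebra.smul_def, norm_mul]
        refine mul_le_mul_of_nonneg_right (le_of_eq ?_) (norm_nonneg _)
        rw [hnorm]
        exact hφ r }
  have halg : IsAlgClosed (WithAbs v) := IsAlgClosed.of_ringEquiv K _ (WithAbs.equiv v).symm
  rcases NormedAlgebra.Real.nonempty_algEquiv_or (WithAbs v) with he | he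
  · exfalso
    obtain ⟨e⟩ := he
    obtain ⟨z, hz⟩ := IsAlgClosed.exists_pow_nat_eq (-1 : WithAbs v) (n := 2) (by norm_num)
    have h := congrArg e hz
    rw [map_pow, map_neg, map_one] at h
    nlinarith [sq_nonneg (e z)]
  · obtain ⟨e⟩ := he
    refine ⟨(WithAbs.equiv v).symm.trans e.toRingEquiv, fun x => ?_⟩
    have h := norm_eq_of_algEquiv_complex e ((WithAbs.equiv v).symm x)
    rw [hnorm, RingEquiv.apply_symm_apply] at h
    have : ‖((WithAbs.equiv v).symm.trans e.toRingEquiv) x‖ = ‖x‖ ^ c := h.symm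
    rw [this, Real.rpow_rpow_inv (norm_nonneg _) hc.ne']

end Ostrowski

/-! ### Points of the archimedean Berkovich line -/

section ArchimedeanPoints

variable {K : Type*} [NontriviallyNormedField K]

theorem BerkovichA1.abs_sub_le (s : BerkovichA1 K) (a b : K) :
    |s.1 (X - C a) - s.1 (X - C b)| ≤ ‖a - b‖ := by
  have h1 := map_add_le_add s.1 (X - C a) (C (a - b))
  have h2 := map_add_le_add s.1 (X - C b) (C (b - a))
  rw [s.2, C_sub, sub_add_sub_cancel] at h1 h2
  rw [norm_sub_rev b a] at h2
  rw [abs_le]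
  constructor <;> linarith

variable [IsAlgClosed K]

theorem BerkovichA1.pow_le_of_monic (s : BerkovichA1 K) {M : ℝ} (hM : 0 ≤ M)
    (h : ∀ a, M ≤ s.1 (X - C a)) {Q : K[X]} (hQ : Q.Monic) : M ^ Q.natDegree ≤ s.1 Q := by
  conv_rhs => rw [(IsAlgClosed.splits Q).eq_prod_roots, hQ.leadingCoeff, C_1, one_mul,
    map_multiset_prod, Multiset.map_map]
  rw [(IsAlgClosed.splits Q).natDegree_eq_card_roots]
  generalize Q.roots = R
  induction R using Multiset.induction with
  | empty => simp
  | cons a R ih =>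
    rw [Multiset.card_cons, pow_succ', Multiset.map_cons, Multiset.prod_cons]
    exact mul_le_mul (h a) ih (by positivity) (apply_nonneg s.1 _)

theorem BerkovichA1.apply_le_of_min (s : BerkovichA1 K) {M : ℝ} (hM : 0 < M)
    (h : ∀ a, M ≤ s.1 (X - C a)) {a c : K} (ha : s.1 (X - C a) = M) (hc : ‖c‖ < M) :
    s.1 (X - C (a + c)) ≤ M := by
  have key (n : ℕ) : s.1 (X - C (a + c)) ≤ M * (1 + (‖c‖ / M) ^ (n + 1)) := by
    obtain ⟨Q, hQ⟩ : (X - C a) - C c ∣ (X - C a) ^ (n + 1) - (C c) ^ (n + 1) :=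
      sub_dvd_pow_sub_pow _ _ _
    rw [sub_sub, ← C_add] at hQ
    have hdeg : ((X - C a) ^ (n + 1)).natDegree = n + 1 := by
      rw [natDegree_pow, natDegree_X_sub_C, mul_one]
    have hmon : ((X - C a) ^ (n + 1) - (C c) ^ (n + 1)).Monic := by
      refine ((monic_X_sub_C a).pow _).sub_of_left ?_
      rw [← C_pow]
      refine degree_C_le.trans_lt ?_
      rw [degree_eq_natDegree ((monic_X_sub_C a).pow _).ne_zero, hdeg]
      exact_mod_cast Nat.succ_pos n
    have hQm : Q.Monic := Monic.of_mul_monic_left (monic_X_sub_C _) (hQ ▸ hmon)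
    have hQd : Q.natDegree = n := by
      have h1 := congrArg natDegree hQ
      rw [(monic_X_sub_C (a + c)).natDegree_mul hQm, natDegree_X_sub_C, ← C_pow, natDegree_sub_C,
        hdeg] at h1
      omega
    have h2 := s.pow_le_of_monic hM.le h hQm
    rw [hQd] at h2
    have h3 : s.1 (X - C (a + c)) * s.1 Q ≤ M ^ (n + 1) + ‖c‖ ^ (n + 1) := by
      rw [← map_mul, ← hQ, sub_eq_add_neg]
      refine (map_add_le_add s.1 _ _).trans (le_of_eq ?_)
      rw [map_neg_eq_map, map_pow, map_pow, ha, s.2]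
    have h4 : s.1 (X - C (a + c)) * M ^ n ≤ M ^ (n + 1) + ‖c‖ ^ (n + 1) :=
      (mul_le_mul_of_nonneg_left h2 (apply_nonneg s.1 _)).trans h3
    rw [← le_div_iff₀ (pow_pos hM n)] at h4
    refine h4.trans (le_of_eq ?_)
    rw [div_pow, pow_succ M n]
    field_simp
  have hlim : Tendsto (fun n : ℕ => M * (1 + (‖c‖ / M) ^ (n + 1))) atTop (𝓝 (M * (1 + 0))) := by
    refine ((tendsto_pow_atTop_nhds_zero_of_lt_one (by positivity)
      ((div_lt_one hM).2 hc)).comp (tendsto_add_atTop_nat 1)).const_add 1 |>.const_mul M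
  rw [add_zero, mul_one] at hlim
  exact ge_of_tendsto' hlim key

theorem BerkovichA1.exists_eq_evalPoint {e : K ≃+* ℂ} {σ : ℝ} (hσ : 0 < σ)
    (he : ∀ x, ‖x‖ = ‖e x‖ ^ σ) (s : BerkovichA1 K) : ∃ a, s = evalPoint a := by
  set H : ℂ → ℝ := fun z => s.1 (X - C (e.symm z)) with hH
  have hn (z : ℂ) : ‖e.symm z‖ = ‖z‖ ^ σ := by rw [he, e.apply_symm_apply]
  have hdiff (z w : ℂ) : |H z - H w| ≤ ‖z - w‖ ^ σ := by
    rw [← hn, map_sub]; exact s.abs_sub_le _ _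
  have hcont : Continuous H := by
    refine continuous_iff_continuousAt.2 fun w => ?_
    rw [ContinuousAt, tendsto_iff_norm_sub_tendsto_zero]
    have h1 : Tendsto (fun z => ‖z - w‖ ^ σ) (𝓝 w) (𝓝 0) := by
      have : Continuous fun z : ℂ => ‖z - w‖ ^ σ :=
        (continuous_id.sub continuous_const).norm.rpow_const fun _ => Or.inr hσ.le
      simpa [Real.zero_rpow hσ.ne'] using this.tendsto w
    exact squeeze_zero (fun _ => norm_nonneg _) (fun z => hdiff z w) h1
  have htop : Tendsto H (cocompact ℂ) atTop := by
    have h1 : Tendsto (fun z : ℂ => ‖z‖ ^ σ - H 0) (cocompact ℂ) atTop :=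
      tendsto_atTop_add_const_right _ _
        ((tendsto_rpow_atTop hσ).comp (tendsto_norm_cocompact_atTop (E := ℂ)))
    refine tendsto_atTop_mono (fun z => ?_) h1
    have h2 := map_add_le_add s.1 (X - C (e.symm 0)) (-(X - C (e.symm z)))
    rw [map_neg_eq_map, show X - C (e.symm 0) + -(X - C (e.symm z)) = C (e.symm z) by simp, s.2,
      hn] at h2
    simp only [hH]
    linarith
  obtain ⟨z₀, hz₀⟩ := hcont.exists_forall_le htop
  have hmin (a : K) : H z₀ ≤ s.1 (X - C a) := by simpa [hH] using hz₀ (e a)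
  rcases (apply_nonneg s.1 (X - C (e.symm z₀))).eq_or_lt with h0 | hpos
  · refine ⟨e.symm z₀, BerkovichA1.ext_of_linear fun b => ?_⟩
    have h1 := s.abs_sub_le b (e.symm z₀)
    have h2 := map_add_le_add s.1 (X - C b) (-(X - C (e.symm z₀)))
    rw [map_neg_eq_map, ← h0, show X - C b + -(X - C (e.symm z₀)) = C (e.symm z₀ - b) by
      rw [C_sub]; ring, s.2] at h2
    rw [← h0, sub_zero, abs_of_nonneg (apply_nonneg s.1 _), norm_sub_rev] at h1
    simpa using le_antisymm h1 (by linarith)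
  · exfalso
    have hall : {z | H z = H z₀} = Set.univ := by
      refine IsClopen.eq_univ ⟨isClosed_eq hcont continuous_const, ?_⟩ ⟨z₀, rfl⟩
      rw [isOpen_iff_mem_nhds]
      intro w hw
      have h1 : ∀ᶠ z in 𝓝 w, ‖z - w‖ ^ σ < H z₀ := by
        have : Continuous fun z : ℂ => ‖z - w‖ ^ σ :=
          (continuous_id.sub continuous_const).norm.rpow_const fun _ => Or.inr hσ.le
        refine this.continuousAt.eventually_lt_const ?_
        simpa [Real.zero_rpow hσ.ne'] using hpos
      filter_upwards [h1] with z hz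
      refine le_antisymm ?_ (hz₀ z)
      have := s.apply_le_of_min hpos hmin (a := e.symm w) (c := e.symm (z - w)) hw (by rwa [hn])
      rwa [← map_add, add_sub_cancel] at this
    obtain ⟨z, hz⟩ := (htop.eventually_gt_atTop (H z₀)).exists
    have : z ∈ {z | H z = H z₀} := hall ▸ Set.mem_univ z
    exact absurd this hz.ne'

end ArchimedeanPoints

/-! ### A smooth truncation of the logarithm -/

section LogStep

/-- A smooth function that vanishes on `(-∞, 1]` and equals `log √v` on `[2, ∞)`. -/
def logStep (v : ℝ) : ℝ := Real.log v / 2 * Real.smoothTransition (v - 1)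

theorem logStep_of_le_one {v : ℝ} (hv : v ≤ 1) : logStep v = 0 := by
  rw [logStep, Real.smoothTransition.zero_of_nonpos (by linarith), mul_zero]

theorem logStep_of_two_le {v : ℝ} (hv : 2 ≤ v) : logStep v = Real.log v / 2 := by
  rw [logStep, Real.smoothTransition.one_of_one_le (by linarith), mul_one]

theorem contDiff_logStep : ContDiff ℝ ∞ logStep := by
  refine contDiff_iff_contDiffAt.2 fun v => ?_
  rcases lt_or_ge v 1 with hv | hv
  · refine contDiffAt_const.congr_of_eventuallyEq (f := fun _ => (0 : ℝ)) ?_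
    filter_upwards [eventually_lt_nhds hv] with u hu using logStep_of_le_one hu.le
  · refine ((Real.contDiffAt_log.2 (by linarith)).div_const 2).mul ?_
    exact Real.smoothTransition.contDiff.contDiffAt.comp v (contDiffAt_id.sub contDiffAt_const)

theorem logStep_nonneg (v : ℝ) : 0 ≤ logStep v := by
  rcases le_total v 1 with hv | hv
  · rw [logStep_of_le_one hv]
  · exact mul_nonneg (div_nonneg (Real.log_nonneg hv) zero_le_two)
      (Real.smoothTransition.nonneg _)

theorem monotone_logStep : Monotone logStep := by
  intro u v h
  rcases le_total u 1 with hu | hu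
  · rw [logStep_of_le_one hu]; exact logStep_nonneg v
  · have h1 := Real.log_le_log (by linarith) h
    exact mul_le_mul (by linarith) (Real.smoothTransition.monotone (by linarith))
      (Real.smoothTransition.nonneg _) (div_nonneg (Real.log_nonneg (hu.trans h)) zero_le_two)

theorem logStep_le_abs_log (v : ℝ) : logStep v ≤ |Real.log v| / 2 := by
  have h := Real.smoothTransition.le_one (v - 1)
  have h' := Real.smoothTransition.nonneg (v - 1)
  rw [logStep]
  nlinarith [abs_nonneg (Real.log v), le_abs_self (Real.log v)]

theorem logStep_le_log {v : ℝ} (hv : 1 ≤ v) : logStep v ≤ Real.log v / 2 := by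
  simpa [abs_of_nonneg (Real.log_nonneg hv)] using logStep_le_abs_log v

theorem log_le_logStep_add_one (v : ℝ) (hv : 0 ≤ v) : Real.log v / 2 ≤ logStep v + 1 := by
  rcases le_total v 1 with h1 | h1
  · linarith [Real.log_nonpos hv h1, logStep_nonneg v]
  rcases le_total v 2 with h2 | h2
  · have := Real.log_le_sub_one_of_pos (by linarith : 0 < v)
    linarith [logStep_nonneg v]
  · rw [logStep_of_two_le h2]; linarith

theorem contDiff_deriv_logStep : ContDiff ℝ ∞ (deriv logStep) :=
  (contDiff_infty_iff_deriv.1 contDiff_logStep).2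

theorem contDiff_deriv_deriv_logStep : ContDiff ℝ ∞ (deriv (deriv logStep)) :=
  (contDiff_infty_iff_deriv.1 contDiff_deriv_logStep).2

theorem deriv_logStep_of_two_lt {v : ℝ} (hv : 2 < v) : deriv logStep v = v⁻¹ / 2 := by
  have : logStep =ᶠ[𝓝 v] fun u => Real.log u / 2 := by
    filter_upwards [eventually_gt_nhds hv] with u hu using logStep_of_two_le hu.le
  rw [this.deriv_eq, deriv_div_const, Real.deriv_log]

theorem deriv_deriv_logStep_of_two_lt {v : ℝ} (hv : 2 < v) :
    deriv (deriv logStep) v = -(v ^ 2)⁻¹ / 2 := by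
  have : deriv logStep =ᶠ[𝓝 v] fun u => u⁻¹ / 2 := by
    filter_upwards [eventually_gt_nhds hv] with u hu using deriv_logStep_of_two_lt hu
  rw [this.deriv_eq, deriv_div_const, deriv_inv]

/-- The Laplacian of `z ↦ logStep (|z|²)`. -/
def logStepKernel (z : ℂ) : ℝ :=
  4 * (‖z‖ ^ 2 * deriv (deriv logStep) (‖z‖ ^ 2) + deriv logStep (‖z‖ ^ 2))

theorem continuous_logStepKernel : Continuous logStepKernel := by
  have h1 := contDiff_deriv_logStep.continuous
  have h2 := contDiff_deriv_deriv_logStep.continuous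
  unfold logStepKernel
  fun_prop

theorem hasCompactSupport_logStepKernel : HasCompactSupport logStepKernel := by
  refine HasCompactSupport.intro (isCompact_closedBall (0 : ℂ) 2) fun z hz => ?_
  have hz : 2 < ‖z‖ := by simpa using hz
  have h2 : 2 < ‖z‖ ^ 2 := by nlinarith
  rw [logStepKernel, deriv_logStep_of_two_lt h2, deriv_deriv_logStep_of_two_lt h2]
  field_simp
  ring

theorem integral_logStepKernel : ∫ z, logStepKernel z = 2 * Real.pi := by
  set k : ℝ → ℝ := fun ρ => 4 * (ρ ^ 2 * deriv (deriv logStep) (ρ ^ 2) + deriv logStep (ρ ^ 2))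
    with hk
  have hrad : ∫ z, logStepKernel z = _ := integral_fun_norm_addHaar (volume : Measure ℂ) k
  have hderiv (ρ : ℝ) : HasDerivAt (fun ρ => 2 * ρ ^ 2 * deriv logStep (ρ ^ 2)) (ρ * k ρ) ρ := by
    have h1 : HasDerivAt (fun ρ : ℝ => ρ ^ 2) (2 * ρ) ρ := by simpa using hasDerivAt_pow 2 ρ
    have h2 : HasDerivAt (deriv logStep) (deriv (deriv logStep) (ρ ^ 2)) (ρ ^ 2) :=
      (contDiff_deriv_logStep.differentiable (by simp)).differentiableAt.hasDerivAt
    have h3 : HasDerivAt (fun ρ : ℝ => deriv logStep (ρ ^ 2))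
        (deriv (deriv logStep) (ρ ^ 2) * (2 * ρ)) ρ := HasDerivAt.comp (h₂ := deriv logStep) (h := fun ρ : ℝ => ρ ^ 2) ρ h2 h1
    refine ((h1.const_mul 2).mul h3).congr_deriv ?_
    simp only [hk]; ring
  have hkc : Continuous k := by
    have h1 := contDiff_deriv_logStep.continuous
    have h2 := contDiff_deriv_deriv_logStep.continuous
    fun_prop
  have hsupp (ρ : ℝ) (hρ : 2 < ρ) : k ρ = 0 := by
    have h2 : 2 < ρ ^ 2 := by nlinarith
    simp only [hk]
    rw [deriv_logStep_of_two_lt h2, deriv_deriv_logStep_of_two_lt h2]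
    field_simp
    ring
  have hint : IntegrableOn (fun ρ => ρ * k ρ) (Set.Ioi 0) := by
    refine IntegrableOn.of_forall_sdiff_eq_zero (s := Set.Icc 0 2)
      (continuous_id.mul hkc).continuousOn.integrableOn_Icc measurableSet_Ioi fun ρ hρ => ?_
    have h0 : (0 : ℝ) < ρ := hρ.1
    rw [hsupp ρ (by by_contra! h; exact hρ.2 ⟨h0.le, h⟩), mul_zero]
  have hlim : Tendsto (fun ρ => 2 * ρ ^ 2 * deriv logStep (ρ ^ 2)) atTop (𝓝 1) := by
    refine tendsto_const_nhds.congr' ?_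
    filter_upwards [eventually_gt_atTop 2] with ρ hρ
    rw [deriv_logStep_of_two_lt (by nlinarith)]
    field_simp
  have := integral_Ioi_of_hasDerivAt_of_tendsto' (a := 0) (fun ρ _ => hderiv ρ) hint hlim
  rw [hrad]
  simp only [Complex.finrank_real_complex, smul_eq_mul, nsmul_eq_mul, pow_one, Nat.add_one_sub_one]
  rw [this]
  simp [Measure.real]

end LogStep

section RadialLaplacian

theorem laplacian_comp_norm_sq {Ψ : ℝ → ℝ} (hΨ : ContDiff ℝ ∞ Ψ) (c : ℝ) (w y : ℂ) :
    (Δ (fun y : ℂ => Ψ (c * ‖y - w‖ ^ 2)) : ℂ → ℝ) y =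
      4 * c * (c * ‖y - w‖ ^ 2 * deriv (deriv Ψ) (c * ‖y - w‖ ^ 2)
        + deriv Ψ (c * ‖y - w‖ ^ 2)) := by
  have hΨ' : ContDiff ℝ ∞ (deriv Ψ) := (contDiff_infty_iff_deriv.1 hΨ).2
  obtain ⟨L, hL⟩ : ∃ L : ℂ →L[ℝ] ℂ →L[ℝ] ℝ, ∀ a b, L a b = inner ℝ a b :=
    ⟨innerSL ℝ, fun _ _ => rfl⟩
  have hN (y : ℂ) : HasFDerivAt (fun y : ℂ => c * ‖y - w‖ ^ 2)
      ((2 * c) • L (y - w)) y := by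
    have h := ((hasStrictFDerivAt_norm_sq (y - w)).hasFDerivAt.comp y
      ((hasFDerivAt_id y).sub_const w)).const_mul c
    refine h.congr_fderiv ?_
    ext v
    simp [hL, mul_comm, mul_left_comm]
  have hd (Θ : ℝ → ℝ) (hΘ : ContDiff ℝ ∞ Θ) (y : ℂ) :
      HasFDerivAt (fun y : ℂ => Θ (c * ‖y - w‖ ^ 2))
        (deriv Θ (c * ‖y - w‖ ^ 2) • ((2 * c) • L (y - w))) y :=
    (hΘ.differentiable (by simp)).differentiableAt.hasDerivAt.comp_hasFDerivAt y (hN y)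
  have h1 : fderiv ℝ (fun y : ℂ => Ψ (c * ‖y - w‖ ^ 2)) =
      fun y => deriv Ψ (c * ‖y - w‖ ^ 2) • ((2 * c) • L (y - w)) :=
    funext fun y => (hd Ψ hΨ y).fderiv
  have h2 : HasFDerivAt (fun y : ℂ => (2 * c) • L (y - w)) ((2 * c) • L) y := by
    have h := L.hasFDerivAt.comp y ((hasFDerivAt_id y).sub_const w)
    exact HasFDerivAt.const_smul (f := fun y : ℂ => L (y - w)) (f' := L) h (2 * c)
  have h3 := ((hd _ hΨ' y).fun_smul h2).fderiv
  rw [InnerProductSpace.laplacian_eq_iteratedFDeriv_complexPlane]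
  simp only [iteratedFDeriv_two_apply, h1]
  rw [h3]
  have hsq : ‖y - w‖ ^ 2 = (y - w).re ^ 2 + (y - w).im ^ 2 := by
    rw [Complex.sq_norm, Complex.normSq_apply]; ring
  simp [hL, Complex.inner]
  rw [hsq]
  simp
  ring

end RadialLaplacian

/-! ### The logarithmic potential of a measure with a given distributional Laplacian -/

section LogPotential

/-- A smooth substitute for `y ↦ log (max |y - w| r)`. -/
def logTrunc (w : ℂ) (r : ℝ) (y : ℂ) : ℝ := Real.log r + logStep ((r ^ 2)⁻¹ * ‖y - w‖ ^ 2)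

theorem two_le_infty : (2 : WithTop ℕ∞) ≤ ((⊤ : ℕ∞) : WithTop ℕ∞) := by
  have h : ((2 : ℕ∞) : WithTop ℕ∞) ≤ ((⊤ : ℕ∞) : WithTop ℕ∞) := WithTop.coe_le_coe.2 le_top
  exact h

theorem contDiff_norm_sub_sq (w : ℂ) : ContDiff ℝ ∞ fun y : ℂ => ‖y - w‖ ^ 2 :=
  (contDiff_id.sub contDiff_const).norm_sq ℝ

theorem contDiff_logTrunc (w : ℂ) (r : ℝ) : ContDiff ℝ ∞ (logTrunc w r) :=
  contDiff_const.add (contDiff_logStep.comp (contDiff_const.mul (contDiff_norm_sub_sq w)))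

theorem continuous_logTrunc (w : ℂ) (r : ℝ) : Continuous (logTrunc w r) :=
  (contDiff_logTrunc w r).continuous

theorem logTrunc_self (w : ℂ) (r : ℝ) : logTrunc w r w = Real.log r := by
  simp [logTrunc, logStep_of_le_one]

theorem logTrunc_one (w y : ℂ) : logTrunc w 1 y = logStep (‖y - w‖ ^ 2) := by
  simp [logTrunc]

theorem log_le_logTrunc (w : ℂ) (r : ℝ) (y : ℂ) : Real.log r ≤ logTrunc w r y :=
  le_add_of_nonneg_right (logStep_nonneg _)

theorem log_inv_sq_mul {r : ℝ} (hr : 0 < r) {ρ : ℝ} (hρ : ρ ≠ 0) :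
    Real.log ((r ^ 2)⁻¹ * ρ ^ 2) / 2 = Real.log ρ - Real.log r := by
  rw [Real.log_mul (by positivity) (by positivity), Real.log_inv, Real.log_pow, Real.log_pow]
  push_cast; ring

theorem log_norm_le_logTrunc_add_one {w y : ℂ} (hy : y ≠ w) {r : ℝ} (hr : 0 < r) :
    Real.log ‖y - w‖ ≤ logTrunc w r y + 1 := by
  have h := log_le_logStep_add_one ((r ^ 2)⁻¹ * ‖y - w‖ ^ 2) (by positivity)
  rw [log_inv_sq_mul hr (norm_ne_zero_iff.2 (sub_ne_zero.2 hy))] at h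
  rw [logTrunc]; linarith

theorem logTrunc_eq_log_norm {w y : ℂ} {r : ℝ} (hr : 0 < r) (h : 2 * r ^ 2 ≤ ‖y - w‖ ^ 2) :
    logTrunc w r y = Real.log ‖y - w‖ := by
  have h0 : ‖y - w‖ ≠ 0 := by
    intro h0
    rw [h0] at h
    nlinarith [pow_pos hr 2]
  rw [logTrunc, logStep_of_two_le, log_inv_sq_mul hr h0]
  · ring
  · rw [le_inv_mul_iff₀ (by positivity)]; linarith

theorem logTrunc_eq_log {w y : ℂ} {r : ℝ} (hr : 0 < r) (h : ‖y - w‖ ≤ r) :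
    logTrunc w r y = Real.log r := by
  rw [logTrunc, logStep_of_le_one, add_zero]
  rw [inv_mul_le_one₀ (by positivity)]
  gcongr

theorem logTrunc_le_add_one (w : ℂ) {r R : ℝ} (hr : 0 < r) (h : r ≤ R) (y : ℂ) :
    logTrunc w r y ≤ logTrunc w R y + 1 := by
  rcases le_total (‖y - w‖) r with h1 | h1
  · rw [logTrunc_eq_log hr h1]
    linarith [log_le_logTrunc w R y, Real.log_le_log hr h]
  · have h0 : 0 < ‖y - w‖ := hr.trans_le h1
    have hy : y ≠ w := by
      rintro rfl
      simp at h0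
    have h2 : 1 ≤ (r ^ 2)⁻¹ * ‖y - w‖ ^ 2 := by
      rw [le_inv_mul_iff₀ (by positivity), mul_one]
      gcongr
    have h3 := logStep_le_log h2
    rw [log_inv_sq_mul hr h0.ne'] at h3
    have h4 := log_norm_le_logTrunc_add_one hy (hr.trans_le h)
    have h5 : logTrunc w r y ≤ Real.log ‖y - w‖ := by rw [logTrunc]; linarith
    linarith

theorem logTrunc_sub_le (w : ℂ) {r R : ℝ} (hr : 0 < r) (h : r ≤ R) (y : ℂ) :
    logTrunc w R y - logTrunc w r y ≤ Real.log R - Real.log r := by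
  have : logStep ((R ^ 2)⁻¹ * ‖y - w‖ ^ 2) ≤ logStep ((r ^ 2)⁻¹ * ‖y - w‖ ^ 2) := by
    apply monotone_logStep
    gcongr
  simp only [logTrunc]; linarith

theorem hasCompactSupport_logTrunc_sub (w : ℂ) {r R : ℝ} (hr : 0 < r) (hR : 0 < R) :
    HasCompactSupport fun y => logTrunc w R y - logTrunc w r y := by
  refine HasCompactSupport.intro (isCompact_closedBall w (2 * (r + R))) fun y hy => ?_
  have hy : 2 * (r + R) < ‖y - w‖ := by simpa [dist_eq_norm] using hy
  rw [logTrunc_eq_log_norm hr (by nlinarith), logTrunc_eq_log_norm hR (by nlinarith), sub_self]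

theorem laplacian_logTrunc (w : ℂ) {r : ℝ} (hr : 0 < r) (y : ℂ) :
    (Δ (logTrunc w r) : ℂ → ℝ) y = (r ^ 2)⁻¹ * logStepKernel (r⁻¹ • (y - w)) := by
  have h1 : logTrunc w r = (fun _ => Real.log r) +
      fun y => logStep ((r ^ 2)⁻¹ * ‖y - w‖ ^ 2) := rfl
  have h2 : ContDiffAt ℝ 2 (fun y => logStep ((r ^ 2)⁻¹ * ‖y - w‖ ^ 2)) y :=
    (contDiff_logStep.comp (contDiff_const.mul (contDiff_norm_sub_sq w))).contDiffAt.of_le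
      two_le_infty
  have h3 : ‖r⁻¹ • (y - w)‖ ^ 2 = (r ^ 2)⁻¹ * ‖y - w‖ ^ 2 := by
    rw [norm_smul, mul_pow, Real.norm_of_nonneg (inv_nonneg.2 hr.le), inv_pow]
  rw [h1, ContDiffAt.laplacian_add contDiffAt_const h2, InnerProductSpace.laplacian_const,
    laplacian_comp_norm_sq contDiff_logStep, logStepKernel, h3]
  simp only [Pi.zero_apply]
  ring

theorem integral_mul_laplacian_logTrunc (G : ℂ → ℝ) (w : ℂ) {r : ℝ} (hr : 0 < r) :
    ∫ y, G y * (Δ (logTrunc w r) : ℂ → ℝ) y = ∫ z, G (w + r • z) * logStepKernel z := by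
  have h := Measure.integral_comp_smul (volume : Measure ℂ)
    (fun z => G (w + z) * logStepKernel (r⁻¹ • z)) r
  simp only [smul_smul, inv_mul_cancel₀ hr.ne', one_smul, Complex.finrank_real_complex] at h
  rw [h, abs_of_pos (by positivity), smul_eq_mul, ← integral_const_mul,
    ← integral_add_right_eq_self _ w]
  refine integral_congr_ae (Eventually.of_forall fun z => ?_)
  simp only [laplacian_logTrunc w hr]
  rw [add_sub_cancel_right, add_comm z w]
  ring

theorem integral_mul_laplacian_logTrunc_sub {G : ℂ → ℝ} (hG : Continuous G) (w : ℂ) {r R : ℝ}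
    (hr : 0 < r) (hR : 0 < R) :
    ∫ y, G y * (Δ (fun y => logTrunc w R y - logTrunc w r y) : ℂ → ℝ) y =
      (∫ z, G (w + R • z) * logStepKernel z) - ∫ z, G (w + r • z) * logStepKernel z := by
  have hd (ρ : ℝ) (y : ℂ) : ContDiffAt ℝ 2 (logTrunc w ρ) y :=
    (contDiff_logTrunc w ρ).contDiffAt.of_le two_le_infty
  have hl (y : ℂ) : (Δ (fun y => logTrunc w R y - logTrunc w r y) : ℂ → ℝ) y =
      (Δ (logTrunc w R) : ℂ → ℝ) y - (Δ (logTrunc w r) : ℂ → ℝ) y :=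
    ContDiffAt.laplacian_sub (hd R y) (hd r y)
  have hi (ρ : ℝ) (hρ : 0 < ρ) : Integrable fun y => G y * (Δ (logTrunc w ρ) : ℂ → ℝ) y := by
    simp only [laplacian_logTrunc w hρ]
    refine Continuous.integrable_of_hasCompactSupport ?_ ?_
    · have := continuous_logStepKernel
      fun_prop
    · refine HasCompactSupport.intro (isCompact_closedBall w (2 * ρ)) fun y hy => ?_
      have hy : 2 * ρ < ‖y - w‖ := by simpa [dist_eq_norm] using hy
      have : logStepKernel (ρ⁻¹ • (y - w)) = 0 := by
        have h2 : 2 < ‖ρ⁻¹ • (y - w)‖ ^ 2 := by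
          rw [norm_smul, Real.norm_of_nonneg (inv_nonneg.2 hρ.le), mul_pow, inv_pow,
            lt_inv_mul_iff₀ (by positivity)]
          nlinarith
        rw [logStepKernel, deriv_logStep_of_two_lt h2, deriv_deriv_logStep_of_two_lt h2]
        field_simp
        ring
      rw [this, mul_zero, mul_zero]
  simp only [hl, mul_sub]
  rw [integral_sub (hi R hR) (hi r hr), integral_mul_laplacian_logTrunc G w hR,
    integral_mul_laplacian_logTrunc G w hr]

theorem tendsto_integral_mul_logStepKernel {G : ℂ → ℝ} (hG : Continuous G) {C : ℝ}
    (hC : ∀ z, |G z| ≤ C) {w : ℂ} {r : ℕ → ℝ} {c : ℝ}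
    (h : ∀ z ≠ 0, Tendsto (fun n => G (w + r n • z)) atTop (𝓝 c)) :
    Tendsto (fun n => ∫ z, G (w + r n • z) * logStepKernel z) atTop (𝓝 (2 * Real.pi * c)) := by
  rw [mul_comm, ← integral_logStepKernel, ← integral_const_mul]
  refine tendsto_integral_of_dominated_convergence (fun z => C * |logStepKernel z|)
    (fun n => ?_) ?_ (fun n => ?_) ?_
  · have := continuous_logStepKernel
    exact Continuous.aestronglyMeasurable (by fun_prop)
  · exact ((continuous_logStepKernel.integrable_of_hasCompactSupport
      hasCompactSupport_logStepKernel).abs).const_mul C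
  · refine Eventually.of_forall fun z => ?_
    rw [norm_mul, Real.norm_eq_abs, Real.norm_eq_abs]
    exact mul_le_mul_of_nonneg_right (hC _) (abs_nonneg _)
  · filter_upwards [compl_mem_ae_iff.2 (measure_singleton (0 : ℂ))] with z hz
    exact (h z hz).mul_const _

/-- Fatou's lemma and dominated convergence for a sequence whose integrals with respect to two
measures are compared. -/
theorem integrable_and_integral_sub_eq {X : Type*} [MeasurableSpace X] {m₁ m₂ : Measure X}
    [IsFiniteMeasure m₁] [IsFiniteMeasure m₂] {f : X → ℝ} {F : ℕ → X → ℝ} {c ℓ : ℝ}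
    (h₁ : ∀ n, Integrable (F n) m₁) (h₂ : ∀ n, Integrable (F n) m₂) (h0 : ∀ n x, 0 ≤ F n x)
    (hd₁ : ∀ᵐ x ∂m₁, ∀ n, F n x ≤ f x + c) (hd₂ : ∀ᵐ x ∂m₂, ∀ n, F n x ≤ f x + c)
    (hl₁ : ∀ᵐ x ∂m₁, Tendsto (fun n => F n x) atTop (𝓝 (f x)))
    (hl₂ : ∀ᵐ x ∂m₂, Tendsto (fun n => F n x) atTop (𝓝 (f x)))
    (hf : Integrable f m₂)
    (hD : Tendsto (fun n => ∫ x, F n x ∂m₁ - ∫ x, F n x ∂m₂) atTop (𝓝 ℓ)) :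
    Integrable f m₁ ∧ ∫ x, f x ∂m₁ - ∫ x, f x ∂m₂ = ℓ := by
  have ht₂ : Tendsto (fun n => ∫ x, F n x ∂m₂) atTop (𝓝 (∫ x, f x ∂m₂)) := by
    refine tendsto_integral_of_dominated_convergence (fun x => f x + c)
      (fun n => (h₂ n).1) (hf.add (integrable_const c)) (fun n => ?_) hl₂
    filter_upwards [hd₂] with x hx
    rw [Real.norm_of_nonneg (h0 n x)]
    exact hx n
  have ht₁ : Tendsto (fun n => ∫ x, F n x ∂m₁) atTop (𝓝 (ℓ + ∫ x, f x ∂m₂)) := by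
    simpa using hD.add ht₂
  have hmeas : AEStronglyMeasurable f m₁ :=
    aestronglyMeasurable_of_tendsto_ae atTop (fun n => (h₁ n).1) hl₁
  have hfat : ∫⁻ x, ENNReal.ofReal (f x) ∂m₁ ≤ ENNReal.ofReal (ℓ + ∫ x, f x ∂m₂) := by
    have e1 : ∫⁻ x, ENNReal.ofReal (f x) ∂m₁ =
        ∫⁻ x, liminf (fun n => ENNReal.ofReal (F n x)) atTop ∂m₁ := by
      refine lintegral_congr_ae ?_
      filter_upwards [hl₁] with x hx
      exact (ENNReal.tendsto_ofReal hx).liminf_eq.symm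
    rw [e1]
    refine (lintegral_liminf_le' fun n => (h₁ n).1.aemeasurable.ennreal_ofReal).trans ?_
    have e2 (n : ℕ) : ∫⁻ x, ENNReal.ofReal (F n x) ∂m₁ = ENNReal.ofReal (∫ x, F n x ∂m₁) :=
      (ofReal_integral_eq_lintegral_ofReal (h₁ n) (Eventually.of_forall (h0 n))).symm
    simp only [e2]
    exact (ENNReal.tendsto_ofReal ht₁).liminf_eq.le
  have hf0 : 0 ≤ᵐ[m₁] f := by
    filter_upwards [hl₁] with x hx
    exact ge_of_tendsto' hx fun n => h0 n x
  have hf₁ : Integrable f m₁ := by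
    refine ⟨hmeas, ?_⟩
    rw [hasFiniteIntegral_iff_ofReal hf0]
    exact hfat.trans_lt ENNReal.ofReal_lt_top
  refine ⟨hf₁, ?_⟩
  have ht₁' : Tendsto (fun n => ∫ x, F n x ∂m₁) atTop (𝓝 (∫ x, f x ∂m₁)) := by
    refine tendsto_integral_of_dominated_convergence (fun x => f x + c)
      (fun n => (h₁ n).1) (hf₁.add (integrable_const c)) (fun n => ?_) hl₁
    filter_upwards [hd₁] with x hx
    rw [Real.norm_of_nonneg (h0 n x)]
    exact hx n
  rw [tendsto_nhds_unique ht₁' ht₁]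
  ring

variable {m₁ m₂ : Measure ℂ} [IsFiniteMeasure m₁] [IsProbabilityMeasure m₂] {s L : ℝ} {G : ℂ → ℝ}

theorem exists_abs_le_of_tendsto_cocompact (hG : Continuous G)
    (hL : Tendsto G (cocompact ℂ) (𝓝 L)) : ∃ C, ∀ z, |G z| ≤ C := by
  have h1 := hL.abs.eventually (gt_mem_nhds (lt_add_one |L|))
  obtain ⟨t, ht, hts⟩ := mem_cocompact.1 h1
  obtain ⟨C, hC⟩ := ht.exists_bound_of_continuousOn hG.continuousOn
  refine ⟨max C (|L| + 1), fun z => ?_⟩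
  by_cases hz : z ∈ t
  · exact (hC z hz).trans (le_max_left _ _)
  · exact (le_of_lt (hts hz)).trans (le_max_right _ _)

theorem integrable_logTrunc_sub (m : Measure ℂ) [IsFiniteMeasure m] (w : ℂ) {r R : ℝ}
    (hr : 0 < r) (hR : 0 < R) : Integrable (fun y => logTrunc w R y - logTrunc w r y) m :=
  ((continuous_logTrunc w R).sub (continuous_logTrunc w r)).integrable_of_hasCompactSupport
    (hasCompactSupport_logTrunc_sub w hr hR)

/-- The test functions `logTrunc w R - logTrunc w r`, in the limits `R → ∞` and `r → 0`. -/
theorem integral_log_norm_sub_eq (hG : Continuous G)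
    (hL : Tendsto G (cocompact ℂ) (𝓝 L))
    (hΔ : ∀ φ : ℂ → ℝ, ContDiff ℝ ∞ φ → HasCompactSupport φ →
      ∫ z, φ z ∂m₁ - ∫ z, φ z ∂m₂ = (2 * Real.pi * s)⁻¹ * ∫ z, G z * (Δ φ : ℂ → ℝ) z)
    [NullSingletonClass m₂] (hm₂ : ∀ w, Integrable (fun y => Real.log ‖y - w‖) m₂) (w : ℂ) :
    m₁.real Set.univ = 1 ∧ m₁ {w} = 0 ∧ Integrable (fun y => Real.log ‖y - w‖) m₁ ∧
      ∫ y, Real.log ‖y - w‖ ∂m₁ - ∫ y, Real.log ‖y - w‖ ∂m₂ = s⁻¹ * (G w - L) := by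
  obtain ⟨C, hC⟩ := exists_abs_le_of_tendsto_cocompact hG hL
  set A : ℝ → ℝ := fun r => (2 * Real.pi)⁻¹ * ∫ z, G (w + r • z) * logStepKernel z with hA
  have hD (r R : ℝ) (hr : 0 < r) (hR : 0 < R) :
      ∫ y, (logTrunc w R y - logTrunc w r y) ∂m₁ - ∫ y, (logTrunc w R y - logTrunc w r y) ∂m₂ =
        s⁻¹ * (A R - A r) := by
    rw [hΔ _ ((contDiff_logTrunc w R).sub (contDiff_logTrunc w r))
      (hasCompactSupport_logTrunc_sub w hr hR), integral_mul_laplacian_logTrunc_sub hG w hr hR, hA]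
    simp only [mul_inv]
    ring
  set R : ℕ → ℝ := fun n => n + 2 with hRdef
  have hR1 (n : ℕ) : 1 ≤ R n := by
    have : (0 : ℝ) ≤ n := n.cast_nonneg
    simp only [hRdef]; linarith
  have hR0 (n : ℕ) : 0 < R n := one_pos.trans_le (hR1 n)
  have hRtop : Tendsto R atTop atTop := tendsto_natCast_atTop_atTop.atTop_add tendsto_const_nhds
  have hlogtop : Tendsto (fun n => Real.log (R n)) atTop atTop := Real.tendsto_log_atTop.comp hRtop
  have hlogpos (n : ℕ) : 0 < Real.log (R n) := by
    have : (0 : ℝ) ≤ n := n.cast_nonneg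
    refine Real.log_pos ?_
    simp only [hRdef]; linarith
  have hpi : (2 * Real.pi)⁻¹ * (2 * Real.pi) = 1 := inv_mul_cancel₀ (by positivity)
  have hAR : Tendsto (fun n => A (R n)) atTop (𝓝 L) := by
    have h := (tendsto_integral_mul_logStepKernel (w := w) (r := R) (c := L) hG hC fun z hz => ?_)
      |>.const_mul (2 * Real.pi)⁻¹
    · rwa [← mul_assoc, hpi, one_mul] at h
    · refine hL.comp ?_
      rw [← Metric.cobounded_eq_cocompact, ← comap_norm_atTop, tendsto_comap_iff]
      have h1 : Tendsto (fun n => R n * ‖z‖ - ‖w‖) atTop atTop :=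
        tendsto_atTop_add_const_right _ _ (hRtop.atTop_mul_const (norm_pos_iff.2 hz))
      refine tendsto_atTop_mono (fun n => ?_) h1
      have h2 := norm_sub_le_norm_add (R n • z) w
      rw [norm_smul, Real.norm_of_nonneg (hR0 n).le] at h2
      simpa [add_comm] using h2
  have hAr : Tendsto (fun n => A (R n)⁻¹) atTop (𝓝 (G w)) := by
    have h := (tendsto_integral_mul_logStepKernel (w := w) (r := fun n => (R n)⁻¹) (c := G w) hG hC
      fun z hz => ?_) |>.const_mul (2 * Real.pi)⁻¹
    · rwa [← mul_assoc, hpi, one_mul] at h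
    · have h1 : Tendsto (fun n => w + (R n)⁻¹ • z) atTop (𝓝 (w + (0 : ℝ) • z)) :=
        (hRtop.inv_tendsto_atTop.smul_const z).const_add w
      rw [zero_smul, add_zero] at h1
      exact (hG.tendsto w).comp h1
  -- for fixed `y`, `logTrunc w (R n) y = log (R n)` eventually
  have hev (y : ℂ) : ∀ᶠ n in atTop, logTrunc w (R n) y = Real.log (R n) := by
    filter_upwards [hRtop.eventually_ge_atTop ‖y - w‖] with n hn
    exact logTrunc_eq_log (hR0 n) hn
  -- the total mass
  have hmass : m₁.real Set.univ = 1 := by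
    have hlim (m : Measure ℂ) [IsFiniteMeasure m] :
        Tendsto (fun n => ∫ y, (Real.log (R n))⁻¹ * (logTrunc w (R n) y - logTrunc w 1 y) ∂m)
          atTop (𝓝 (m.real Set.univ)) := by
      have h1 : m.real Set.univ = ∫ _, (1 : ℝ) ∂m := by simp
      rw [h1]
      have hl0 : 0 < Real.log 2 := Real.log_pos (by norm_num)
      refine tendsto_integral_of_dominated_convergence (fun _ => 1 + (Real.log 2)⁻¹) (fun n => ?_)
        (integrable_const _) (fun n => Eventually.of_forall fun y => ?_)
        (Eventually.of_forall fun y => ?_)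
      · exact ((integrable_logTrunc_sub m w one_pos (hR0 n)).const_mul _).1
      · have h2 := logTrunc_le_add_one w one_pos (hR1 n) y
        have h3 := logTrunc_sub_le w one_pos (hR1 n) y
        rw [Real.log_one, sub_zero] at h3
        have h4 : Real.log 2 ≤ Real.log (R n) :=
          Real.log_le_log (by norm_num) (by simp [hRdef])
        rw [norm_mul, norm_inv, Real.norm_of_nonneg (hlogpos n).le, inv_mul_le_iff₀ (hlogpos n),
          Real.norm_eq_abs, abs_le]
        have h5 : 1 ≤ Real.log (R n) * (Real.log 2)⁻¹ := by
          rw [← div_eq_mul_inv, le_div_iff₀ hl0]; linarith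
        constructor <;> nlinarith [hlogpos n]
      · have h2 : Tendsto (fun n => 1 - (Real.log (R n))⁻¹ * logTrunc w 1 y) atTop
            (𝓝 (1 - 0 * logTrunc w 1 y)) :=
          (hlogtop.inv_tendsto_atTop.mul_const _).const_sub 1
        rw [zero_mul, sub_zero] at h2
        refine h2.congr' ?_
        filter_upwards [hev y] with n hn
        rw [hn, mul_sub, inv_mul_cancel₀ (hlogpos n).ne']
    have h3 : Tendsto (fun n => (Real.log (R n))⁻¹ * (s⁻¹ * (A (R n) - A 1))) atTop
        (𝓝 (0 * (s⁻¹ * (L - A 1)))) :=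
      hlogtop.inv_tendsto_atTop.mul ((hAR.sub_const _).const_mul _)
    have h4 := (hlim m₁).sub (hlim m₂)
    have h5 := tendsto_nhds_unique (h3.congr fun n => ?_) h4
    · simp at h5
      linarith
    · rw [← hD 1 (R n) one_pos (hR0 n), mul_sub, integral_const_mul, integral_const_mul]
  have hae₂ : ∀ᵐ y ∂m₂, y ≠ w := compl_mem_ae_iff.2 (measure_singleton w)
  have hi₂ : Integrable (fun y => logTrunc w 1 y) m₂ := by
    refine (hm₂ w).abs.mono' (continuous_logTrunc w 1).aestronglyMeasurable
      (Eventually.of_forall fun y => ?_)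
    rw [logTrunc_one, Real.norm_of_nonneg (logStep_nonneg _)]
    refine (logStep_le_abs_log _).trans_eq ?_
    rw [Real.log_pow, abs_mul]
    simp
  -- `R → ∞`
  have hstep : Integrable (fun y => logTrunc w 1 y) m₁ ∧
      ∫ y, logTrunc w 1 y ∂m₁ - ∫ y, logTrunc w 1 y ∂m₂ = -(s⁻¹ * (L - A 1)) := by
    have hi (m : Measure ℂ) [IsFiniteMeasure m] (n : ℕ) : Integrable
        (fun y => Real.log (R n) - (logTrunc w (R n) y - logTrunc w 1 y)) m :=
      (integrable_const _).sub (integrable_logTrunc_sub m w one_pos (hR0 n))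
    have hdom (n : ℕ) (y : ℂ) :
        Real.log (R n) - (logTrunc w (R n) y - logTrunc w 1 y) ≤ logTrunc w 1 y + 0 := by
      linarith [log_le_logTrunc w (R n) y]
    have hlim (y : ℂ) : Tendsto (fun n => Real.log (R n) - (logTrunc w (R n) y - logTrunc w 1 y))
        atTop (𝓝 (logTrunc w 1 y)) := by
      refine tendsto_const_nhds.congr' ?_
      filter_upwards [hev y] with n hn
      rw [hn]; ring
    refine integrable_and_integral_sub_eq (c := 0) (hi m₁) (hi m₂) (fun n y => ?_)
      (Eventually.of_forall fun y n => hdom n y) (Eventually.of_forall fun y n => hdom n y)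
      (Eventually.of_forall hlim) (Eventually.of_forall hlim) hi₂ ?_
    · have := logTrunc_sub_le w one_pos (hR1 n) y
      rw [Real.log_one, sub_zero] at this
      linarith
    · refine ((hAR.sub_const (A 1)).const_mul s⁻¹).neg.congr fun n => ?_
      rw [← hD 1 (R n) one_pos (hR0 n), integral_sub (integrable_const _)
        (integrable_logTrunc_sub m₁ w one_pos (hR0 n)), integral_sub (integrable_const _)
        (integrable_logTrunc_sub m₂ w one_pos (hR0 n)), integral_const, integral_const, hmass]
      simp
  -- `r → 0`
  set F : ℕ → ℂ → ℝ := fun n y => logTrunc w 1 y - logTrunc w (R n)⁻¹ y + 1 with hF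
  have hr0 (n : ℕ) : 0 < (R n)⁻¹ := inv_pos.2 (hR0 n)
  have hr1 (n : ℕ) : (R n)⁻¹ ≤ 1 := inv_le_one_of_one_le₀ (hR1 n)
  have hFi (m : Measure ℂ) [IsFiniteMeasure m] (n : ℕ) : Integrable (F n) m :=
    (integrable_logTrunc_sub m w (hr0 n) one_pos).add (integrable_const 1)
  have hF0 (n : ℕ) (y : ℂ) : 0 ≤ F n y := by
    have := logTrunc_le_add_one w (hr0 n) (hr1 n) y
    simp only [hF]; linarith
  have hFdom (y : ℂ) (hy : y ≠ w) (n : ℕ) :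
      F n y ≤ (logTrunc w 1 y - Real.log ‖y - w‖ + 1) + 1 := by
    have := log_norm_le_logTrunc_add_one hy (hr0 n)
    simp only [hF]; linarith
  have hFlim (y : ℂ) (hy : y ≠ w) : Tendsto (fun n => F n y) atTop
      (𝓝 (logTrunc w 1 y - Real.log ‖y - w‖ + 1)) := by
    refine tendsto_const_nhds.congr' ?_
    have h1 : Tendsto (fun n => 2 * ((R n)⁻¹) ^ 2) atTop (𝓝 (2 * 0 ^ 2)) :=
      (hRtop.inv_tendsto_atTop.pow 2).const_mul 2
    have h2 : (2 * 0 ^ 2 : ℝ) < ‖y - w‖ ^ 2 := by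
      rw [zero_pow two_ne_zero, mul_zero]
      have := norm_pos_iff.2 (sub_ne_zero.2 hy)
      positivity
    filter_upwards [h1.eventually (gt_mem_nhds h2)] with n hn
    simp only [hF]
    rw [logTrunc_eq_log_norm (hr0 n) (le_of_lt hn)]
  have hFint (m : Measure ℂ) [IsFiniteMeasure m] (n : ℕ) : ∫ y, F n y ∂m =
      ∫ y, (logTrunc w 1 y - logTrunc w (R n)⁻¹ y) ∂m + m.real Set.univ := by
    simp only [hF]
    rw [integral_add (integrable_logTrunc_sub m w (hr0 n) one_pos) (integrable_const 1)]
    simp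
  have hFD : Tendsto (fun n => ∫ y, F n y ∂m₁ - ∫ y, F n y ∂m₂) atTop
      (𝓝 (s⁻¹ * (A 1 - G w))) := by
    refine ((hAr.const_sub (A 1)).const_mul s⁻¹).congr fun n => ?_
    rw [← hD _ 1 (hr0 n) one_pos, hFint, hFint, hmass, probReal_univ]
    ring
  have hi₂' : Integrable (fun y => logTrunc w 1 y - Real.log ‖y - w‖ + 1) m₂ :=
    (hi₂.sub (hm₂ w)).add (integrable_const 1)
  have hatom : m₁ {w} = 0 := by
    by_contra h
    have hpos : 0 < m₁.real {w} := ENNReal.toReal_pos h (measure_ne_top _ _)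
    have ht₂ : Tendsto (fun n => ∫ y, F n y ∂m₂) atTop
        (𝓝 (∫ y, (logTrunc w 1 y - Real.log ‖y - w‖ + 1) ∂m₂)) := by
      refine tendsto_integral_of_dominated_convergence
        (fun y => (logTrunc w 1 y - Real.log ‖y - w‖ + 1) + 1)
        (fun n => (hFi m₂ n).1) (hi₂'.add (integrable_const 1)) (fun n => ?_) ?_
      · filter_upwards [hae₂] with y hy
        rw [Real.norm_of_nonneg (hF0 n y)]
        exact hFdom y hy n
      · filter_upwards [hae₂] with y hy using hFlim y hy
    have ht₁ := hFD.add ht₂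
    simp only [sub_add_cancel] at ht₁
    refine not_tendsto_atTop_of_tendsto_nhds ht₁ ?_
    refine tendsto_atTop_mono (fun n => ?_) (hlogtop.atTop_mul_const hpos)
    refine le_trans ?_ (mul_meas_ge_le_integral_of_nonneg (Eventually.of_forall (hF0 n)) (hFi m₁ n)
      (Real.log (R n)))
    refine mul_le_mul_of_nonneg_left (measureReal_mono ?_) (hlogpos n).le
    rintro y rfl
    simp only [hF, Set.mem_ofPred_eq, logTrunc_self, Real.log_one, Real.log_inv]
    linarith
  have hae₁ : ∀ᵐ y ∂m₁, y ≠ w := compl_mem_ae_iff.2 hatom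
  have hstep' := integrable_and_integral_sub_eq (c := 1) (hFi m₁) (hFi m₂) hF0
    (f := fun y => logTrunc w 1 y - Real.log ‖y - w‖ + 1)
    (hae₁.mono fun y hy n => hFdom y hy n) (hae₂.mono fun y hy n => hFdom y hy n)
    (hae₁.mono hFlim) (hae₂.mono hFlim) hi₂' hFD
  have hlog₁ : Integrable (fun y => Real.log ‖y - w‖) m₁ := by
    refine ((hstep.1.sub hstep'.1).add (integrable_const 1)).congr
      (Eventually.of_forall fun y => ?_)
    simp only [Pi.add_apply, Pi.sub_apply]
    ring
  refine ⟨hmass, hatom, hlog₁, ?_⟩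
  have hsplit (m : Measure ℂ) [IsFiniteMeasure m] (ha : Integrable (fun y => logTrunc w 1 y) m)
      (hb : Integrable (fun y => Real.log ‖y - w‖) m) :
      ∫ y, (logTrunc w 1 y - Real.log ‖y - w‖ + 1) ∂m =
        ∫ y, logTrunc w 1 y ∂m - ∫ y, Real.log ‖y - w‖ ∂m + m.real Set.univ := by
    have hab : Integrable (fun y => logTrunc w 1 y - Real.log ‖y - w‖) m := ha.sub hb
    rw [integral_add hab (integrable_const 1), integral_sub ha hb]
    simp
  have h1 := hstep'.2
  rw [hsplit m₁ hstep.1 hlog₁, hsplit m₂ hi₂ (hm₂ w), hmass, probReal_univ] at h1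
  have h2 := hstep.2
  linarith

end LogPotential

/-! ### The logarithmic potential of the curvature measure of `log ‖(z, 1)‖` -/

section FubiniStudy

/-- The area density `(s/π) |z|^(2s-2) (1 + |z|^(2s))⁻²` as a function of `ρ = |z|`. -/
def fsDensity (s ρ : ℝ) : ℝ := s / Real.pi * ρ ^ (2 * s - 2) / (1 + ρ ^ (2 * s)) ^ 2

/-- The measure on `ℂ` with density `fsDensity`. -/
def fsMeasure (s : ℝ) : Measure ℂ :=
  (volume : Measure ℂ).withDensity fun z => ENNReal.ofReal (fsDensity s ‖z‖)

/-- The mass of the disk of radius `ρ` centered at the origin. -/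
def fsMass (s ρ : ℝ) : ℝ := 1 - (1 + ρ ^ (2 * s))⁻¹

/-- The derivative of `fsMass`. -/
def fsRadial (s ρ : ℝ) : ℝ := 2 * s * ρ ^ (2 * s - 1) / (1 + ρ ^ (2 * s)) ^ 2

/-- A primitive of `ρ ↦ log ρ * fsRadial s ρ`. -/
def fsLogPrimitive (s ρ : ℝ) : ℝ :=
  Real.log ρ * fsMass s ρ - (2 * s)⁻¹ * Real.log (1 + ρ ^ (2 * s))

variable {s : ℝ}

theorem measurable_fsDensity : Measurable (fsDensity s) := by
  unfold fsDensity
  fun_prop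

theorem fsDensity_nonneg (hs : 0 < s) {ρ : ℝ} (hρ : 0 ≤ ρ) : 0 ≤ fsDensity s ρ := by
  unfold fsDensity
  positivity

theorem fsRadial_nonneg (hs : 0 < s) {ρ : ℝ} (hρ : 0 ≤ ρ) : 0 ≤ fsRadial s ρ := by
  unfold fsRadial
  positivity

theorem two_pi_mul_fsDensity {ρ : ℝ} (hρ : 0 < ρ) :
    2 * Real.pi * (ρ * fsDensity s ρ) = fsRadial s ρ := by
  have h : ρ ^ (2 * s - 1) = ρ ^ (2 * s - 2) * ρ := by
    rw [show 2 * s - 1 = (2 * s - 2) + 1 by ring, Real.rpow_add_one hρ.ne']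
  rw [fsRadial, fsDensity, h]
  have := Real.pi_pos
  field_simp

theorem one_add_rpow_pos {ρ : ℝ} (hρ : 0 ≤ ρ) : 0 < 1 + ρ ^ (2 * s) := by positivity

theorem hasDerivAt_one_add_rpow {ρ : ℝ} (hρ : 0 < ρ) :
    HasDerivAt (fun ρ => 1 + ρ ^ (2 * s)) (2 * s * ρ ^ (2 * s - 1)) ρ :=
  (Real.hasDerivAt_rpow_const (Or.inl hρ.ne')).const_add 1

theorem hasDerivAt_fsMass {ρ : ℝ} (hρ : 0 < ρ) :
    HasDerivAt (fsMass s) (fsRadial s ρ) ρ := by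
  refine (((hasDerivAt_one_add_rpow hρ).inv (one_add_rpow_pos hρ.le).ne').const_sub 1).congr_deriv
    ?_
  rw [fsRadial]; ring

theorem hasDerivAt_fsLogPrimitive (hs : 0 < s) {ρ : ℝ} (hρ : 0 < ρ) :
    HasDerivAt (fsLogPrimitive s) (Real.log ρ * fsRadial s ρ) ρ := by
  have hp := one_add_rpow_pos (s := s) hρ.le
  refine (((Real.hasDerivAt_log hρ.ne').mul (hasDerivAt_fsMass hρ)).sub
    (((hasDerivAt_one_add_rpow hρ).log hp.ne').const_mul (2 * s)⁻¹)).congr_deriv ?_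
  have h : ρ ^ (2 * s) = ρ ^ (2 * s - 1) * ρ := by
    rw [← Real.rpow_add_one hρ.ne']; ring_nf
  rw [fsMass, h] at *
  field_simp
  ring

theorem continuous_one_add_rpow (hs : 0 < s) : Continuous fun ρ : ℝ => 1 + ρ ^ (2 * s) :=
  continuous_const.add (continuous_id.rpow_const fun _ => Or.inr (by positivity))

theorem continuousOn_fsMass (hs : 0 < s) : ContinuousOn (fsMass s) (Set.Ici 0) := by
  refine continuousOn_const.sub ((continuous_one_add_rpow hs).continuousOn.inv₀ fun ρ hρ => ?_)
  exact (one_add_rpow_pos hρ).ne'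

theorem fsMass_zero (hs : 0 < s) : fsMass s 0 = 0 := by
  simp [fsMass, Real.zero_rpow (by positivity : 2 * s ≠ 0)]

theorem fsLogPrimitive_zero (hs : 0 < s) : fsLogPrimitive s 0 = 0 := by
  simp [fsLogPrimitive, Real.zero_rpow (by positivity : 2 * s ≠ 0)]

theorem fsMass_eq {ρ : ℝ} (hρ : 0 ≤ ρ) : fsMass s ρ = ρ ^ (2 * s) * (1 + ρ ^ (2 * s))⁻¹ := by
  have := one_add_rpow_pos (s := s) hρ
  rw [fsMass]
  field_simp
  ring

theorem continuousWithinAt_fsLogPrimitive (hs : 0 < s) {a : ℝ} (ha : 0 ≤ a) :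
    ContinuousWithinAt (fsLogPrimitive s) (Set.Ici a) a := by
  rcases ha.eq_or_lt with rfl | ha
  · rw [← continuousWithinAt_Ioi_iff_Ici, ContinuousWithinAt, fsLogPrimitive_zero hs]
    have h1 := tendsto_log_mul_rpow_nhdsGT_zero (show 0 < 2 * s by positivity)
    have h2 : Tendsto (fun ρ : ℝ => 1 + ρ ^ (2 * s)) (𝓝[>] 0) (𝓝 1) := by
      have := ((continuous_one_add_rpow hs).tendsto 0).mono_left
        (nhdsWithin_le_nhds (s := Set.Ioi 0))
      simpa [Real.zero_rpow (by positivity : 2 * s ≠ 0)] using this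
    have h3 : Tendsto (fun ρ : ℝ => Real.log ρ * ρ ^ (2 * s) * (1 + ρ ^ (2 * s))⁻¹ -
        (2 * s)⁻¹ * Real.log (1 + ρ ^ (2 * s))) (𝓝[>] 0)
        (𝓝 (0 * 1⁻¹ - (2 * s)⁻¹ * Real.log 1)) :=
      (h1.mul (h2.inv₀ one_ne_zero)).sub ((h2.log one_ne_zero).const_mul _)
    rw [Real.log_one, mul_zero, zero_mul, sub_zero] at h3
    refine h3.congr' ?_
    filter_upwards [self_mem_nhdsWithin] with ρ hρ
    rw [fsLogPrimitive, fsMass_eq (le_of_lt hρ), mul_assoc]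
  · exact (hasDerivAt_fsLogPrimitive hs ha).continuousAt.continuousWithinAt

theorem tendsto_one_add_rpow (hs : 0 < s) : Tendsto (fun ρ : ℝ => 1 + ρ ^ (2 * s)) atTop atTop :=
  tendsto_atTop_add_const_left _ _ (tendsto_rpow_atTop (by positivity))

theorem tendsto_fsMass (hs : 0 < s) : Tendsto (fsMass s) atTop (𝓝 1) := by
  have h := (tendsto_one_add_rpow hs).inv_tendsto_atTop.const_sub 1
  rwa [sub_zero] at h

theorem tendsto_fsLogPrimitive (hs : 0 < s) : Tendsto (fsLogPrimitive s) atTop (𝓝 0) := by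
  have h1 : Tendsto (fun ρ : ℝ => Real.log ρ * (1 + ρ ^ (2 * s))⁻¹) atTop (𝓝 0) := by
    have h := (isLittleO_log_rpow_atTop (show 0 < 2 * s by positivity)).tendsto_div_nhds_zero
    refine squeeze_zero' ?_ ?_ h
    · filter_upwards [eventually_ge_atTop 1] with ρ hρ
      have := Real.log_nonneg hρ
      positivity
    · filter_upwards [eventually_ge_atTop 1] with ρ hρ
      have := Real.log_nonneg hρ
      rw [div_eq_mul_inv]
      have : 0 < ρ ^ (2 * s) := by positivity
      gcongr
      linarith
  have h2 : Tendsto (fun ρ : ℝ => Real.log (1 + (ρ ^ (2 * s))⁻¹)) atTop (𝓝 0) := by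
    have h := ((tendsto_rpow_atTop (show 0 < 2 * s by positivity)).inv_tendsto_atTop.const_add
      1).log (by norm_num)
    simpa using h
  have h3 := h1.neg.sub (h2.const_mul (2 * s)⁻¹)
  rw [neg_zero, mul_zero, sub_zero] at h3
  refine h3.congr' ?_
  filter_upwards [eventually_gt_atTop 0] with ρ hρ
  have hp : 0 < ρ ^ (2 * s) := by positivity
  have h4 : Real.log (1 + (ρ ^ (2 * s))⁻¹) = Real.log (1 + ρ ^ (2 * s)) - 2 * s * Real.log ρ := by
    rw [← Real.log_rpow hρ, ← Real.log_div (by positivity) hp.ne']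
    congr 1
    field_simp
    ring
  rw [fsLogPrimitive, fsMass, h4]
  field_simp
  ring

theorem integrableOn_fsRadial (hs : 0 < s) {a : ℝ} (ha : 0 ≤ a) :
    IntegrableOn (fsRadial s) (Set.Ioi a) :=
  integrableOn_Ioi_deriv_of_nonneg
    ((continuousOn_fsMass hs a ha).mono (Set.Ici_subset_Ici.2 ha))
    (fun _ hρ => hasDerivAt_fsMass (ha.trans_lt hρ))
    (fun _ hρ => fsRadial_nonneg hs (ha.trans (le_of_lt hρ))) (tendsto_fsMass hs)

theorem integral_fsRadial (hs : 0 < s) {a : ℝ} (ha : 0 ≤ a) :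
    ∫ ρ in Set.Ioi a, fsRadial s ρ = 1 - fsMass s a :=
  integral_Ioi_of_hasDerivAt_of_tendsto
    ((continuousOn_fsMass hs a ha).mono (Set.Ici_subset_Ici.2 ha))
    (fun _ hρ => hasDerivAt_fsMass (ha.trans_lt hρ)) (integrableOn_fsRadial hs ha)
    (tendsto_fsMass hs)

theorem integrableOn_log_mul_fsRadial (hs : 0 < s) :
    IntegrableOn (fun ρ => Real.log ρ * fsRadial s ρ) (Set.Ioi 0) := by
  rw [← Set.Ioc_union_Ioi_eq_Ioi (zero_le_one (α := ℝ))]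
  refine IntegrableOn.union ?_ ?_
  · have h : IntegrableOn (fun ρ => -(Real.log ρ * fsRadial s ρ)) (Set.Ioc 0 1) := by
      refine intervalIntegral.integrableOn_deriv_of_nonneg (g := fun ρ => -fsLogPrimitive s ρ) ?_
        (fun ρ hρ => (hasDerivAt_fsLogPrimitive hs hρ.1).neg) fun ρ hρ => ?_
      · intro ρ hρ
        rcases hρ.1.eq_or_lt with rfl | h0
        · exact ((continuousWithinAt_fsLogPrimitive hs le_rfl).mono
            Set.Icc_subset_Ici_self).neg
        · exact (hasDerivAt_fsLogPrimitive hs h0).continuousAt.neg.continuousWithinAt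
      · have := mul_nonneg (neg_nonneg.2 (Real.log_nonpos hρ.1.le hρ.2.le))
          (fsRadial_nonneg hs hρ.1.le)
        linarith
    simpa using h.neg
  · exact integrableOn_Ioi_deriv_of_nonneg (continuousWithinAt_fsLogPrimitive hs zero_le_one)
      (fun ρ hρ => hasDerivAt_fsLogPrimitive hs (one_pos.trans hρ))
      (fun ρ hρ => mul_nonneg (Real.log_nonneg (le_of_lt hρ))
        (fsRadial_nonneg hs (one_pos.trans hρ).le)) (tendsto_fsLogPrimitive hs)

theorem integral_log_mul_fsRadial (hs : 0 < s) {a : ℝ} (ha : 0 ≤ a) :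
    ∫ ρ in Set.Ioi a, Real.log ρ * fsRadial s ρ = -fsLogPrimitive s a := by
  rw [integral_Ioi_of_hasDerivAt_of_tendsto (continuousWithinAt_fsLogPrimitive hs ha)
    (fun _ hρ => hasDerivAt_fsLogPrimitive hs (ha.trans_lt hρ))
    ((integrableOn_log_mul_fsRadial hs).mono_set (Set.Ioi_subset_Ioi ha))
    (tendsto_fsLogPrimitive hs), zero_sub]

theorem integrableOn_and_integral_log_max_mul_fsRadial (hs : 0 < s) {a : ℝ} (ha : 0 ≤ a) :
    IntegrableOn (fun ρ => Real.log (max ρ a) * fsRadial s ρ) (Set.Ioi 0) ∧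
      ∫ ρ in Set.Ioi 0, Real.log (max ρ a) * fsRadial s ρ =
        (2 * s)⁻¹ * Real.log (1 + a ^ (2 * s)) := by
  have hsub : Set.Ioi a ⊆ Set.Ioi 0 := Set.Ioi_subset_Ioi ha
  have h1 : IntegrableOn (fun ρ => Real.log a * fsRadial s ρ) (Set.Ioi 0) :=
    (integrableOn_fsRadial hs le_rfl).const_mul _
  have h2 : IntegrableOn (fun ρ => Real.log ρ * fsRadial s ρ - Real.log a * fsRadial s ρ)
      (Set.Ioi 0) := (integrableOn_log_mul_fsRadial hs).sub h1
  have h3 : IntegrableOn ((Set.Ioi a).indicator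
      fun ρ => Real.log ρ * fsRadial s ρ - Real.log a * fsRadial s ρ) (Set.Ioi 0) :=
    h2.indicator measurableSet_Ioi
  have heq : (fun ρ => Real.log (max ρ a) * fsRadial s ρ) = fun ρ => Real.log a * fsRadial s ρ +
      (Set.Ioi a).indicator
        (fun ρ => Real.log ρ * fsRadial s ρ - Real.log a * fsRadial s ρ) ρ := by
    funext ρ
    by_cases h : a < ρ
    · rw [Set.indicator_of_mem (Set.mem_Ioi.2 h), max_eq_left h.le]; ring
    · rw [Set.indicator_of_notMem (by simpa using h), max_eq_right (not_lt.1 h), add_zero]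
  rw [heq]
  refine ⟨h1.add h3, ?_⟩
  rw [integral_add h1 h3, integral_const_mul, integral_fsRadial hs le_rfl, fsMass_zero hs,
    setIntegral_indicator measurableSet_Ioi, Set.inter_eq_self_of_subset_right hsub,
    integral_sub ((integrableOn_log_mul_fsRadial hs).mono_set hsub) (h1.mono_set hsub),
    integral_log_mul_fsRadial hs ha, integral_const_mul, integral_fsRadial hs ha, fsLogPrimitive]
  ring

theorem toReal_fsDensity (hs : 0 < s) (z : ℂ) :
    (ENNReal.ofReal (fsDensity s ‖z‖)).toReal = fsDensity s ‖z‖ :=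
  ENNReal.toReal_ofReal (fsDensity_nonneg hs (norm_nonneg z))

theorem measurable_ofReal_fsDensity :
    Measurable fun z : ℂ => ENNReal.ofReal (fsDensity s ‖z‖) :=
  (measurable_fsDensity.comp measurable_norm).ennreal_ofReal

theorem integrable_fsMeasure_radial (hs : 0 < s) {F : ℝ → ℝ} :
    Integrable (fun z : ℂ => F ‖z‖) (fsMeasure s) ↔
      IntegrableOn (fun ρ => F ρ * fsRadial s ρ) (Set.Ioi 0) := by
  rw [fsMeasure, integrable_withDensity_iff_integrable_smul' measurable_ofReal_fsDensity
    (Eventually.of_forall fun _ => ENNReal.ofReal_lt_top)]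
  simp only [toReal_fsDensity hs]
  rw [integrable_fun_norm_addHaar volume (f := fun ρ => fsDensity s ρ • F ρ)]
  have h : ∀ ρ ∈ Set.Ioi (0 : ℝ), F ρ * fsRadial s ρ =
      (2 * Real.pi) * (ρ ^ (Module.finrank ℝ ℂ - 1) • fsDensity s ρ • F ρ) := fun ρ hρ => by
    rw [← two_pi_mul_fsDensity hρ, Complex.finrank_real_complex]
    simp only [smul_eq_mul, Nat.add_one_sub_one, pow_one]
    ring
  rw [integrableOn_congr_fun h measurableSet_Ioi]
  exact (integrable_const_mul_iff (IsUnit.mk0 _ (by positivity)) _).symm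

theorem integral_fsMeasure_radial (hs : 0 < s) (F : ℝ → ℝ) :
    ∫ z : ℂ, F ‖z‖ ∂fsMeasure s = ∫ ρ in Set.Ioi 0, F ρ * fsRadial s ρ := by
  rw [fsMeasure, integral_withDensity_eq_integral_toReal_smul measurable_ofReal_fsDensity
    (Eventually.of_forall fun _ => ENNReal.ofReal_lt_top)]
  simp only [toReal_fsDensity hs]
  rw [integral_fun_norm_addHaar volume (fun ρ => fsDensity s ρ • F ρ)]
  have h : ∀ ρ ∈ Set.Ioi (0 : ℝ), F ρ * fsRadial s ρ =
      (2 * Real.pi) * (ρ ^ (Module.finrank ℝ ℂ - 1) • fsDensity s ρ • F ρ) := fun ρ hρ => by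
    rw [← two_pi_mul_fsDensity hρ, Complex.finrank_real_complex]
    simp only [smul_eq_mul, Nat.add_one_sub_one, pow_one]
    ring
  rw [setIntegral_congr_fun measurableSet_Ioi h, integral_const_mul]
  simp [Measure.real]
  ring

theorem isProbabilityMeasure_fsMeasure (hs : 0 < s) : IsProbabilityMeasure (fsMeasure s) := by
  have hi : Integrable (fun _ : ℂ => (1 : ℝ)) (fsMeasure s) :=
    (integrable_fsMeasure_radial hs (F := fun _ => 1)).2
      (by simpa using integrableOn_fsRadial hs le_rfl)
  have hfin : IsFiniteMeasure (fsMeasure s) := (integrable_const_iff_isFiniteMeasure one_ne_zero).1 hi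
  have h := integral_fsMeasure_radial hs (fun _ => 1)
  simp only [one_mul, integral_fsRadial hs le_rfl, fsMass_zero hs, integral_const, smul_eq_mul,
    mul_one, sub_zero] at h
  exact ⟨by rw [← ENNReal.toReal_eq_one_iff]; exact h⟩

instance : NullSingletonClass (fsMeasure s) := by
  unfold fsMeasure
  infer_instance

/-- `fsMeasure` only sees the integrals over the circles centered at the origin. -/
theorem lintegral_fsMeasure_congr {k k' : ℂ → ℝ≥0∞} (hk : Measurable k) (hk' : Measurable k')
    (h : ∀ ρ : ℝ, 0 < ρ → ∫⁻ θ in Set.Ioo (-Real.pi) Real.pi, k (circleMap 0 ρ θ) =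
      ∫⁻ θ in Set.Ioo (-Real.pi) Real.pi, k' (circleMap 0 ρ θ)) :
    ∫⁻ z, k z ∂fsMeasure s = ∫⁻ z, k' z ∂fsMeasure s := by
  have key (k : ℂ → ℝ≥0∞) (hk : Measurable k) : ∫⁻ z, k z ∂fsMeasure s =
      ∫⁻ ρ in Set.Ioi (0 : ℝ), ENNReal.ofReal ρ * ENNReal.ofReal (fsDensity s ρ) *
        ∫⁻ θ in Set.Ioo (-Real.pi) Real.pi, k (circleMap 0 ρ θ) := by
    have hcm : Measurable fun p : ℝ × ℝ => circleMap 0 p.1 p.2 := by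
      unfold circleMap
      fun_prop
    rw [fsMeasure, lintegral_withDensity_eq_lintegral_mul _ measurable_ofReal_fsDensity hk,
      ← Complex.lintegral_comp_polarCoord_symm, polarCoord_target, Measure.volume_eq_prod,
      ← Measure.prod_restrict]
    have hpt (p : ℝ × ℝ) : Complex.polarCoord.symm p = circleMap 0 p.1 p.2 := by
      rw [Complex.polarCoord_symm_apply, circleMap, zero_add, Complex.exp_mul_I,
        Complex.ofReal_cos, Complex.ofReal_sin]
    simp only [hpt, Pi.mul_apply, norm_circleMap_zero]
    rw [lintegral_prod]
    · refine setLIntegral_congr_fun measurableSet_Ioi fun ρ hρ => ?_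
      have hkρ : Measurable fun θ => k (circleMap 0 ρ θ) :=
        hk.comp (hcm.comp measurable_prodMk_left)
      simp only [smul_eq_mul, abs_of_pos (Set.mem_Ioi.1 hρ), ← mul_assoc]
      rw [← lintegral_const_mul _ hkρ]
    · have := measurable_fsDensity (s := s)
      have h2 := hk.comp hcm
      simp only [smul_eq_mul]
      refine Measurable.aemeasurable ?_
      refine measurable_fst.ennreal_ofReal.mul (Measurable.mul ?_ h2)
      exact (this.comp measurable_fst.abs).ennreal_ofReal
  rw [key k hk, key k' hk']
  refine setLIntegral_congr_fun measurableSet_Ioi fun ρ hρ => ?_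
  simp only [h ρ hρ]

theorem circle_integrable_and_integral_log (w : ℂ) {ρ : ℝ} (hρ : 0 < ρ) :
    IntegrableOn (fun θ => Real.log ‖circleMap 0 ρ θ - w‖) (Set.Ioo (-Real.pi) Real.pi) ∧
      ∫ θ in Set.Ioo (-Real.pi) Real.pi, Real.log ‖circleMap 0 ρ θ - w‖ =
        2 * Real.pi * Real.log (max ρ ‖w‖) := by
  have hper : Function.Periodic (fun θ => Real.log ‖circleMap 0 ρ θ - w‖) (2 * Real.pi) :=
    fun θ => by simp only [periodic_circleMap 0 ρ θ]
  have hci : CircleIntegrable (fun z => Real.log ‖z - w‖) 0 ρ :=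
    circleIntegrable_log_norm_sub_const ρ
  have hpi : -Real.pi ≤ Real.pi := by linarith [Real.pi_pos]
  have hii : IntervalIntegrable (fun θ => Real.log ‖circleMap 0 ρ θ - w‖) volume (-Real.pi)
      Real.pi := hper.intervalIntegrable₀ (by positivity) hci _ _
  have hio := (intervalIntegrable_iff_integrableOn_Ioo_of_le hpi).1 hii
  refine ⟨hio, ?_⟩
  have havg := circleAverage_log_norm_sub_const_eq_log_radius_add_posLog (a := w) (c := 0) hρ.ne'
  rw [Real.circleAverage_eq_integral_add (-Real.pi)] at havg
  have hshift : ∫ θ in Set.Ioo (-Real.pi) Real.pi, Real.log ‖circleMap 0 ρ θ - w‖ =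
      ∫ θ in (0)..(2 * Real.pi), Real.log ‖circleMap 0 ρ (θ + -Real.pi) - w‖ := by
    rw [intervalIntegral.integral_comp_add_right
      (fun θ => Real.log ‖circleMap 0 ρ θ - w‖), ← integral_Ioc_eq_integral_Ioo,
      ← intervalIntegral.integral_of_le hpi]
    congr 1 <;> ring
  have hmax : Real.log ρ + Real.posLog (ρ⁻¹ * ‖w‖) = Real.log (max ρ ‖w‖) := by
    rcases le_total ‖w‖ ρ with h | h
    · rw [max_eq_left h, (Real.posLog_eq_zero_iff _).2, add_zero]
      rw [abs_of_nonneg (by positivity)]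
      exact inv_mul_le_one_of_le₀ h hρ.le
    · have hw : 0 < ‖w‖ := hρ.trans_le h
      rw [max_eq_right h, Real.posLog_eq_log, Real.log_mul (by positivity) hw.ne', Real.log_inv]
      · ring
      · rw [abs_of_nonneg (by positivity), le_inv_mul_iff₀ hρ, mul_one]
        exact h
  rw [zero_sub, norm_neg, hmax, smul_eq_mul, inv_mul_eq_iff_eq_mul₀ (by positivity)] at havg
  rw [hshift, havg]

theorem integrable_log_max_fsMeasure (hs : 0 < s) {a : ℝ} (ha : 0 ≤ a) :
    Integrable (fun z : ℂ => Real.log (max ‖z‖ a)) (fsMeasure s) :=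
  (integrable_fsMeasure_radial hs (F := fun ρ => Real.log (max ρ a))).2
    (integrableOn_and_integral_log_max_mul_fsRadial hs ha).1

theorem integrable_log_one_add_norm_fsMeasure (hs : 0 < s) :
    Integrable (fun z : ℂ => Real.log (1 + ‖z‖)) (fsMeasure s) := by
  have := isProbabilityMeasure_fsMeasure hs
  refine ((integrable_const (Real.log 2)).add (integrable_log_max_fsMeasure hs zero_le_one)).mono'
    (Measurable.aestronglyMeasurable (by fun_prop)) (Eventually.of_forall fun z => ?_)
  have h1 : 1 ≤ max ‖z‖ 1 := le_max_right _ _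
  rw [Real.norm_of_nonneg (Real.log_nonneg (by linarith [norm_nonneg z])), Pi.add_apply,
    ← Real.log_mul (by norm_num) (by positivity)]
  refine Real.log_le_log (by positivity) ?_
  linarith [le_max_left ‖z‖ 1]

theorem integrable_and_integral_log_norm_sub_fsMeasure (hs : 0 < s) (w : ℂ) :
    Integrable (fun z => Real.log ‖z - w‖) (fsMeasure s) ∧
      ∫ z, Real.log ‖z - w‖ ∂fsMeasure s = (2 * s)⁻¹ * Real.log (1 + ‖w‖ ^ (2 * s)) := by
  have := isProbabilityMeasure_fsMeasure hs
  set P : ℂ → ℝ := fun z => Real.log (1 + ‖z‖) + Real.log (1 + ‖w‖) with hP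
  have hPi : Integrable P (fsMeasure s) :=
    (integrable_log_one_add_norm_fsMeasure hs).add (integrable_const _)
  have hPeq (z : ℂ) : P z = Real.log ((1 + ‖z‖) * (1 + ‖w‖)) :=
    (Real.log_mul (by positivity) (by positivity)).symm
  have hbound (z : ℂ) (t : ℝ) (ht : t ≤ ‖z‖ + ‖w‖) (ht0 : 0 ≤ t) : 0 ≤ P z - Real.log t := by
    rw [hPeq, sub_nonneg]
    rcases ht0.eq_or_lt with rfl | ht0
    · rw [Real.log_zero]
      refine Real.log_nonneg ?_
      nlinarith [norm_nonneg z, norm_nonneg w, mul_nonneg (norm_nonneg z) (norm_nonneg w)]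
    · refine Real.log_le_log ht0 ?_
      nlinarith [norm_nonneg z, norm_nonneg w, mul_nonneg (norm_nonneg z) (norm_nonneg w)]
  have hk0 (z : ℂ) : 0 ≤ P z - Real.log ‖z - w‖ := hbound z _ (norm_sub_le z w) (norm_nonneg _)
  have hH0 (z : ℂ) : 0 ≤ P z - Real.log (max ‖z‖ ‖w‖) :=
    hbound z _ (max_le (by linarith [norm_nonneg w]) (by linarith [norm_nonneg z]))
      (le_max_of_le_left (norm_nonneg z))
  have hmax := integrable_log_max_fsMeasure hs (norm_nonneg w)
  have hHi : Integrable (fun z => P z - Real.log (max ‖z‖ ‖w‖)) (fsMeasure s) := hPi.sub hmax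
  have hmk : Measurable fun z => P z - Real.log ‖z - w‖ := by
    simp only [hP]
    fun_prop
  have hmH : Measurable fun z => P z - Real.log (max ‖z‖ ‖w‖) := by
    simp only [hP]
    fun_prop
  have hlin : ∫⁻ z, ENNReal.ofReal (P z - Real.log ‖z - w‖) ∂fsMeasure s =
      ∫⁻ z, ENNReal.ofReal (P z - Real.log (max ‖z‖ ‖w‖)) ∂fsMeasure s := by
    refine lintegral_fsMeasure_congr hmk.ennreal_ofReal hmH.ennreal_ofReal fun ρ hρ => ?_
    obtain ⟨hi, hv⟩ := circle_integrable_and_integral_log w hρ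
    have hPc (θ : ℝ) : P (circleMap 0 ρ θ) = Real.log (1 + ρ) + Real.log (1 + ‖w‖) := by
      simp only [hP, norm_circleMap_zero, abs_of_pos hρ]
    have hci (c : ℝ) : IntegrableOn (fun _ : ℝ => c) (Set.Ioo (-Real.pi) Real.pi) :=
      integrableOn_const (by simp)
    have hi1 : IntegrableOn (fun θ => P (circleMap 0 ρ θ) - Real.log ‖circleMap 0 ρ θ - w‖)
        (Set.Ioo (-Real.pi) Real.pi) := by
      simp only [hPc]
      exact (hci _).sub hi
    have hi2 : IntegrableOn (fun θ => P (circleMap 0 ρ θ) -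
        Real.log (max ‖circleMap 0 ρ θ‖ ‖w‖)) (Set.Ioo (-Real.pi) Real.pi) := by
      simp only [hPc, norm_circleMap_zero]
      exact (hci _).sub (hci _)
    rw [← ofReal_integral_eq_lintegral_ofReal hi1 (Eventually.of_forall fun θ => hk0 _),
      ← ofReal_integral_eq_lintegral_ofReal hi2 (Eventually.of_forall fun θ => hH0 _)]
    congr 1
    simp only [hPc, norm_circleMap_zero, abs_of_pos hρ]
    rw [integral_sub (hci _) hi, integral_sub (hci _) (hci _), hv]
    have hpi : 0 ≤ Real.pi - -Real.pi := by linarith [Real.pi_pos]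
    simp only [integral_const, MeasurableSet.univ, measureReal_restrict_apply, Set.univ_inter,
      Real.volume_real_Ioo_of_le (by linarith [Real.pi_pos] : -Real.pi ≤ Real.pi), smul_eq_mul]
    ring
  have hki : Integrable (fun z => P z - Real.log ‖z - w‖) (fsMeasure s) := by
    refine ⟨hmk.aestronglyMeasurable, ?_⟩
    rw [hasFiniteIntegral_iff_ofReal (Eventually.of_forall hk0), hlin,
      ← hasFiniteIntegral_iff_ofReal (Eventually.of_forall hH0)]
    exact hHi.2
  have hint : ∫ z, (P z - Real.log ‖z - w‖) ∂fsMeasure s =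
      ∫ z, (P z - Real.log (max ‖z‖ ‖w‖)) ∂fsMeasure s := by
    rw [integral_eq_lintegral_of_nonneg_ae (Eventually.of_forall hk0) hmk.aestronglyMeasurable,
      hlin, ← integral_eq_lintegral_of_nonneg_ae (Eventually.of_forall hH0)
        hmH.aestronglyMeasurable]
  have hli : Integrable (fun z => Real.log ‖z - w‖) (fsMeasure s) := by
    refine (hPi.sub hki).congr (Eventually.of_forall fun z => ?_)
    simp
  refine ⟨hli, ?_⟩
  rw [integral_sub hPi hli, integral_sub hPi hmax,
    integral_fsMeasure_radial hs (fun ρ => Real.log (max ρ ‖w‖)),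
    (integrableOn_and_integral_log_max_mul_fsRadial hs (norm_nonneg w)).2] at hint
  linarith

end FubiniStudy

/-! ### The affine chart of the archimedean projective line -/

section Chart

variable {K : Type*} [NontriviallyNormedField K] {e : K ≃+* ℂ} {s : ℝ}

theorem norm_symm_eq (he : ∀ x, ‖x‖ = ‖e x‖ ^ s) (z : ℂ) : ‖e.symm z‖ = ‖z‖ ^ s := by
  rw [he, e.apply_symm_apply]

theorem norm_eq_rpow_inv (hs : 0 < s) (he : ∀ x, ‖x‖ = ‖e x‖ ^ s) (x : K) :
    ‖e x‖ = ‖x‖ ^ s⁻¹ := by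
  rw [he, Real.rpow_rpow_inv (norm_nonneg _) hs.ne']

theorem continuous_of_norm_eq_rpow {A B : Type*} [NormedField A] [NormedField B] (φ : A →+* B)
    {c : ℝ} (hc : 0 < c) (h : ∀ x, ‖φ x‖ = ‖x‖ ^ c) : Continuous φ := by
  refine continuous_of_continuousAt_zero φ ?_
  rw [ContinuousAt, map_zero, tendsto_zero_iff_norm_tendsto_zero]
  have h1 : Continuous fun x : A => ‖x‖ ^ c := continuous_norm.rpow_const fun _ => Or.inr hc.le
  have h2 := h1.tendsto 0
  simp only [norm_zero, Real.zero_rpow hc.ne'] at h2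
  exact h2.congr fun x => (h x).symm

theorem continuous_ringEquiv (hs : 0 < s) (he : ∀ x, ‖x‖ = ‖e x‖ ^ s) : Continuous e :=
  continuous_of_norm_eq_rpow (e : K →+* ℂ) (inv_pos.2 hs) (norm_eq_rpow_inv hs he)

theorem continuous_ringEquiv_symm (hs : 0 < s) (he : ∀ x, ‖x‖ = ‖e x‖ ^ s) :
    Continuous e.symm :=
  continuous_of_norm_eq_rpow (e.symm : ℂ →+* K) hs (norm_symm_eq he)

theorem exists_chart [CompleteSpace K] [IsAlgClosed K] (hK : ¬ IsUltrametricDist K) :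
    0 < absExponent K ∧ ∃ e : K ≃+* ℂ, Continuous e ∧ (∀ x, ‖x‖ = ‖e x‖ ^ absExponent K) ∧
      omegaCan K = (fsMeasure (absExponent K)).map (chartZero e) := by
  obtain ⟨hs, e₀, he₀⟩ := exists_ringEquiv_complex hK
  have hex : ∃ e : K ≃+* ℂ, Continuous e := ⟨e₀, continuous_ringEquiv hs he₀⟩
  refine ⟨hs, hex.choose, hex.choose_spec, fun x => ?_, ?_⟩
  · have hc : Continuous ((hex.choose : K →+* ℂ).comp (e₀.symm : ℂ →+* K)) :=
      hex.choose_spec.comp (continuous_ringEquiv_symm hs he₀)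
    have hx : hex.choose x = ((hex.choose : K →+* ℂ).comp (e₀.symm : ℂ →+* K)) (e₀ x) := by
      simp
    rw [he₀, hx]
    rcases Complex.ringHom_eq_id_or_conj_of_continuous hc with h | h <;> rw [h] <;> simp
  · rw [omegaCan, dif_neg hK, dif_pos hex]
    rfl

theorem chartZero_eq (e : K ≃+* ℂ) (z : ℂ) :
    chartZero e z = classical (OnePoint.some (e.symm z)) := by
  simp [chartZero, proj]

theorem chartZero_eq_coe (e : K ≃+* ℂ) (z : ℂ) :
    chartZero e z = ((evalPoint (e.symm z) : BerkovichA1 K) : BerkovichP1 K) := by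
  rw [chartZero_eq, classical_some]

theorem chartZero_ne_infty (z : ℂ) : chartZero e z ≠ OnePoint.infty := by
  rw [chartZero_eq_coe]
  exact OnePoint.coe_ne_infty _

theorem exists_chartZero_eq_or [IsAlgClosed K] (hs : 0 < s) (he : ∀ x, ‖x‖ = ‖e x‖ ^ s) (x : BerkovichP1 K) :
    x = OnePoint.infty ∨ ∃ z, x = chartZero e z := by
  induction x using OnePoint.rec with
  | infty => exact Or.inl rfl
  | coe t =>
    obtain ⟨a, rfl⟩ := BerkovichA1.exists_eq_evalPoint hs he t
    exact Or.inr ⟨e a, by rw [chartZero_eq_coe, e.symm_apply_apply]⟩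

variable [IsAlgClosed K]

/-- The Berkovich affine line of an archimedean field is the complex plane. -/
def homeoA1 (hs : 0 < s) (he : ∀ x, ‖x‖ = ‖e x‖ ^ s) : ℂ ≃ₜ BerkovichA1 K := by
  refine (Equiv.ofBijective (fun z : ℂ => (evalPoint (e.symm z) : BerkovichA1 K))
    ⟨evalPoint_injective.comp e.symm.injective, fun t => ?_⟩).toHomeomorphOfIsInducing ?_
  · obtain ⟨a, rfl⟩ := BerkovichA1.exists_eq_evalPoint hs he t
    exact ⟨e a, by simp⟩
  · have hcont : Continuous fun z : ℂ => (evalPoint (e.symm z) : BerkovichA1 K) := by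
      rw [BerkovichA1.isEmbedding_coe.continuous_iff]
      refine continuous_pi fun P => ?_
      have := continuous_ringEquiv_symm hs he
      simp only [Function.comp, evalPoint_apply]
      exact (P.continuous.comp this).norm
    rw [isInducing_iff_nhds]
    refine fun z => le_antisymm (hcont.continuousAt.le_comap) ?_
    have h1 : Tendsto (fun y : ℂ => ‖y - z‖ ^ s)
        (comap (fun y : ℂ => (evalPoint (e.symm y) : BerkovichA1 K))
          (𝓝 (evalPoint (e.symm z)))) (𝓝 0) := by
      have h2 := ((BerkovichA1.continuous_apply (X - C (e.symm z))).tendsto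
        (evalPoint (e.symm z))).comp (tendsto_comap
          (f := fun y : ℂ => (evalPoint (e.symm y) : BerkovichA1 K)))
      simp only [evalPoint_apply, eval_sub, eval_X, eval_C, sub_self, norm_zero,
        Function.comp_def] at h2
      refine h2.congr fun y => ?_
      rw [← map_sub, norm_symm_eq he]
    have h3 : Tendsto (fun y : ℂ => ‖y - z‖)
        (comap (fun y : ℂ => (evalPoint (e.symm y) : BerkovichA1 K))
          (𝓝 (evalPoint (e.symm z)))) (𝓝 0) := by
      have h4 := h1.rpow_const (p := s⁻¹) (Or.inr (inv_pos.2 hs).le)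
      rw [Real.zero_rpow (inv_pos.2 hs).ne'] at h4
      exact h4.congr fun y => Real.rpow_rpow_inv (norm_nonneg _) hs.ne'
    exact tendsto_id'.1 (tendsto_iff_norm_sub_tendsto_zero.2 h3)

theorem chartZero_eq_comp (hs : 0 < s) (he : ∀ x, ‖x‖ = ‖e x‖ ^ s) :
    chartZero e = ((↑) : BerkovichA1 K → BerkovichP1 K) ∘ homeoA1 hs he :=
  funext fun z => chartZero_eq_coe e z

theorem isOpenEmbedding_chartZero (hs : 0 < s) (he : ∀ x, ‖x‖ = ‖e x‖ ^ s) :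
    IsOpenEmbedding (chartZero e) := by
  rw [chartZero_eq_comp hs he]
  exact OnePoint.isOpenEmbedding_coe.comp (homeoA1 hs he).isOpenEmbedding

theorem measurableEmbedding_chartZero (hs : 0 < s) (he : ∀ x, ‖x‖ = ‖e x‖ ^ s) :
    MeasurableEmbedding (chartZero e) :=
  (isOpenEmbedding_chartZero hs he).measurableEmbedding

theorem tendsto_chartZero (hs : 0 < s) (he : ∀ x, ‖x‖ = ‖e x‖ ^ s) :
    Tendsto (chartZero e) (cocompact ℂ) (𝓝 OnePoint.infty) := by
  have : T2Space (BerkovichA1 K) := (homeoA1 hs he).t2Space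
  rw [chartZero_eq_comp hs he]
  have h1 := OnePoint.tendsto_coe_infty (X := BerkovichA1 K)
  rw [coclosedCompact_eq_cocompact] at h1
  exact h1.comp (homeoA1 hs he).isClosedEmbedding.tendsto_cocompact

theorem classical_surjective (hs : 0 < s) (he : ∀ x, ‖x‖ = ‖e x‖ ^ s) :
    Function.Surjective (classical (K := K)) := by
  intro x
  rcases exists_chartZero_eq_or hs he x with rfl | ⟨z, rfl⟩
  · exact ⟨OnePoint.infty, classical_infty⟩
  · exact ⟨_, (chartZero_eq e z).symm⟩

end Chart

section ArchimedeanKernel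

variable {K : Type*} [NontriviallyNormedField K] {e : K ≃+* ℂ} {s : ℝ}

theorem hsia_classical_classical (hK : ¬ IsUltrametricDist K) (z w : OnePoint K) :
    hsia (classical z) (classical w) = chordal z w := by
  rw [hsia, if_neg hK, Function.leftInverse_invFun classical_injective,
    Function.leftInverse_invFun classical_injective]

theorem norm2_arch (hK : ¬ IsUltrametricDist K) (a b : ℝ) :
    norm2 K a b = Real.sqrt (a ^ 2 + b ^ 2) := by
  rw [norm2, if_neg hK]

theorem chordal_le_one_of_not_ultrametric (hK : ¬ IsUltrametricDist K) (z w : OnePoint K) :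
    chordal z w ≤ 1 := by
  rw [chordal]
  refine div_le_one_of_le₀ ?_
    (mul_pos (pairNorm_homCoord_pos z) (pairNorm_homCoord_pos w)).le
  rw [pairNorm, pairNorm, norm2_arch hK, norm2_arch hK, ← Real.sqrt_mul (by positivity)]
  refine Real.le_sqrt_of_sq_le ?_
  have h := norm_sub_le ((homCoord z).1 * (homCoord w).2) ((homCoord z).2 * (homCoord w).1)
  rw [norm_mul, norm_mul] at h
  have h2 := pow_le_pow_left₀ (norm_nonneg _) h 2
  nlinarith [sq_nonneg (‖(homCoord z).1‖ * ‖(homCoord w).1‖ -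
    ‖(homCoord z).2‖ * ‖(homCoord w).2‖)]

/-- The function `log ‖(z, 1)‖` on `ℂ`. -/
def logPairNorm (s : ℝ) (z : ℂ) : ℝ := Real.log (1 + ‖z‖ ^ (2 * s)) / 2

theorem logPairNorm_nonneg (s : ℝ) (z : ℂ) : 0 ≤ logPairNorm s z := by
  have : 0 ≤ ‖z‖ ^ (2 * s) := by positivity
  exact div_nonneg (Real.log_nonneg (by linarith)) zero_le_two

theorem log_norm2 (hK : ¬ IsUltrametricDist K) (he : ∀ x, ‖x‖ = ‖e x‖ ^ s) (z : ℂ) :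
    Real.log (norm2 K ‖e.symm z‖ 1) = logPairNorm s z := by
  rw [norm2_arch hK, norm_symm_eq he, Real.log_sqrt (by positivity), logPairNorm, one_pow,
    ← Real.rpow_natCast, ← Real.rpow_mul (norm_nonneg _), add_comm, mul_comm s]
  norm_num

theorem hsia_chart_chart (hK : ¬ IsUltrametricDist K) (w z : ℂ) :
    hsia (chartZero e w) (chartZero e z) =
      ‖e.symm (z - w)‖ / (norm2 K ‖e.symm w‖ 1 * norm2 K ‖e.symm z‖ 1) := by
  rw [chartZero_eq, chartZero_eq, hsia_classical_classical hK, chordal, pairNorm_some,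
    pairNorm_some, map_sub, ← norm_neg (e.symm z - e.symm w)]
  simp

theorem hsia_chart_self (hK : ¬ IsUltrametricDist K) (w : ℂ) :
    hsia (chartZero e w) (chartZero e w) = 0 := by
  rw [hsia_chart_chart hK]; simp

theorem hsia_infty_chart (hK : ¬ IsUltrametricDist K) (z : ℂ) :
    hsia OnePoint.infty (chartZero e z) = (norm2 K ‖e.symm z‖ 1)⁻¹ := by
  rw [chartZero_eq, ← classical_infty, hsia_classical_classical hK, chordal, pairNorm_some,
    pairNorm_infty]
  simp

theorem hsia_infty_infty (hK : ¬ IsUltrametricDist K) :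
    hsia (OnePoint.infty : BerkovichP1 K) OnePoint.infty = 0 := by
  rw [← classical_infty, hsia_classical_classical hK, chordal]
  simp

theorem hsia_chart_chart_pos (hK : ¬ IsUltrametricDist K) {w z : ℂ} (h : z ≠ w) :
    0 < hsia (chartZero e w) (chartZero e z) := by
  rw [hsia_chart_chart hK]
  have h1 := norm2_one_pos (K := K) ‖e.symm w‖
  have h2 := norm2_one_pos (K := K) ‖e.symm z‖
  have h3 : 0 < ‖e.symm (z - w)‖ := norm_pos_iff.2 (by simpa [sub_eq_zero] using h)
  positivity

theorem log_hsia_chart_chart (hK : ¬ IsUltrametricDist K) (he : ∀ x, ‖x‖ = ‖e x‖ ^ s) {w z : ℂ}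
    (h : z ≠ w) : Real.log (hsia (chartZero e w) (chartZero e z)) =
      s * Real.log ‖z - w‖ - logPairNorm s w - logPairNorm s z := by
  have h1 := norm2_one_pos (K := K) ‖e.symm w‖
  have h2 := norm2_one_pos (K := K) ‖e.symm z‖
  have h3 : 0 < ‖z - w‖ := norm_pos_iff.2 (sub_ne_zero.2 h)
  rw [hsia_chart_chart hK, norm_symm_eq he, Real.log_div (by positivity) (by positivity),
    Real.log_mul h1.ne' h2.ne', log_norm2 hK he, log_norm2 hK he, Real.log_rpow h3]
  ring

theorem log_hsia_infty_chart (hK : ¬ IsUltrametricDist K) (he : ∀ x, ‖x‖ = ‖e x‖ ^ s) (z : ℂ) :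
    Real.log (hsia OnePoint.infty (chartZero e z)) = -logPairNorm s z := by
  rw [hsia_infty_chart hK, Real.log_inv, log_norm2 hK he]

theorem absExponent_le_one (K : Type*) [NontriviallyNormedField K] : absExponent K ≤ 1 := by
  have h : ‖(2 : K)‖ ≤ 2 := by
    have := norm_add_le (1 : K) 1
    rw [one_add_one_eq_two, norm_one] at this
    linarith
  rw [absExponent]
  rcases (norm_nonneg (2 : K)).eq_or_lt with h0 | h0
  · rw [← h0]; simp
  · rw [Real.logb_le_iff_le_rpow (by norm_num) h0]
    simpa using h

end ArchimedeanKernel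

/-! ### Potentials of continuous weights over an archimedean field -/

section ArchimedeanPotential

variable {K : Type*} [NontriviallyNormedField K] [IsAlgClosed K] {e : K ≃+* ℂ}

theorem integral_extend_chartZero {s : ℝ} (hs : 0 < s) (he : ∀ x, ‖x‖ = ‖e x‖ ^ s)
    (μ : Measure (BerkovichP1 K)) (φ : ℂ → ℝ) :
    ∫ x, Function.extend (chartZero e) φ 0 x ∂μ = ∫ z, φ z ∂μ.comap (chartZero e) := by
  have hχ := measurableEmbedding_chartZero hs he
  have h1 : ∫ x, Function.extend (chartZero e) φ 0 x ∂μ =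
      ∫ x in Set.range (chartZero e), Function.extend (chartZero e) φ 0 x ∂μ :=
    (setIntegral_eq_integral_of_forall_compl_eq_zero fun x hx =>
      Function.extend_apply' φ (0 : BerkovichP1 K → ℝ) x hx).symm
  rw [h1, ← hχ.map_comap, hχ.integral_map]
  simp only [hχ.injective.extend_apply]

/-- The potential of `μ` in the affine chart. -/
theorem integral_log_norm_sub_of_isContinuousWeight (hK : ¬ IsUltrametricDist K)
    (hs : 0 < absExponent K) (hec : Continuous e) (he : ∀ x, ‖x‖ = ‖e x‖ ^ absExponent K)
    (hΩ : omegaCan K = (fsMeasure (absExponent K)).map (chartZero e))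
    {g : BerkovichP1 K → ℝ} {μ : Measure (BerkovichP1 K)} (hg : IsContinuousWeight g μ) (w : ℂ) :
    (μ.comap (chartZero e)).real Set.univ = 1 ∧ μ.comap (chartZero e) {w} = 0 ∧
      Integrable (fun y => Real.log ‖y - w‖) (μ.comap (chartZero e)) ∧
      absExponent K * ∫ y, Real.log ‖y - w‖ ∂μ.comap (chartZero e) =
        logPairNorm (absExponent K) w + (g (chartZero e w) - g OnePoint.infty) := by
  have := hg.isProbabilityMeasure
  have hχ := measurableEmbedding_chartZero hs he
  have hfs := isProbabilityMeasure_fsMeasure hs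
  have hfin : IsFiniteMeasure (μ.comap (chartZero e)) := by
    refine ⟨?_⟩
    rw [hχ.comap_apply]
    exact measure_lt_top _ _
  have hcomap : (omegaCan K).comap (chartZero e) = fsMeasure (absExponent K) := by
    rw [hΩ, hχ.comap_map]
  have hlap := hg.laplacian
  rw [HasLaplacian, if_neg hK] at hlap
  obtain ⟨h1, h2, h3, h4⟩ := integral_log_norm_sub_eq (m₁ := μ.comap (chartZero e))
    (m₂ := fsMeasure (absExponent K)) (s := absExponent K) (G := fun z => g (chartZero e z))
    (L := g OnePoint.infty)
    (hg.continuous.comp (isOpenEmbedding_chartZero hs he).continuous)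
    ((hg.continuous.tendsto _).comp (tendsto_chartZero hs he))
    (fun φ hφ hφc => by
      have := hlap e hec _ (Or.inl rfl) φ hφ hφc
      rwa [integral_extend_chartZero hs he, integral_extend_chartZero hs he, hcomap] at this)
    (fun w => (integrable_and_integral_log_norm_sub_fsMeasure hs w).1) w
  refine ⟨h1, h2, h3, ?_⟩
  rw [(integrable_and_integral_log_norm_sub_fsMeasure hs w).2] at h4
  rw [sub_eq_iff_eq_add.1 h4, logPairNorm]
  field_simp
  ring

theorem map_comap_chartZero {s : ℝ} (hs : 0 < s) (he : ∀ x, ‖x‖ = ‖e x‖ ^ s)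
    {μ : Measure (BerkovichP1 K)} [IsProbabilityMeasure μ]
    (h : (μ.comap (chartZero e)).real Set.univ = 1) :
    (μ.comap (chartZero e)).map (chartZero e) = μ := by
  have hχ := measurableEmbedding_chartZero hs he
  rw [hχ.map_comap]
  refine Measure.restrict_eq_self_of_ae_mem ?_
  rw [measureReal_def, hχ.comap_apply, Set.image_univ, ENNReal.toReal_eq_one_iff] at h
  exact (prob_compl_eq_zero_iff hχ.measurableSet_range).2 h

theorem measurable_logPairNorm (s : ℝ) : Measurable (logPairNorm s) := by
  unfold logPairNorm
  fun_prop

theorem logPairNorm_le {s : ℝ} (hs : 0 < s) (z : ℂ) :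
    logPairNorm s z ≤ Real.log 2 / 2 + s * |Real.log ‖z‖| := by
  have hmul : 0 ≤ s * |Real.log ‖z‖| := by positivity
  rw [logPairNorm]
  rcases le_total ‖z‖ 1 with h | h
  · have h1 : ‖z‖ ^ (2 * s) ≤ 1 := Real.rpow_le_one (norm_nonneg z) h (by positivity)
    have h2 : Real.log (1 + ‖z‖ ^ (2 * s)) ≤ Real.log 2 :=
      Real.log_le_log (by positivity) (by linarith)
    linarith
  · have h0 : 0 < ‖z‖ := one_pos.trans_le h
    have h1 : 1 ≤ ‖z‖ ^ (2 * s) := Real.one_le_rpow h (by positivity)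
    have h2 : Real.log (1 + ‖z‖ ^ (2 * s)) ≤ Real.log (2 * ‖z‖ ^ (2 * s)) :=
      Real.log_le_log (by positivity) (by linarith)
    rw [Real.log_mul two_ne_zero (by positivity), Real.log_rpow h0] at h2
    have h3 := mul_le_mul_of_nonneg_left (le_abs_self (Real.log ‖z‖)) hs.le
    linarith

theorem exists_potential_eq_of_not_ultrametric (hK : ¬ IsUltrametricDist K)
    (hs : 0 < absExponent K) (hec : Continuous e) (he : ∀ x, ‖x‖ = ‖e x‖ ^ absExponent K)
    (hΩ : omegaCan K = (fsMeasure (absExponent K)).map (chartZero e))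
    {g : BerkovichP1 K → ℝ} {μ : Measure (BerkovichP1 K)} (hg : IsContinuousWeight g μ) :
    ∃ κ : ℝ, ∀ x, g x + κ ≤ 0 ∧
      ∫⁻ y, negLog (hsia x y) ∂μ = ENNReal.ofReal (-(g x + κ)) := by
  have := hg.isProbabilityMeasure
  have hχ := measurableEmbedding_chartZero hs he
  have hpot := integral_log_norm_sub_of_isContinuousWeight hK hs hec he hΩ hg
  set m := μ.comap (chartZero e) with hm
  have hmap : m.map (chartZero e) = μ := map_comap_chartZero hs he (hpot 0).1
  have hmass : m.real Set.univ = 1 := (hpot 0).1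
  have hfin : IsFiniteMeasure m := by
    refine ⟨?_⟩
    rw [hm, hχ.comap_apply]
    exact measure_lt_top _ _
  have hNi : Integrable (logPairNorm (absExponent K)) m := by
    have h0 := (hpot 0).2.2.1
    simp only [sub_zero] at h0
    refine ((integrable_const (Real.log 2 / 2)).add (h0.abs.const_mul (absExponent K))).mono'
      (measurable_logPairNorm _).aestronglyMeasurable (Eventually.of_forall fun z => ?_)
    rw [Real.norm_of_nonneg (logPairNorm_nonneg _ z)]
    exact logPairNorm_le hs z
  set J := ∫ z, logPairNorm (absExponent K) z ∂m with hJ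
  have hle (x y : BerkovichP1 K) : hsia x y ≤ 1 := by
    obtain ⟨z, rfl⟩ := classical_surjective hs he x
    obtain ⟨w, rfl⟩ := classical_surjective hs he y
    rw [hsia_classical_classical hK]
    exact chordal_le_one_of_not_ultrametric hK z w
  refine ⟨-g OnePoint.infty - J, fun x => ?_⟩
  have hlin : ∫⁻ y, negLog (hsia x y) ∂μ = ∫⁻ z, negLog (hsia x (chartZero e z)) ∂m := by
    conv_lhs => rw [← hmap]
    exact hχ.lintegral_map _
  rw [hlin]
  rcases exists_chartZero_eq_or hs he x with rfl | ⟨w, rfl⟩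
  · have h1 (z : ℂ) : negLog (hsia OnePoint.infty (chartZero e z)) =
        ENNReal.ofReal (logPairNorm (absExponent K) z) := by
      rw [negLog_of_pos, log_hsia_infty_chart hK he, neg_neg]
      rw [hsia_infty_chart hK]
      exact inv_pos.2 (norm2_one_pos _)
    simp only [h1]
    rw [← ofReal_integral_eq_lintegral_ofReal hNi
      (Eventually.of_forall (logPairNorm_nonneg _)), ← hJ]
    have hJ0 : 0 ≤ J := integral_nonneg (logPairNorm_nonneg _)
    exact ⟨by linarith, by congr 1; ring⟩
  · obtain ⟨-, hw, hi, hv⟩ := hpot w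
    have hae : ∀ᵐ z ∂m, z ≠ w := compl_mem_ae_iff.2 hw
    set u : ℂ → ℝ := fun z => logPairNorm (absExponent K) w + logPairNorm (absExponent K) z -
      absExponent K * Real.log ‖z - w‖ with hu
    have hueq (z : ℂ) (hz : z ≠ w) :
        u z = -Real.log (hsia (chartZero e w) (chartZero e z)) := by
      rw [log_hsia_chart_chart hK he hz]
      simp only [hu]; ring
    have hu0 : 0 ≤ᵐ[m] u := by
      filter_upwards [hae] with z hz
      rw [hueq z hz, Pi.zero_apply, neg_nonneg]
      exact Real.log_nonpos (hsia_chart_chart_pos hK hz).le (hle _ _)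
    have hui : Integrable u m :=
      ((integrable_const _).add hNi).sub (hi.const_mul _)
    have h1 : ∫⁻ z, negLog (hsia (chartZero e w) (chartZero e z)) ∂m =
        ∫⁻ z, ENNReal.ofReal (u z) ∂m := by
      refine lintegral_congr_ae ?_
      filter_upwards [hae] with z hz
      rw [hueq z hz, negLog_of_pos (hsia_chart_chart_pos hK hz)]
    have hint : ∫ z, u z ∂m = -(g (chartZero e w) + (-g OnePoint.infty - J)) := by
      have h2 : Integrable (fun z => logPairNorm (absExponent K) w +
          logPairNorm (absExponent K) z) m := (integrable_const _).add hNi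
      simp only [hu]
      rw [integral_sub h2 (hi.const_mul _), integral_add (integrable_const _) hNi,
        integral_const_mul, hv, integral_const, hmass, ← hJ]
      simp only [one_smul]
      ring
    rw [h1, ← ofReal_integral_eq_lintegral_ofReal hui hu0, hint]
    refine ⟨?_, rfl⟩
    have := integral_nonneg_of_ae hu0
    rw [hint] at this
    linarith

end ArchimedeanPotential

/-! ### Energies of probability measures over an archimedean field -/

section PowerSeriesKernel

variable {X ι : Type*} [MeasurableSpace X] {v : ι → X → ℝ}

theorem integrable_prod_of_abs_le_one (hv : ∀ i, Measurable (v i)) (hv1 : ∀ i x, |v i x| ≤ 1)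
    (μ : Measure X) [IsFiniteMeasure μ] {N : ℕ} (κ : Fin N → ι) :
    Integrable (fun x => ∏ j, v (κ j) x) μ := by
  refine Integrable.of_bound (C := 1) (Finset.measurable_fun_prod _ fun j _ =>
    hv (κ j)).aestronglyMeasurable (Eventually.of_forall fun x => ?_)
  rw [Real.norm_eq_abs, Finset.abs_prod]
  exact Finset.prod_le_one (fun _ _ => abs_nonneg _) fun j _ => hv1 (κ j) x

variable [Fintype ι]

theorem lintegral_pow_eq (hv : ∀ i, Measurable (v i)) (hv1 : ∀ i x, |v i x| ≤ 1)
    (hv0 : ∀ x y, 0 ≤ ∑ i, v i x * v i y) (μ : Measure X) [IsFiniteMeasure μ] {c : ℝ} (hc : 0 ≤ c)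
    (N : ℕ) (x : X) :
    ∫⁻ y, ENNReal.ofReal (c * (∑ i, v i x * v i y) ^ N) ∂μ =
      ENNReal.ofReal (c * ∑ κ : Fin N → ι, (∏ j, v (κ j) x) * ∫ y, ∏ j, v (κ j) y ∂μ) := by
  have hexp (y : X) : c * (∑ i, v i x * v i y) ^ N =
      c * ∑ κ : Fin N → ι, (∏ j, v (κ j) x) * ∏ j, v (κ j) y := by
    rw [Fintype.sum_pow]
    simp only [Finset.prod_mul_distrib]
  have hi (κ : Fin N → ι) : Integrable (fun y => (∏ j, v (κ j) x) * ∏ j, v (κ j) y) μ :=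
    (integrable_prod_of_abs_le_one hv hv1 μ κ).const_mul _
  rw [← ofReal_integral_eq_lintegral_ofReal]
  · simp only [hexp]
    rw [integral_const_mul, integral_finsetSum _ fun κ _ => hi κ]
    simp only [integral_const_mul]
  · simp only [hexp]
    exact (integrable_finsetSum _ fun κ _ => hi κ).const_mul c
  · exact Eventually.of_forall fun y => mul_nonneg hc (pow_nonneg (hv0 x y) N)

theorem lintegral_lintegral_pow_eq (hv : ∀ i, Measurable (v i)) (hv1 : ∀ i x, |v i x| ≤ 1)
    (hv0 : ∀ x y, 0 ≤ ∑ i, v i x * v i y) (μ ν : Measure X) [IsFiniteMeasure μ]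
    [IsFiniteMeasure ν] {c : ℝ} (hc : 0 ≤ c) (N : ℕ) :
    ∫⁻ x, ∫⁻ y, ENNReal.ofReal (c * (∑ i, v i x * v i y) ^ N) ∂μ ∂ν =
      ENNReal.ofReal (c * ∑ κ : Fin N → ι,
        (∫ x, ∏ j, v (κ j) x ∂ν) * ∫ y, ∏ j, v (κ j) y ∂μ) := by
  have hi (κ : Fin N → ι) : Integrable
      (fun x => (∏ j, v (κ j) x) * ∫ y, ∏ j, v (κ j) y ∂μ) ν :=
    (integrable_prod_of_abs_le_one hv hv1 ν κ).mul_const _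
  simp only [lintegral_pow_eq hv hv1 hv0 μ hc N]
  rw [← ofReal_integral_eq_lintegral_ofReal]
  · rw [integral_const_mul, integral_finsetSum _ fun κ _ => hi κ]
    simp only [integral_mul_const]
  · exact (integrable_finsetSum _ fun κ _ => hi κ).const_mul c
  · refine Eventually.of_forall fun x => ?_
    have hexp (y : X) : (∑ i, v i x * v i y) ^ N =
        ∑ κ : Fin N → ι, (∏ j, v (κ j) x) * ∏ j, v (κ j) y := by
      rw [Fintype.sum_pow]
      simp only [Finset.prod_mul_distrib]
    have h2 : ∑ κ : Fin N → ι, (∏ j, v (κ j) x) * ∫ y, ∏ j, v (κ j) y ∂μ =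
        ∫ y, (∑ i, v i x * v i y) ^ N ∂μ := by
      simp only [hexp]
      rw [integral_finsetSum _ fun κ _ =>
        (integrable_prod_of_abs_le_one hv hv1 μ κ).const_mul _]
      simp only [integral_const_mul]
    simp only [Pi.zero_apply, h2]
    exact mul_nonneg hc (integral_nonneg fun y => pow_nonneg (hv0 x y) N)

/-- A kernel `∑ cₙ ⟨v(x), v(y)⟩ⁿ` with non-negative coefficients is positive semidefinite. -/
theorem two_mul_lintegral_tsum_pow_le (hv : ∀ i, Measurable (v i)) (hv1 : ∀ i x, |v i x| ≤ 1)
    (hv0 : ∀ x y, 0 ≤ ∑ i, v i x * v i y) (μ ν : Measure X) [IsFiniteMeasure μ]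
    [IsFiniteMeasure ν] {c : ℕ → ℝ} (hc : ∀ n, 0 ≤ c n) :
    2 * ∫⁻ x, ∫⁻ y, ∑' n, ENNReal.ofReal (c n * (∑ i, v i x * v i y) ^ n) ∂μ ∂ν ≤
      (∫⁻ x, ∫⁻ y, ∑' n, ENNReal.ofReal (c n * (∑ i, v i x * v i y) ^ n) ∂ν ∂ν) +
        ∫⁻ x, ∫⁻ y, ∑' n, ENNReal.ofReal (c n * (∑ i, v i x * v i y) ^ n) ∂μ ∂μ := by
  have key (μ ν : Measure X) [IsFiniteMeasure μ] [IsFiniteMeasure ν] :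
      ∫⁻ x, ∫⁻ y, ∑' n, ENNReal.ofReal (c n * (∑ i, v i x * v i y) ^ n) ∂μ ∂ν =
        ∑' n, ENNReal.ofReal (c n * ∑ κ : Fin n → ι,
          (∫ x, ∏ j, v (κ j) x ∂ν) * ∫ y, ∏ j, v (κ j) y ∂μ) := by
    have h1 (x : X) : ∫⁻ y, ∑' n, ENNReal.ofReal (c n * (∑ i, v i x * v i y) ^ n) ∂μ =
        ∑' n, ∫⁻ y, ENNReal.ofReal (c n * (∑ i, v i x * v i y) ^ n) ∂μ := by
      refine lintegral_tsum fun n => Measurable.aemeasurable ?_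
      fun_prop
    simp only [h1]
    rw [lintegral_tsum]
    · exact tsum_congr fun n => lintegral_lintegral_pow_eq hv hv1 hv0 μ ν (hc n) n
    · intro n
      simp only [lintegral_pow_eq hv hv1 hv0 μ (hc n) n]
      refine Measurable.aemeasurable ?_
      fun_prop
  rw [key, key, key, ← ENNReal.tsum_mul_left, ← ENNReal.tsum_add]
  refine ENNReal.tsum_le_tsum fun n => ?_
  have hsq (μ : Measure X) : 0 ≤ c n * ∑ κ : Fin n → ι,
      (∫ x, ∏ j, v (κ j) x ∂μ) * ∫ y, ∏ j, v (κ j) y ∂μ :=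
    mul_nonneg (hc n) (Finset.sum_nonneg fun κ _ => mul_self_nonneg _)
  rw [← ENNReal.ofReal_add (hsq ν) (hsq μ), ← ENNReal.ofReal_ofNat 2,
    ← ENNReal.ofReal_mul zero_le_two]
  refine ENNReal.ofReal_le_ofReal ?_
  rw [← mul_add, mul_left_comm, ← Finset.sum_add_distrib, Finset.mul_sum]
  refine mul_le_mul_of_nonneg_left (Finset.sum_le_sum fun κ _ => ?_) (hc n)
  nlinarith [sq_nonneg ((∫ x, ∏ j, v (κ j) x ∂ν) - ∫ y, ∏ j, v (κ j) y ∂μ)]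

end PowerSeriesKernel

/-! ### The logarithmic kernel of the Riemann sphere -/

section SphereKernel

theorem tsum_ofReal_pow_div_eq {t : ℝ} (h0 : 0 ≤ t) (h1 : t < 1) :
    ∑' n : ℕ, ENNReal.ofReal ((2 * (n : ℝ))⁻¹ * t ^ n) =
      ENNReal.ofReal (-Real.log (1 - t) / 2) := by
  have h := (Real.hasSum_pow_div_log_of_abs_lt_one (x := t) (by rwa [abs_of_nonneg h0])).div_const 2
  have h' : HasSum (fun n : ℕ => (2 * (n : ℝ))⁻¹ * t ^ n) (-Real.log (1 - t) / 2) := by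
    rw [← hasSum_nat_add_iff' 1]
    simp only [Finset.sum_range_one, Nat.cast_zero, mul_zero, inv_zero, zero_mul, sub_zero]
    refine h.congr_fun fun n => ?_
    push_cast
    field_simp
  rw [← ENNReal.ofReal_tsum_of_nonneg (fun n => by positivity) h'.summable, h'.tsum_eq]

theorem tsum_ofReal_inv_eq_top : ∑' n : ℕ, ENNReal.ofReal ((2 * (n : ℝ))⁻¹ * 1 ^ n) = ⊤ := by
  by_contra h
  have h1 := ENNReal.summable_toReal h
  refine Real.not_summable_natCast_inv ((h1.mul_left 2).congr fun n => ?_)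
  rw [one_pow, mul_one, ENNReal.toReal_ofReal (by positivity), mul_inv]
  ring

/-- Coordinates of the (rank one, Hermitian) projection onto the line `[z : 1]`. -/
def sphereVec (i : Fin 4) (z : ℂ) : ℝ :=
  ![‖z‖ ^ 2, 1, Real.sqrt 2 * z.re, Real.sqrt 2 * z.im] i / (1 + ‖z‖ ^ 2)

/-- Coordinates of the projection onto the line `[1 : 0]`. -/
def sphereVecInfty (i : Fin 4) : ℝ := ![1, 0, 0, 0] i

theorem measurable_sphereVec (i : Fin 4) : Measurable (sphereVec i) := by
  unfold sphereVec
  fin_cases i <;> simp <;> fun_prop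

theorem norm_sq_eq (z : ℂ) : ‖z‖ ^ 2 = z.re ^ 2 + z.im ^ 2 := by
  rw [Complex.sq_norm, Complex.normSq_apply]; ring

theorem sum_sphereVec_mul (z w : ℂ) : ∑ i, sphereVec i z * sphereVec i w =
    (‖z‖ ^ 2 * ‖w‖ ^ 2 + 1 + 2 * (z.re * w.re + z.im * w.im)) /
      ((1 + ‖z‖ ^ 2) * (1 + ‖w‖ ^ 2)) := by
  have h2 : Real.sqrt 2 * Real.sqrt 2 = 2 := Real.mul_self_sqrt zero_le_two
  simp only [sphereVec, Fin.sum_univ_four, Matrix.cons_val]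
  rw [div_mul_div_comm, div_mul_div_comm, div_mul_div_comm, div_mul_div_comm, ← add_div, ← add_div,
    ← add_div]
  congr 1
  linear_combination (z.re * w.re + z.im * w.im) * h2

theorem one_sub_sum_sphereVec_mul (z w : ℂ) : 1 - ∑ i, sphereVec i z * sphereVec i w =
    ‖z - w‖ ^ 2 / ((1 + ‖z‖ ^ 2) * (1 + ‖w‖ ^ 2)) := by
  rw [sum_sphereVec_mul, eq_div_iff (by positivity), sub_mul, div_mul_cancel₀ _ (by positivity)]
  simp only [norm_sq_eq, Complex.sub_re, Complex.sub_im]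
  ring

theorem sum_sphereVec_mul_nonneg (z w : ℂ) : 0 ≤ ∑ i, sphereVec i z * sphereVec i w := by
  rw [sum_sphereVec_mul]
  refine div_nonneg ?_ (by positivity)
  simp only [norm_sq_eq]
  nlinarith [sq_nonneg (z.re * w.re + z.im * w.im + 1), sq_nonneg (z.im * w.re - z.re * w.im)]

theorem sum_sphereVecInfty_mul (z : ℂ) :
    ∑ i, sphereVecInfty i * sphereVec i z = ‖z‖ ^ 2 / (1 + ‖z‖ ^ 2) := by
  simp [sphereVec, sphereVecInfty, Fin.sum_univ_four]

theorem sum_sphereVecInfty_mul_self : ∑ i, sphereVecInfty i * sphereVecInfty i = 1 := by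
  simp [sphereVecInfty, Fin.sum_univ_four]

theorem abs_le_one_of_sum_mul_self {ι : Type*} [Fintype ι] {a : ι → ℝ} (h : ∑ i, a i * a i = 1)
    (i : ι) : |a i| ≤ 1 := by
  rw [← sq_le_one_iff_abs_le_one, ← h, sq]
  exact Finset.single_le_sum (f := fun i => a i * a i) (fun j _ => mul_self_nonneg _)
    (Finset.mem_univ i)

/-- The difference between `log ‖(z, 1)‖` for the absolute values `|·|^s` and `|·|`, suitably
normalized. -/
def logPairNormDefect (s : ℝ) (z : ℂ) : ℝ := logPairNorm s z - s * (Real.log (1 + ‖z‖ ^ 2) / 2)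

theorem measurable_logPairNormDefect (s : ℝ) : Measurable (logPairNormDefect s) := by
  have := measurable_logPairNorm s
  unfold logPairNormDefect
  fun_prop

theorem logPairNormDefect_nonneg {s : ℝ} (hs : 0 < s) (hs1 : s ≤ 1) (z : ℂ) :
    0 ≤ logPairNormDefect s z := by
  have h := NNReal.rpow_add_le_add_rpow 1 (‖z‖₊ ^ 2) hs.le hs1
  have h' : (1 + ‖z‖ ^ 2) ^ s ≤ 1 + ‖z‖ ^ (2 * s) := by
    rw [Real.rpow_mul (norm_nonneg z), Real.rpow_two]
    simpa using NNReal.coe_le_coe.2 h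
  have h2 := Real.log_le_log (by positivity) h'
  rw [Real.log_rpow (by positivity)] at h2
  rw [logPairNormDefect, logPairNorm]
  linarith

end SphereKernel

section ArchimedeanEnergy

variable {K : Type*} [NontriviallyNormedField K] [IsAlgClosed K] {e : K ≃+* ℂ}

/-- The extension of `sphereVec` to the projective line. -/
def sphereVecP1 (e : K ≃+* ℂ) (i : Fin 4) : BerkovichP1 K → ℝ :=
  Function.extend (chartZero e) (sphereVec i) fun _ => sphereVecInfty i

/-- The extension by zero of `logPairNormDefect` to the projective line. -/
def defectP1 (e : K ≃+* ℂ) (s : ℝ) : BerkovichP1 K → ℝ :=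
  Function.extend (chartZero e) (logPairNormDefect s) fun _ => 0

theorem negLog_hsia_eq (hK : ¬ IsUltrametricDist K)
    (hs : 0 < absExponent K) (he : ∀ x, ‖x‖ = ‖e x‖ ^ absExponent K) (x y : BerkovichP1 K) :
    0 ≤ ∑ i, sphereVecP1 e i x * sphereVecP1 e i y ∧ negLog (hsia x y) =
      ENNReal.ofReal (absExponent K) * ∑' n : ℕ, ENNReal.ofReal ((2 * (n : ℝ))⁻¹ *
        (∑ i, sphereVecP1 e i x * sphereVecP1 e i y) ^ n) +
      ENNReal.ofReal (defectP1 e (absExponent K) x) +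
      ENNReal.ofReal (defectP1 e (absExponent K) y) := by
  have hinj := (isOpenEmbedding_chartZero hs he).injective
  have hs1 := absExponent_le_one K
  set s := absExponent K with hsdef
  have hvc (i : Fin 4) (z : ℂ) : sphereVecP1 e i (chartZero e z) = sphereVec i z :=
    hinj.extend_apply _ _ _
  have hno : ¬ ∃ z, chartZero e z = OnePoint.infty := by
    rintro ⟨z, hz⟩
    exact chartZero_ne_infty z hz
  have hvi (i : Fin 4) : sphereVecP1 e i OnePoint.infty = sphereVecInfty i :=
    Function.extend_apply' _ _ _ hno
  have hdc (z : ℂ) : defectP1 e s (chartZero e z) = logPairNormDefect s z :=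
    hinj.extend_apply _ _ _
  have hdi : defectP1 e s (OnePoint.infty : BerkovichP1 K) = 0 :=
    Function.extend_apply' _ _ _ hno
  have htop (a b : ℝ≥0∞) : ENNReal.ofReal s * ⊤ + a + b = ⊤ := by
    rw [ENNReal.mul_top (by simpa using hs)]
    simp
  have hfin {t p q r : ℝ} (h0 : 0 ≤ t) (h1 : t < 1) (hp : 0 ≤ p) (hq : 0 ≤ q)
      (h : s * (-Real.log (1 - t) / 2) + p + q = r) :
      ENNReal.ofReal r = ENNReal.ofReal s * ∑' n : ℕ, ENNReal.ofReal ((2 * (n : ℝ))⁻¹ * t ^ n) +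
        ENNReal.ofReal p + ENNReal.ofReal q := by
    have hl : 0 ≤ -Real.log (1 - t) / 2 := by
      have := Real.log_nonpos (by linarith : 0 ≤ 1 - t) (by linarith)
      linarith
    have hsl : 0 ≤ s * (-Real.log (1 - t) / 2) := mul_nonneg hs.le hl
    rw [tsum_ofReal_pow_div_eq h0 h1, ← ENNReal.ofReal_mul hs.le, ← ENNReal.ofReal_add hsl hp,
      ← ENNReal.ofReal_add (by positivity) hq, h]
  have hd0 (z : ℂ) : 0 ≤ logPairNormDefect s z := logPairNormDefect_nonneg hs hs1 z
  have hinfty (z : ℂ) : 0 ≤ ∑ i, sphereVecInfty i * sphereVec i z ∧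
      negLog (hsia OnePoint.infty (chartZero e z)) =
        ENNReal.ofReal s * ∑' n : ℕ, ENNReal.ofReal ((2 * (n : ℝ))⁻¹ *
          (∑ i, sphereVecInfty i * sphereVec i z) ^ n) +
        ENNReal.ofReal 0 + ENNReal.ofReal (logPairNormDefect s z) := by
    have h0 : 0 < hsia OnePoint.infty (chartZero e z) := by
      rw [hsia_infty_chart hK]
      exact inv_pos.2 (norm2_one_pos _)
    rw [sum_sphereVecInfty_mul, negLog_of_pos h0]
    refine ⟨by positivity, hfin (by positivity) ?_ le_rfl (hd0 z) ?_⟩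
    · rw [div_lt_one (by positivity)]
      linarith
    · have : 1 - ‖z‖ ^ 2 / (1 + ‖z‖ ^ 2) = (1 + ‖z‖ ^ 2)⁻¹ := by
        field_simp
        ring
      rw [this, Real.log_inv, log_hsia_infty_chart hK he, logPairNormDefect]
      ring
  have hcomm (z : ℂ) : hsia (chartZero e z) OnePoint.infty =
      hsia OnePoint.infty (chartZero e z) := by
    rw [chartZero_eq, ← classical_infty, hsia_classical_classical hK,
      hsia_classical_classical hK, chordal_comm]
  rcases exists_chartZero_eq_or hs he x with rfl | ⟨w, rfl⟩ <;>
    rcases exists_chartZero_eq_or hs he y with rfl | ⟨z, rfl⟩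
  · simp only [hvi, hdi, sum_sphereVecInfty_mul_self, tsum_ofReal_inv_eq_top,
      hsia_infty_infty hK, negLog_zero, htop]
    exact ⟨zero_le_one, trivial⟩
  · simp only [hvi, hdi, hvc, hdc]
    exact hinfty z
  · simp only [hvi, hdi, hvc, hdc, hcomm, mul_comm (sphereVec _ w)]
    rw [add_right_comm]
    exact hinfty w
  · simp only [hvc, hdc]
    refine ⟨sum_sphereVec_mul_nonneg w z, ?_⟩
    have hsub := one_sub_sum_sphereVec_mul w z
    rcases eq_or_ne z w with rfl | hzw
    · have h1 : ∑ i, sphereVec i z * sphereVec i z = 1 := by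
        simp at hsub
        linarith
      rw [h1, tsum_ofReal_inv_eq_top, htop, hsia_chart_self hK, negLog_zero]
    · rw [negLog_of_pos (hsia_chart_chart_pos hK hzw)]
      have hn : 0 < ‖w - z‖ := norm_pos_iff.2 (sub_ne_zero.2 hzw.symm)
      refine hfin (sum_sphereVec_mul_nonneg w z) ?_ (hd0 w) (hd0 z) ?_
      · have : 0 < ‖w - z‖ ^ 2 / ((1 + ‖w‖ ^ 2) * (1 + ‖z‖ ^ 2)) := by positivity
        linarith
      · rw [hsub, log_hsia_chart_chart hK he hzw, Real.log_div (by positivity) (by positivity),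
          Real.log_mul (by positivity) (by positivity), Real.log_pow, norm_sub_rev w z,
          logPairNormDefect, logPairNormDefect]
        push_cast
        ring

theorem abs_sphereVecP1_le_one {s : ℝ} (hs : 0 < s) (he : ∀ x, ‖x‖ = ‖e x‖ ^ s) (i : Fin 4)
    (x : BerkovichP1 K) : |sphereVecP1 e i x| ≤ 1 := by
  rcases exists_chartZero_eq_or hs he x with rfl | ⟨w, rfl⟩
  · rw [sphereVecP1, Function.extend_apply' _ _ _ (by
      rintro ⟨z, hz⟩
      exact chartZero_ne_infty z hz)]
    exact abs_le_one_of_sum_mul_self sum_sphereVecInfty_mul_self i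
  · rw [sphereVecP1, (isOpenEmbedding_chartZero hs he).injective.extend_apply]
    refine abs_le_one_of_sum_mul_self (a := fun i => sphereVec i w) ?_ i
    have := one_sub_sum_sphereVec_mul w w
    simp at this
    linarith

theorem two_mul_energy_le_of_not_ultrametric (hK : ¬ IsUltrametricDist K)
    (hs : 0 < absExponent K) (he : ∀ x, ‖x‖ = ‖e x‖ ^ absExponent K)
    (μ ν : Measure (BerkovichP1 K)) [IsProbabilityMeasure μ] [IsProbabilityMeasure ν] :
    2 * ∫⁻ x, ∫⁻ y, negLog (hsia x y) ∂μ ∂ν ≤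
      (∫⁻ x, ∫⁻ y, negLog (hsia x y) ∂ν ∂ν) + ∫⁻ x, ∫⁻ y, negLog (hsia x y) ∂μ ∂μ := by
  have hχ := measurableEmbedding_chartZero hs he
  have hv (i : Fin 4) : Measurable (sphereVecP1 e i) :=
    hχ.measurable_extend (measurable_sphereVec i) measurable_const
  have hd : Measurable fun x => ENNReal.ofReal (defectP1 e (absExponent K) x) :=
    (hχ.measurable_extend (measurable_logPairNormDefect _) measurable_const).ennreal_ofReal
  have hsum := two_mul_lintegral_tsum_pow_le hv (abs_sphereVecP1_le_one hs he)
    (fun x y => (negLog_hsia_eq hK hs he x y).1) μ ν (c := fun n => (2 * (n : ℝ))⁻¹)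
    (fun n => by positivity)
  have key (μ ν : Measure (BerkovichP1 K)) [IsProbabilityMeasure μ] [IsProbabilityMeasure ν] :
      ∫⁻ x, ∫⁻ y, negLog (hsia x y) ∂μ ∂ν =
        ENNReal.ofReal (absExponent K) * (∫⁻ x, ∫⁻ y, ∑' n : ℕ, ENNReal.ofReal ((2 * (n : ℝ))⁻¹ *
          (∑ i, sphereVecP1 e i x * sphereVecP1 e i y) ^ n) ∂μ ∂ν) +
        ∫⁻ x, ENNReal.ofReal (defectP1 e (absExponent K) x) ∂ν +
        ∫⁻ x, ENNReal.ofReal (defectP1 e (absExponent K) x) ∂μ := by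
    simp only [fun x y => (negLog_hsia_eq hK hs he x y).2]
    have hin (x : BerkovichP1 K) : ∫⁻ y, (ENNReal.ofReal (absExponent K) *
          ∑' n : ℕ, ENNReal.ofReal ((2 * (n : ℝ))⁻¹ *
            (∑ i, sphereVecP1 e i x * sphereVecP1 e i y) ^ n) +
          ENNReal.ofReal (defectP1 e (absExponent K) x) +
          ENNReal.ofReal (defectP1 e (absExponent K) y)) ∂μ =
        ENNReal.ofReal (absExponent K) * (∫⁻ y, ∑' n : ℕ, ENNReal.ofReal ((2 * (n : ℝ))⁻¹ *
          (∑ i, sphereVecP1 e i x * sphereVecP1 e i y) ^ n) ∂μ) +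
        ENNReal.ofReal (defectP1 e (absExponent K) x) +
        ∫⁻ y, ENNReal.ofReal (defectP1 e (absExponent K) y) ∂μ := by
      rw [lintegral_add_right _ hd, lintegral_add_right _ measurable_const,
        lintegral_const_mul' _ _ ENNReal.ofReal_ne_top]
      simp
    simp only [hin]
    rw [lintegral_add_right _ measurable_const, lintegral_add_right _ hd,
      lintegral_const_mul' _ _ ENNReal.ofReal_ne_top]
    simp
  rw [key μ ν, key ν ν, key μ μ]
  have h := mul_le_mul_right hsum (ENNReal.ofReal (absExponent K))
  rw [mul_add, mul_left_comm] at h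
  have alg {A B C a b : ℝ≥0∞} (h : 2 * A ≤ B + C) :
      2 * (A + a + b) ≤ (B + a + a) + (C + b + b) := by
    calc 2 * (A + a + b) = 2 * A + (2 * a + 2 * b) := by ring
      _ ≤ B + C + (2 * a + 2 * b) := by gcongr
      _ = _ := by ring
  exact alg h

theorem potentialTheory_of_not_ultrametric [CompleteSpace K] (hK : ¬ IsUltrametricDist K) :
    PotentialTheory K := by
  obtain ⟨hs, e, hec, he, hΩ⟩ := exists_chart hK
  have hsurj := classical_surjective hs he
  have hcomm (x y : BerkovichP1 K) : hsia x y = hsia y x := by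
    obtain ⟨z, rfl⟩ := hsurj x
    obtain ⟨w, rfl⟩ := hsurj y
    rw [hsia_classical_classical hK, hsia_classical_classical hK, chordal_comm]
  have hcl (x : BerkovichP1 K) (w : OnePoint K) : hsia x (classical w) = chordalTo x w := by
    obtain ⟨z, rfl⟩ := hsurj x
    rw [hsia_classical_classical hK, chordalTo_classical]
  refine ⟨hsurj.denseRange, hcl, fun x y => ?_, hcomm, fun x => ?_,
    fun g₁ g₂ μ h₁ h₂ => ?_,
    fun g μ hg => exists_potential_eq_of_not_ultrametric hK hs hec he hΩ hg,
    fun μ ν hμ hν => two_mul_energy_le_of_not_ultrametric hK hs he μ ν⟩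
  · obtain ⟨z, rfl⟩ := hsurj x
    obtain ⟨w, rfl⟩ := hsurj y
    rw [hsia_classical_classical hK]
    exact chordal_le_one_of_not_ultrametric hK z w
  · obtain ⟨w, rfl⟩ := hsurj x
    have : hsia (classical w) = fun y => chordalTo y w := funext fun y => by rw [hcomm, hcl]
    rw [this]
    exact (continuous_chordalTo w).measurable
  · refine ⟨g₁ OnePoint.infty - g₂ OnePoint.infty, fun x => ?_⟩
    rcases exists_chartZero_eq_or hs he x with rfl | ⟨w, rfl⟩
    · ring
    · have e₁ := (integral_log_norm_sub_of_isContinuousWeight hK hs hec he hΩ h₁ w).2.2.2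
      have e₂ := (integral_log_norm_sub_of_isContinuousWeight hK hs hec he hΩ h₂ w).2.2.2
      linarith

end ArchimedeanEnergy

end BerkovichDynamics

end

theorem proximity_function_riesz_decomposition {K : Type*} [NontriviallyNormedField K]
    [IsAlgClosed K] [CompleteSpace K] (f : RatFunc K) (hf : 1 < ratDegree f)
    (μf : Measure (BerkovichP1 K)) (hμf : IsEquilibriumMeasure f μf)
    (gf : BerkovichP1 K → ℝ) (hgf : IsNormalizedWeight gf μf)
    (n : ℕ) (hn : 1 ≤ n) (x : BerkovichP1 K) :
    logProximity f n gf x =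
      potential gf (fixMeasure f n) x + eintegral μf (logProximity f n gf) := by
  by_cases hK : IsUltrametricDist K
  · exact potentialTheory_of_ultrametric.riesz_decomposition f hf μf hμf gf hgf n hn x
  · exact (potentialTheory_of_not_ultrametric hK).riesz_decomposition f hf μf hμf gf hgf n hn x
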